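/- arXiv:2308.06569 — 3 statements merged into one kernel-verified Lean document; each statement's English description precedes it below -/
import Mathlib

section
/- (Wick's theorem for the free-field Gaussian measure, Proposition 1.3, stated in coordinates.) Let γ be the standard complex Gaussian measure on ℂ, i.e. the measure with density z ↦ π⁻¹ exp(−|z|²) with respect to Lebesgue measure on ℂ ≅ ℝ², and let μ := ⊗_{k∈ℕ} γ be the countable product measure on ℂ^ℕ, with coordinates ω = (ω_k)_{k∈ℕ}. Fix n ∈ ℕ, indices κ(1),…,κ(n) ∈ ℕ, and for each i ∈ {1,…,n} let c_i : ℂ^ℕ → ℂ be either c_i(ω) = ω_{κ(i)} or c_i(ω) = conj(ω_{κ(i)}). Then the product c_1 ⋯ c_n is μ-integrable and ∫ c_1(ω) ⋯ c_n(ω) dμ(ω) = Σ_{Π ∈ M(n)} ∏_{{i,j} ∈ Π} ∫ c_i(ω) c_j(ω) dμ(ω), where M(n) denotes the set of complete pairings of {1,…,n}, i.e. partitions of {1,…,n} into unordered pairs (so that both sides vanish when n is odd, the sum over the empty set of pairings being 0). -/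
open MeasureTheory

/-- The standard complex Gaussian measure on `ℂ`, with density
`z ↦ π⁻¹ exp (−|z|²)` with respect to Lebesgue measure on `ℂ`. -/
noncomputable def gaussC : Measure ℂ :=
  volume.withDensity (fun z => ENNReal.ofReal (Real.exp (-(‖z‖) ^ 2) / Real.pi))

theorem measurable_gaussC_density :
    Measurable fun z : ℂ => ENNReal.ofReal (Real.exp (-(‖z‖) ^ 2) / Real.pi) := by
  fun_prop

theorem integral_gaussC (f : ℂ → ℂ) :
    ∫ z, f z ∂gaussC = ∫ z, (Real.exp (-(‖z‖) ^ 2) / Real.pi) • f z := by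
  rw [gaussC, integral_withDensity_eq_integral_toReal_smul measurable_gaussC_density
    (.of_forall fun _ => ENNReal.ofReal_lt_top)]
  congr! 3 with z
  exact ENNReal.toReal_ofReal (by positivity)

theorem integral_norm_pow_mul_exp_neg_sq (m : ℕ) :
    ∫ z : ℂ, ‖z‖ ^ m * Real.exp (-(‖z‖) ^ 2) = Real.pi * Real.Gamma (((m : ℝ) + 2) / 2) := by
  have h := Complex.integral_rpow_mul_exp_neg_rpow (p := 2) (q := m) one_le_two
    (by linarith [(Nat.cast_nonneg m : (0 : ℝ) ≤ m)])
  simpa only [Real.rpow_natCast, Real.rpow_two, mul_div_cancel_left₀ _ (two_ne_zero (α := ℝ))]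
    using h

theorem integrable_norm_pow_mul_exp_neg_sq (m : ℕ) :
    Integrable fun z : ℂ => ‖z‖ ^ m * Real.exp (-(‖z‖) ^ 2) := by
  refine Integrable.of_integral_ne_zero ?_
  rw [integral_norm_pow_mul_exp_neg_sq]
  exact (mul_pos Real.pi_pos (Real.Gamma_pos_of_pos (by positivity))).ne'

theorem integrable_gaussC_monomial (a b : ℕ) :
    Integrable (fun z : ℂ => z ^ a * starRingEnd ℂ z ^ b) gaussC := by
  rw [gaussC, integrable_withDensity_iff_integrable_smul' measurable_gaussC_density
    (.of_forall fun _ => ENNReal.ofReal_lt_top)]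
  refine ((integrable_norm_pow_mul_exp_neg_sq (a + b)).div_const Real.pi).mono
    (Measurable.aestronglyMeasurable (by fun_prop)) (.of_forall fun z => le_of_eq ?_)
  rw [ENNReal.toReal_ofReal (by positivity)]
  simp only [norm_smul, norm_div, norm_mul, norm_pow, RCLike.norm_conj, norm_norm]
  ring

theorem integral_gaussC_comp_mul (u : Circle) (f : ℂ → ℂ) :
    ∫ z, f (u * z) ∂gaussC = ∫ z, f z ∂gaussC := by
  rw [integral_gaussC, integral_gaussC]
  have h := (rotation u).measurePreserving.integral_comp
    (rotation u).toHomeomorph.measurableEmbedding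
    (fun z => (Real.exp (-(‖z‖) ^ 2) / Real.pi) • f z)
  simpa only [rotation_apply, norm_mul, Circle.norm_coe, one_mul] using h

/-- The moments of the standard complex Gaussian. -/
theorem integral_gaussC_monomial (a b : ℕ) :
    ∫ z, z ^ a * starRingEnd ℂ z ^ b ∂gaussC = if a = b then (a.factorial : ℂ) else 0 := by
  split_ifs with h
  · subst h
    have hpt (z : ℂ) : (Real.exp (-(‖z‖) ^ 2) / Real.pi) • (z ^ a * starRingEnd ℂ z ^ a) =
        ((‖z‖ ^ (2 * a) * Real.exp (-(‖z‖) ^ 2) / Real.pi : ℝ) : ℂ) := by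
      rw [← mul_pow, Complex.mul_conj', Complex.real_smul]
      push_cast
      ring
    simp_rw [integral_gaussC, hpt]
    rw [integral_complex_ofReal, integral_div, integral_norm_pow_mul_exp_neg_sq,
      mul_div_cancel_left₀ _ Real.pi_ne_zero]
    have : ((2 * a : ℕ) + 2 : ℝ) / 2 = a + 1 := by push_cast; ring
    rw [this, Real.Gamma_nat_eq_factorial]
    simp
  · have hab : (a : ℂ) - b ≠ 0 := sub_ne_zero.2 (by exact_mod_cast h)
    set u : Circle := Circle.exp (Real.pi / (a - b))
    have hu : (u : ℂ) ^ a * starRingEnd ℂ (u : ℂ) ^ b = -1 := by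
      rw [← Circle.coe_inv_eq_conj, ← Circle.exp_neg, Circle.coe_exp, Circle.coe_exp,
        ← Complex.exp_nat_mul, ← Complex.exp_nat_mul, ← Complex.exp_add, ← Complex.exp_pi_mul_I]
      congr 1
      push_cast
      field_simp
      ring
    have hpt (z : ℂ) : (u * z) ^ a * starRingEnd ℂ (u * z) ^ b =
        -(z ^ a * starRingEnd ℂ z ^ b) := by
      rw [map_mul, mul_pow, mul_pow, mul_mul_mul_comm, hu, neg_one_mul]
    have key := integral_gaussC_comp_mul u fun z => z ^ a * starRingEnd ℂ z ^ b
    simp_rw [hpt, integral_neg] at key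
    exact self_eq_neg.1 key.symm

theorem Fintype.card_equiv_eq_ite (A B : Type*) [DecidableEq A] [DecidableEq B] [Fintype A]
    [Fintype B] : Fintype.card (A ≃ B) =
      if Fintype.card A = Fintype.card B then (Fintype.card A).factorial else 0 := by
  split_ifs with h
  · exact Fintype.card_equiv (Fintype.equivOfCardEq h)
  · have : IsEmpty (A ≃ B) := ⟨fun e => h (Fintype.card_congr e)⟩
    exact Fintype.card_eq_zero

/-- The self-map glued from bijections between the positive and the negative points of each
colour. -/
def glueFiberEquivs {ι K : Type*} {κ : ι → K} {t : ι → Bool}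
    (e : ∀ k, {i // κ i = k ∧ t i = true} ≃ {i // κ i = k ∧ t i = false}) (i : ι) : ι :=
  if h : t i = true then e (κ i) ⟨i, rfl, h⟩ else
    (e (κ i)).symm ⟨i, rfl, Bool.eq_false_iff.2 h⟩

theorem glueFiberEquivs_of_true {ι K : Type*} {κ : ι → K} {t : ι → Bool}
    (e : ∀ k, {i // κ i = k ∧ t i = true} ≃ {i // κ i = k ∧ t i = false}) {k : K} {i : ι}
    (hi : κ i = k ∧ t i = true) : glueFiberEquivs e i = e k ⟨i, hi⟩ := by
  obtain ⟨rfl, h⟩ := hi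
  simp [glueFiberEquivs, h]

theorem glueFiberEquivs_of_false {ι K : Type*} {κ : ι → K} {t : ι → Bool}
    (e : ∀ k, {i // κ i = k ∧ t i = true} ≃ {i // κ i = k ∧ t i = false}) {k : K} {i : ι}
    (hi : κ i = k ∧ t i = false) : glueFiberEquivs e i = (e k).symm ⟨i, hi⟩ := by
  obtain ⟨rfl, h⟩ := hi
  simp [glueFiberEquivs, h]

/-- Involutions that preserve the colour `κ` and flip the sign `t` amount to a choice, for each
colour, of a bijection between the positive and the negative points of that colour. -/
def flipInvolutionEquiv {ι K : Type*} (κ : ι → K) (t : ι → Bool) :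
    {σ : ι → ι // ∀ i, σ (σ i) = i ∧ κ (σ i) = κ i ∧ t (σ i) = !t i} ≃
      ∀ k, {i // κ i = k ∧ t i = true} ≃ {i // κ i = k ∧ t i = false} where
  toFun σ k :=
    { toFun := fun i => ⟨σ.1 i, by simp [(σ.2 i).2, i.2]⟩
      invFun := fun i => ⟨σ.1 i, by simp [(σ.2 i).2, i.2]⟩
      left_inv := fun i => Subtype.ext (σ.2 i).1
      right_inv := fun i => Subtype.ext (σ.2 i).1 }
  invFun e := ⟨glueFiberEquivs e, fun i => by
    cases h : t i
    · have hj := ((e (κ i)).symm ⟨i, rfl, h⟩).2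
      rw [glueFiberEquivs_of_false e ⟨rfl, h⟩, glueFiberEquivs_of_true e hj]
      simp [hj.1, hj.2]
    · have hj := (e (κ i) ⟨i, rfl, h⟩).2
      rw [glueFiberEquivs_of_true e ⟨rfl, h⟩, glueFiberEquivs_of_false e hj]
      simp [hj.1, hj.2]⟩
  left_inv σ := by
    ext i
    cases h : t i <;> simp [glueFiberEquivs, h]
  right_inv e := by
    ext k i
    simp [glueFiberEquivs_of_true e i.2]

theorem card_flipInvolution {ι K : Type*} [Fintype ι] [DecidableEq ι] [Fintype K] [DecidableEq K]
    (κ : ι → K) (t : ι → Bool) :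
    (Finset.univ.filter fun σ : ι → ι =>
        ∀ i, σ (σ i) = i ∧ κ (σ i) = κ i ∧ t (σ i) = !t i).card =
      ∏ k, if (Finset.univ.filter fun i => κ i = k ∧ t i = true).card =
          (Finset.univ.filter fun i => κ i = k ∧ t i = false).card then
        (Finset.univ.filter fun i => κ i = k ∧ t i = true).card.factorial else 0 := by
  rw [← Fintype.card_subtype, Fintype.card_congr (flipInvolutionEquiv κ t), Fintype.card_pi]
  simp_rw [Fintype.card_equiv_eq_ite, Fintype.card_subtype]

/-- A finite product of functions of distinct coordinates is integrable for a product measure, and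
its integral factorizes. -/
theorem integral_infinitePi_prod {ι E : Type*} [MeasurableSpace E] (ν : ι → Measure E)
    [∀ i, IsProbabilityMeasure (ν i)] (s : Finset ι) (f : s → E → ℂ)
    (hf : ∀ k, Integrable (f k) (ν k)) :
    Integrable (fun ω : ι → E => ∏ k : s, f k (ω k)) (Measure.infinitePi ν) ∧
      ∫ ω : ι → E, ∏ k : s, f k (ω k) ∂Measure.infinitePi ν = ∏ k : s, ∫ x, f k x ∂ν k := by
  have hint : Integrable (fun x : s → E => ∏ k : s, f k (x k)) (Measure.pi fun k : s => ν k) :=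
    Integrable.fintype_prod hf
  constructor
  · rw [← Measure.infinitePi_map_restrict] at hint
    exact hint.comp_measurable (Finset.measurable_restrict s)
  · rw [← integral_fintype_prod_eq_prod]
    exact integral_restrict_infinitePi (s := s) ν hint.aestronglyMeasurable

theorem prod_letter_eq_prod_monomial {ι K : Type*} [Fintype ι] [Fintype K] [DecidableEq K]
    (κ : ι → K) (t : ι → Bool) (x : K → ℂ) :
    ∏ i, (if t i then x (κ i) else starRingEnd ℂ (x (κ i))) =
      ∏ k, x k ^ (Finset.univ.filter fun i => κ i = k ∧ t i = true).card *
        starRingEnd ℂ (x k) ^ (Finset.univ.filter fun i => κ i = k ∧ t i = false).card := by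
  rw [← Finset.prod_fiberwise Finset.univ κ]
  refine Finset.prod_congr rfl fun k _ => ?_
  calc _ = ∏ i with κ i = k, (if t i then x k else starRingEnd ℂ (x k)) :=
        Finset.prod_congr rfl fun i hi => by rw [(Finset.mem_filter.1 hi).2]
    _ = _ := by
        simp only [Finset.prod_ite, Finset.prod_const, Finset.filter_filter, Bool.not_eq_true]

/-- The mixed moments of independent standard complex Gaussians count the involutions matching
each coordinate with a conjugate of the same coordinate. -/
theorem integral_prod_letter [IsProbabilityMeasure gaussC] {ι : Type*} [Fintype ι]
    [DecidableEq ι] (κ : ι → ℕ) (t : ι → Bool) :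
    Integrable (fun ω : ℕ → ℂ => ∏ i, (if t i then ω (κ i) else starRingEnd ℂ (ω (κ i))))
        (Measure.infinitePi fun _ => gaussC) ∧
      ∫ ω : ℕ → ℂ, ∏ i, (if t i then ω (κ i) else starRingEnd ℂ (ω (κ i)))
        ∂(Measure.infinitePi fun _ => gaussC) =
        (Finset.univ.filter fun σ : ι → ι =>
          ∀ i, σ (σ i) = i ∧ κ (σ i) = κ i ∧ t (σ i) = !t i).card := by
  let s := Finset.univ.image κ
  let κ' : ι → s := fun i => ⟨κ i, Finset.mem_image_of_mem κ (Finset.mem_univ i)⟩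
  have h := integral_infinitePi_prod (fun _ : ℕ => gaussC) s _ fun k => integrable_gaussC_monomial
    (Finset.univ.filter fun i => κ' i = k ∧ t i = true).card
    (Finset.univ.filter fun i => κ' i = k ∧ t i = false).card
  have hprod (ω : ℕ → ℂ) := prod_letter_eq_prod_monomial κ' t fun k => ω k
  simp_rw [← hprod, integral_gaussC_monomial] at h
  refine ⟨h.1, h.2.trans ?_⟩
  have hcard := card_flipInvolution κ' t
  simp only [κ', Subtype.mk.injEq] at hcard ⊢
  rw [hcard]
  push_cast
  rfl

theorem integral_letter_mul_letter [IsProbabilityMeasure gaussC] (k l : ℕ) (a b : Bool) :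
    ∫ ω : ℕ → ℂ, (if a then ω k else starRingEnd ℂ (ω k)) *
        (if b then ω l else starRingEnd ℂ (ω l)) ∂(Measure.infinitePi fun _ => gaussC) =
      if l = k ∧ b = !a then 1 else 0 := by
  have h := (integral_prod_letter ![k, l] ![a, b]).2
  simp only [Fin.prod_univ_two] at h
  refine h.trans ?_
  have hσ (σ : Fin 2 → Fin 2) : (∀ i, σ (σ i) = i ∧ ![k, l] (σ i) = ![k, l] i ∧
      ![a, b] (σ i) = !(![a, b] i)) ↔ σ = ![1, 0] ∧ l = k ∧ b = !a := by
    constructor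
    · intro h
      have h0 : σ 0 = 1 := by
        by_contra hne
        have := (h 0).2.2
        rw [show σ 0 = 0 by omega] at this
        simp at this
      have h1 : σ 1 = 0 := h0 ▸ (h 0).1
      refine ⟨by ext i; fin_cases i <;> simp [h0, h1], ?_⟩
      simpa [h0] using (h 0).2
    · rintro ⟨rfl, rfl, rfl⟩
      simp [Fin.forall_fin_two]
  simp_rw [hσ]
  split_ifs with hc <;> simp [hc, Finset.filter_eq']

theorem eq_infinitePi_gaussC [IsProbabilityMeasure gaussC] (μ : Measure (ℕ → ℂ))
    (hμ : ∀ (s : Finset ℕ) (f : ℕ → Set ℂ), (∀ k, MeasurableSet (f k)) →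
      μ {ω | ∀ k ∈ s, ω k ∈ f k} = ∏ k ∈ s, gaussC (f k)) :
    μ = Measure.infinitePi fun _ => gaussC :=
  Measure.eq_infinitePi _ fun s f hf => hμ s f hf

/-- **Wick's theorem** for the free-field Gaussian measure, in coordinates.
`μ` is the countable product `⊗_{k∈ℕ} γ` of standard complex Gaussians, characterised as the
unique probability measure on `ℂ^ℕ` whose cylinder-set probabilities are products of
`γ`-probabilities.  Each `c i` is either the coordinate `ω ↦ ω (κ i)` or its complex conjugate.
Then the product `c_1 ⋯ c_n` is integrable and its integral is the sum over all complete
pairings (fixed-point-free involutions `σ` of `Fin n`, each unordered pair `{i, σ i}` counted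
once via the condition `i < σ i`) of the product of the pair integrals. -/
theorem wick_theorem (μ : Measure (ℕ → ℂ)) [IsProbabilityMeasure μ]
    (hμ : ∀ (s : Finset ℕ) (f : ℕ → Set ℂ), (∀ k, MeasurableSet (f k)) →
      μ {ω | ∀ k ∈ s, ω k ∈ f k} = ∏ k ∈ s, gaussC (f k))
    (n : ℕ) (κ : Fin n → ℕ) (c : Fin n → (ℕ → ℂ) → ℂ)
    (hc : ∀ i, (c i = fun ω => ω (κ i)) ∨ (c i = fun ω => (starRingEnd ℂ) (ω (κ i)))) :
    Integrable (fun ω => ∏ i, c i ω) μ ∧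
    ∫ ω, ∏ i, c i ω ∂μ =
      ∑ σ ∈ Finset.univ.filter (fun σ : Fin n → Fin n => ∀ i, σ (σ i) = i ∧ σ i ≠ i),
        ∏ i ∈ Finset.univ.filter (fun i : Fin n => i < σ i),
          ∫ ω, c i ω * c (σ i) ω ∂μ := by
  have : IsProbabilityMeasure gaussC :=
    ⟨by simpa using (hμ {0} (fun _ => Set.univ) fun _ => MeasurableSet.univ).symm⟩
  obtain rfl := eq_infinitePi_gaussC μ hμ
  have ht (i) : ∃ b : Bool, c i = fun ω => if b then ω (κ i) else starRingEnd ℂ (ω (κ i)) :=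
    (hc i).elim (fun h => ⟨true, by simpa using h⟩) fun h => ⟨false, by simpa using h⟩
  choose t ht using ht
  obtain rfl := funext ht
  refine ⟨(integral_prod_letter κ t).1, (integral_prod_letter κ t).2.trans ?_⟩
  simp_rw [integral_letter_mul_letter, Finset.prod_ite_zero, Finset.prod_const_one,
    Finset.sum_boole, Finset.filter_filter]
  refine congrArg Nat.cast (congrArg Finset.card (Finset.ext fun σ => ?_))
  simp only [Finset.mem_filter, Finset.mem_univ, true_and]
  refine ⟨fun h => ⟨fun i => ⟨(h i).1, fun hi => ?_⟩,
    fun i _ => (h i).2⟩, fun ⟨hσ, h⟩ i => ⟨(hσ i).1, ?_⟩⟩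
  · simpa [hi] using (h i).2.2
  · rcases (hσ i).2.lt_or_gt with hi | hi
    · have := h (σ i) (by rwa [(hσ i).1])
      rw [(hσ i).1] at this
      simp [this.1, this.2]
    · exact h i hi
end

section
/- (Lemma A.6, multilinear estimate for the triangle interaction.) There exists a constant C > 0 such that for all w₁, w₂, w₃ ∈ L^{3/2}(Λ; ℝ) and every continuous q : Λ → ℂ, |∫_Λ ∫_Λ ∫_Λ w₁(x−y) w₂(y−z) w₃(z−x) |q(x)|² |q(y)|² |q(z)|² dx dy dz| ≤ C ‖w₁‖_{L^{3/2}} ‖w₂‖_{L^{3/2}} ‖w₃‖_{L^{3/2}} ‖q‖_{H^{1/3}}⁶, where the right-hand side is interpreted in [0,∞] if ‖q‖_{H^{1/3}} = ∞. -/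
open MeasureTheory
open scoped ENNReal

noncomputable section

/-- The `k`-th Fourier coefficient `q̂(k) = ∫_Λ q(x) e^{−2πikx} dx` of `q : Λ → ℂ` on the torus
`Λ = ℝ/ℤ`. -/
def fourierCoeffC (q : AddCircle (1:ℝ) → ℂ) (k : ℤ) : ℂ :=
  ∫ x : AddCircle (1:ℝ), q x * fourier (-k) x

/-- The (possibly infinite) `H^{1/3}` norm `( Σ_k (1+|k|)^{2/3} |q̂(k)|² )^{1/2}` of `q`,
valued in `ℝ≥0∞`. -/
def HthirdNorm (q : AddCircle (1:ℝ) → ℂ) : ℝ≥0∞ :=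
  (∑' k : ℤ,
    ENNReal.ofReal ((1 + |(k:ℝ)|) ^ ((2:ℝ)/3) * ‖fourierCoeffC q k‖ ^ 2)) ^ ((1:ℝ)/2)

/-- Hölder's inequality for three functions with all exponents equal to `3`. -/
theorem lintegral_mul_mul_le_rpow_third {α : Type*} [MeasurableSpace α] {μ : Measure α}
    {f g h : α → ℝ≥0∞} (hf : AEMeasurable f μ) (hg : AEMeasurable g μ) (hh : AEMeasurable h μ) :
    ∫⁻ a, f a ^ (1 / 3 : ℝ) * g a ^ (1 / 3 : ℝ) * h a ^ (1 / 3 : ℝ) ∂μ ≤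
      ((∫⁻ a, f a ∂μ) * (∫⁻ a, g a ∂μ) * ∫⁻ a, h a ∂μ) ^ (1 / 3 : ℝ) := by
  have key := ENNReal.lintegral_prod_norm_pow_le (μ := μ) (Finset.univ : Finset (Fin 3))
    (f := ![f, g, h]) (by intro i _; fin_cases i <;> simpa) (p := fun _ => 1 / 3)
    (by norm_num) (by intros; norm_num)
  simp only [Fin.prod_univ_three] at key
  rw [ENNReal.mul_rpow_of_nonneg _ _ (by norm_num), ENNReal.mul_rpow_of_nonneg _ _ (by norm_num)]
  exact key

/-- An a.e. measurable `ℝ≥0∞`-valued function is dominated everywhere by a measurable function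
which is a.e. equal to it. -/
theorem AEMeasurable.exists_measurable_ge_ae_eq {α : Type*} [MeasurableSpace α] {μ : Measure α}
    {f : α → ℝ≥0∞} (hf : AEMeasurable f μ) :
    ∃ g : α → ℝ≥0∞, Measurable g ∧ f ≤ g ∧ g =ᵐ[μ] f := by
  classical
  obtain ⟨s, hs, hsm, hs0⟩ := exists_measurable_superset_of_null (ae_iff.1 hf.ae_eq_mk)
  refine ⟨s.piecewise (fun _ => ⊤) (hf.mk f), measurable_const.piecewise hsm hf.measurable_mk,
    fun x => ?_, ?_⟩
  · by_cases hx : x ∈ s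
    · simp [hx]
    · have : f x = hf.mk f x := by
        by_contra h
        exact hx (hs h)
      simp [hx, this]
  · have : ∀ᵐ x ∂μ, x ∉ s := by simpa [ae_iff] using hs0
    filter_upwards [this, hf.ae_eq_mk] with x hx hfx
    simp [hx, hfx]

variable {G : Type*} [AddCommGroup G] [MeasurableSpace G] [MeasurableAdd₂ G] [MeasurableNeg G]
  {μ : Measure G} [SFinite μ] [μ.IsAddLeftInvariant] [μ.IsNegInvariant]

/-- Young's inequality in trilinear form, with all exponents equal to `3 / 2`. -/
theorem lintegral_lintegral_young_three_halves {a b c : G → ℝ≥0∞} (ha : Measurable a)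
    (hb : Measurable b) (hc : Measurable c) :
    ∫⁻ u, ∫⁻ v, a u * b v * c (-u - v) ∂μ ∂μ ≤
      ((∫⁻ u, a u ^ (3 / 2 : ℝ) ∂μ) * (∫⁻ u, b u ^ (3 / 2 : ℝ) ∂μ) *
        ∫⁻ u, c u ^ (3 / 2 : ℝ) ∂μ) ^ (2 / 3 : ℝ) := by
  have split : ∀ r s t : ℝ≥0∞, r * s * t =
      (r ^ (3 / 2 : ℝ) * s ^ (3 / 2 : ℝ)) ^ (1 / 3 : ℝ) *
      (r ^ (3 / 2 : ℝ) * t ^ (3 / 2 : ℝ)) ^ (1 / 3 : ℝ) *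
      (s ^ (3 / 2 : ℝ) * t ^ (3 / 2 : ℝ)) ^ (1 / 3 : ℝ) := by
    have half : ∀ r : ℝ≥0∞, r = r ^ (1 / 2 : ℝ) * r ^ (1 / 2 : ℝ) := fun r => by
      rw [← ENNReal.rpow_add_of_nonneg _ _ (by norm_num) (by norm_num)]; norm_num
    intro r s t
    simp only [ENNReal.mul_rpow_of_nonneg _ _ (by norm_num : (0 : ℝ) ≤ 1 / 3), ← ENNReal.rpow_mul]
    norm_num only
    conv_lhs => rw [half r, half s, half t]
    ring
  have h1 : ∫⁻ p : G × G, a p.1 ^ (3 / 2 : ℝ) * b p.2 ^ (3 / 2 : ℝ) ∂μ.prod μ =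
      (∫⁻ u, a u ^ (3 / 2 : ℝ) ∂μ) * ∫⁻ u, b u ^ (3 / 2 : ℝ) ∂μ :=
    lintegral_prod_mul (ha.pow_const _).aemeasurable (hb.pow_const _).aemeasurable
  have h2 : ∫⁻ p : G × G, a p.1 ^ (3 / 2 : ℝ) * c (-p.1 - p.2) ^ (3 / 2 : ℝ) ∂μ.prod μ =
      (∫⁻ u, a u ^ (3 / 2 : ℝ) ∂μ) * ∫⁻ u, c u ^ (3 / 2 : ℝ) ∂μ := by
    rw [lintegral_prod _ (by fun_prop), ← lintegral_mul_const _ (by fun_prop)]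
    refine lintegral_congr fun u => ?_
    dsimp only
    rw [lintegral_const_mul _ (by fun_prop),
      lintegral_sub_left_eq_self (fun v => c v ^ (3 / 2 : ℝ))]
  have h3 : ∫⁻ p : G × G, b p.2 ^ (3 / 2 : ℝ) * c (-p.1 - p.2) ^ (3 / 2 : ℝ) ∂μ.prod μ =
      (∫⁻ u, b u ^ (3 / 2 : ℝ) ∂μ) * ∫⁻ u, c u ^ (3 / 2 : ℝ) ∂μ := by
    rw [lintegral_prod_symm _ (by fun_prop), ← lintegral_mul_const _ (by fun_prop)]
    refine lintegral_congr fun v => ?_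
    dsimp only
    rw [lintegral_const_mul _ (by fun_prop)]
    simp_rw [show ∀ u, -u - v = -v - u from fun u => by abel]
    rw [lintegral_sub_left_eq_self (fun u => c u ^ (3 / 2 : ℝ))]
  have key := lintegral_mul_mul_le_rpow_third (μ := μ.prod μ)
    (f := fun p : G × G => a p.1 ^ (3 / 2 : ℝ) * b p.2 ^ (3 / 2 : ℝ))
    (g := fun p : G × G => a p.1 ^ (3 / 2 : ℝ) * c (-p.1 - p.2) ^ (3 / 2 : ℝ))
    (h := fun p : G × G => b p.2 ^ (3 / 2 : ℝ) * c (-p.1 - p.2) ^ (3 / 2 : ℝ))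
    (by fun_prop) (by fun_prop) (by fun_prop)
  simp_rw [← split] at key
  rw [h1, h2, h3, lintegral_prod _ (by fun_prop)] at key
  refine key.trans_eq ?_
  rw [show (2 / 3 : ℝ) = 2 * (1 / 3) by norm_num, ENNReal.rpow_mul, ENNReal.rpow_two]
  congr 1
  ring

/-- The trilinear triangle form is bounded by `L^{3/2}` norms of the interactions and the `L³`
norm of the density. -/
theorem lintegral_triangle_le {a b c f : G → ℝ≥0∞} (ha : Measurable a)
    (hb : Measurable b) (hc : Measurable c) (hf : Measurable f) :
    ∫⁻ x, ∫⁻ y, ∫⁻ z, a (x - y) * b (y - z) * c (z - x) * f x * f y * f z ∂μ ∂μ ∂μ ≤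
      ((∫⁻ u, a u ^ (3 / 2 : ℝ) ∂μ) * (∫⁻ u, b u ^ (3 / 2 : ℝ) ∂μ) *
        ∫⁻ u, c u ^ (3 / 2 : ℝ) ∂μ) ^ (2 / 3 : ℝ) * ∫⁻ x, f x ^ 3 ∂μ := by
  have cube : ∀ r : ℝ≥0∞, (r ^ 3) ^ (1 / 3 : ℝ) = r := fun r => by
    rw [← ENNReal.rpow_natCast, ← ENNReal.rpow_mul]; norm_num
  have inner : ∀ u v : G, ∫⁻ x, f x * f (x - u) * f (x - u - v) ∂μ ≤ ∫⁻ x, f x ^ 3 ∂μ := by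
    intro u v
    have key := lintegral_mul_mul_le_rpow_third (μ := μ) (f := fun x => f x ^ 3)
      (g := fun x => f (x - u) ^ 3) (h := fun x => f (x - u - v) ^ 3)
      (by fun_prop) (by fun_prop) (by fun_prop)
    simp_rw [cube, sub_sub] at key
    rw [lintegral_sub_right_eq_self (fun x => f x ^ 3),
      lintegral_sub_right_eq_self (fun x => f x ^ 3)] at key
    simp_rw [sub_sub]
    refine key.trans_eq ?_
    rw [← pow_two, ← pow_succ, cube]
  calc ∫⁻ x, ∫⁻ y, ∫⁻ z, a (x - y) * b (y - z) * c (z - x) * f x * f y * f z ∂μ ∂μ ∂μ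
      = ∫⁻ x, ∫⁻ u, ∫⁻ v, a u * b v * c (-u - v) *
          (f x * f (x - u) * f (x - u - v)) ∂μ ∂μ ∂μ := by
        refine lintegral_congr fun x => ?_
        rw [← lintegral_sub_left_eq_self _ x]
        refine lintegral_congr fun u => ?_
        rw [← lintegral_sub_left_eq_self _ (x - u)]
        refine lintegral_congr fun v => ?_
        rw [sub_sub_cancel, sub_sub_cancel, show x - u - v - x = -u - v by abel]
        ring
    _ = ∫⁻ u, ∫⁻ v, ∫⁻ x, a u * b v * c (-u - v) *
          (f x * f (x - u) * f (x - u - v)) ∂μ ∂μ ∂μ := by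
        rw [lintegral_lintegral_swap (by fun_prop)]
        refine lintegral_congr fun u => ?_
        rw [lintegral_lintegral_swap (by fun_prop)]
    _ ≤ ∫⁻ u, ∫⁻ v, a u * b v * c (-u - v) * ∫⁻ x, f x ^ 3 ∂μ ∂μ ∂μ := by
        gcongr with u v
        rw [lintegral_const_mul _ (by fun_prop)]
        exact mul_le_mul' le_rfl (inner u v)
    _ = (∫⁻ u, ∫⁻ v, a u * b v * c (-u - v) ∂μ ∂μ) * ∫⁻ x, f x ^ 3 ∂μ := by
        rw [← lintegral_mul_const _ (by fun_prop)]
        refine lintegral_congr fun u => ?_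
        rw [lintegral_mul_const _ (by fun_prop)]
    _ ≤ _ := by
        gcongr
        exact lintegral_lintegral_young_three_halves ha hb hc

theorem volume_eq_haarAddCircle_one :
    (volume : Measure (AddCircle (1 : ℝ))) = AddCircle.haarAddCircle := by
  rw [AddCircle.volume_eq_smul_haarAddCircle, ENNReal.ofReal_one, one_smul]

theorem fourierCoeffC_eq_fourierCoeff (q : AddCircle (1 : ℝ) → ℂ) (k : ℤ) :
    fourierCoeffC q k = fourierCoeff q k := by
  simp only [fourierCoeffC, fourierCoeff, volume_eq_haarAddCircle_one, smul_eq_mul, mul_comm]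

/-- The squared `L²` norm of a continuous function minus a partial sum of its Fourier series. -/
theorem lintegral_enorm_sub_sum_fourier_sq {q : AddCircle (1 : ℝ) → ℂ} (hq : Continuous q)
    (s : Finset ℤ) :
    ∫⁻ x, ‖q x - ∑ k ∈ s, fourierCoeff q k * fourier k x‖ₑ ^ 2 =
      ∑' k : ℤ, if k ∈ s then 0 else ‖fourierCoeff q k‖ₑ ^ 2 := by
  let g : C(AddCircle (1 : ℝ), ℂ) := ⟨q, hq⟩ - ∑ k ∈ s, fourierCoeff q k • fourier k
  have hg : ∀ x, g x = q x - ∑ k ∈ s, fourierCoeff q k * fourier k x := by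
    intro x
    simp [g, -fourier_apply]
  have hcoeff : ∀ n, fourierCoeff g n = if n ∈ s then 0 else fourierCoeff q n := by
    intro n
    have hint : ∀ h : C(AddCircle (1 : ℝ), ℂ), Integrable h AddCircle.haarAddCircle := fun h =>
      h.continuous.integrable_of_hasCompactSupport (HasCompactSupport.of_compactSpace _)
    have hsum : fourierCoeff (∑ k ∈ s, ⇑(fourierCoeff q k • fourier (T := (1 : ℝ)) k)) n =
        if n ∈ s then fourierCoeff q n else 0 := by
      rw [fourierCoeff.sum _ _ fun i _ => hint _, Finset.sum_apply]
      have : ∀ k ∈ s, fourierCoeff (⇑(fourierCoeff q k • fourier (T := (1 : ℝ)) k)) n =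
          if n = k then fourierCoeff q k else 0 := by
        intro k _
        rw [ContinuousMap.coe_smul, fourierCoeff.const_smul, fourierCoeff_fourier, Pi.single_apply]
        simp
      rw [Finset.sum_congr rfl this, Finset.sum_ite_eq]
    have hadd := congrFun (fourierCoeff.add (hint g)
      (hint (∑ k ∈ s, fourierCoeff q k • fourier k))) n
    rw [← ContinuousMap.coe_add, sub_add_cancel, Pi.add_apply, ContinuousMap.coe_sum, hsum] at hadd
    change fourierCoeff q n = _ at hadd
    split_ifs at hadd ⊢ <;> linear_combination -hadd
  have hparseval := hasSum_sq_fourierCoeff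
    (ContinuousMap.toLp (E := ℂ) 2 AddCircle.haarAddCircle ℂ g)
  simp_rw [fourierCoeff_toLp] at hparseval
  have hL : ∫ t, ‖ContinuousMap.toLp (E := ℂ) 2 AddCircle.haarAddCircle ℂ g t‖ ^ 2
      ∂AddCircle.haarAddCircle = ∫ t, ‖g t‖ ^ 2 := by
    rw [volume_eq_haarAddCircle_one]
    refine integral_congr_ae ?_
    filter_upwards [ContinuousMap.coeFn_toLp (p := 2) (𝕜 := ℂ) AddCircle.haarAddCircle g] with t ht
    rw [ht]
  rw [hL] at hparseval
  have hnorm : ∀ z : ℂ, ‖z‖ₑ ^ 2 = ENNReal.ofReal (‖z‖ ^ 2) := fun z => by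
    rw [ENNReal.ofReal_pow (norm_nonneg _), ofReal_norm]
  calc ∫⁻ x, ‖q x - ∑ k ∈ s, fourierCoeff q k * fourier k x‖ₑ ^ 2
      = ENNReal.ofReal (∫ t, ‖g t‖ ^ 2) := by
        rw [ofReal_integral_eq_lintegral_ofReal]
        · simp_rw [hnorm, hg]
        · exact (by fun_prop : Continuous fun t => ‖g t‖ ^ 2).integrable_of_hasCompactSupport
            (HasCompactSupport.of_compactSpace _)
        · exact ae_of_all _ fun _ => by positivity
    _ = ∑' k, ENNReal.ofReal (‖fourierCoeff g k‖ ^ 2) := by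
        rw [← hparseval.tsum_eq,
          ENNReal.ofReal_tsum_of_nonneg (fun _ => by positivity) hparseval.summable]
    _ = _ := by
        refine tsum_congr fun k => ?_
        rw [hcoeff, hnorm]
        split_ifs <;> simp

theorem sum_range_rpow_neg_two_thirds_le (n : ℕ) :
    ∑ k ∈ Finset.range n, (1 + (k : ℝ)) ^ (-(2 : ℝ) / 3) ≤ 3 * (n : ℝ) ^ ((1 : ℝ) / 3) := by
  induction n with
  | zero => simp
  | succ n ih =>
    rw [Finset.sum_range_succ]
    set a : ℝ := ((n : ℝ) + 1) ^ ((1 : ℝ) / 3) with ha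
    set b : ℝ := (n : ℝ) ^ ((1 : ℝ) / 3) with hb
    have ha0 : 0 < a := by positivity
    have hb0 : 0 ≤ b := by positivity
    have hba : b ≤ a := Real.rpow_le_rpow (by positivity) (by linarith) (by norm_num)
    have ha3 : a ^ 3 = n + 1 := by
      rw [ha, ← Real.rpow_natCast, ← Real.rpow_mul (by positivity)]; norm_num
    have hb3 : b ^ 3 = n := by
      rw [hb, ← Real.rpow_natCast, ← Real.rpow_mul (by positivity)]; norm_num
    have hterm : (1 + (n : ℝ)) ^ (-(2 : ℝ) / 3) = 1 / a ^ 2 := by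
      rw [ha, ← Real.rpow_natCast, ← Real.rpow_mul (by positivity), add_comm, one_div,
        ← Real.rpow_neg (by positivity)]
      norm_num
    have hle : 1 / a ^ 2 ≤ 3 * (a - b) := by
      rw [div_le_iff₀ (by positivity)]
      nlinarith [mul_nonneg (sub_nonneg.2 hba) (mul_nonneg hb0 (sub_nonneg.2 hba)),
        mul_nonneg (sub_nonneg.2 hba) (mul_nonneg ha0.le (sub_nonneg.2 hba)), ha3, hb3]
    rw [hterm]
    push_cast
    rw [← ha]
    linarith

theorem sum_rpow_neg_two_thirds_le (s : Finset ℤ) (N : ℕ) (hs : ∀ k ∈ s, k.natAbs ≤ N) :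
    ∑ k ∈ s, (1 + |(k : ℝ)|) ^ (-(2 : ℝ) / 3) ≤ 6 * (1 + (N : ℝ)) ^ ((1 : ℝ) / 3) := by
  have hmaps : ∀ k ∈ s, k.natAbs ∈ Finset.range (N + 1) := fun k hk => by
    simpa [Nat.lt_succ_iff] using hs k hk
  rw [← Finset.sum_fiberwise_of_maps_to hmaps]
  have hfiber : ∀ n ∈ Finset.range (N + 1),
      ∑ k ∈ s with k.natAbs = n, (1 + |(k : ℝ)|) ^ (-(2 : ℝ) / 3) ≤
        2 * (1 + (n : ℝ)) ^ (-(2 : ℝ) / 3) := by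
    intro n _
    have hcard : ({k ∈ s | k.natAbs = n} : Finset ℤ).card ≤ 2 := by
      refine (Finset.card_le_card (t := {(n : ℤ), -(n : ℤ)}) fun k hk => ?_).trans
        Finset.card_le_two
      simp only [Finset.mem_filter] at hk
      simp only [Finset.mem_insert, Finset.mem_singleton]
      omega
    calc ∑ k ∈ s with k.natAbs = n, (1 + |(k : ℝ)|) ^ (-(2 : ℝ) / 3)
        = ∑ k ∈ s with k.natAbs = n, (1 + (n : ℝ)) ^ (-(2 : ℝ) / 3) := by
          refine Finset.sum_congr rfl fun k hk => ?_
          rw [← (Finset.mem_filter.1 hk).2, Nat.cast_natAbs, Int.cast_abs]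
      _ ≤ _ := by
          rw [Finset.sum_const, nsmul_eq_mul]
          gcongr
          exact_mod_cast hcard
  refine (Finset.sum_le_sum hfiber).trans ?_
  rw [← Finset.mul_sum]
  have := sum_range_rpow_neg_two_thirds_le (N + 1)
  push_cast at this
  rw [add_comm (N : ℝ) 1] at this
  linarith

/-- Low frequencies are controlled pointwise by the `H^{1/3}` norm. -/
theorem sum_norm_le_of_weighted_sum_le {c : ℤ → ℂ} {K t : ℝ} (hK : 0 ≤ K) (ht : 0 ≤ t)
    (s : Finset ℤ) (hs : ∀ k ∈ s, 5 * K * (1 + |(k : ℝ)|) ^ ((1 : ℝ) / 6) ≤ t)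
    (hc : ∑ k ∈ s, (1 + |(k : ℝ)|) ^ ((2 : ℝ) / 3) * ‖c k‖ ^ 2 ≤ K ^ 2) :
    ∑ k ∈ s, ‖c k‖ ≤ t / 2 := by
  rcases s.eq_empty_or_nonempty with rfl | hne
  · rw [Finset.sum_empty]; positivity
  obtain ⟨m, hm, hmax⟩ := s.exists_max_image Int.natAbs hne
  have hweight := sum_rpow_neg_two_thirds_le s m.natAbs hmax
  rw [Nat.cast_natAbs, Int.cast_abs] at hweight
  have hcs : (∑ k ∈ s, ‖c k‖) ^ 2 ≤ (∑ k ∈ s, (1 + |(k : ℝ)|) ^ (-(2 : ℝ) / 3)) *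
      ∑ k ∈ s, (1 + |(k : ℝ)|) ^ ((2 : ℝ) / 3) * ‖c k‖ ^ 2 := by
    refine Finset.sum_sq_le_sum_mul_sum_of_sq_le_mul s (fun _ _ => by positivity)
      (fun _ _ => by positivity) fun k _ => le_of_eq ?_
    rw [← mul_assoc, ← Real.rpow_add (by positivity)]
    norm_num
  have hm6 : (5 * K) ^ 2 * (1 + |(m : ℝ)|) ^ ((1 : ℝ) / 3) ≤ t ^ 2 := by
    have := pow_le_pow_left₀ (by positivity) (hs m hm) 2
    rwa [mul_pow, ← Real.rpow_mul_natCast (by positivity),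
      show (1 : ℝ) / 6 * (2 : ℕ) = 1 / 3 by norm_num] at this
  refine le_of_sq_le_sq ?_ (by positivity)
  have hprod := mul_le_mul hweight hc (by positivity) (by positivity)
  nlinarith [hcs, hm6, hprod, sq_nonneg t]

theorem finite_setOf_mul_rpow_le {a r : ℝ} (ha : 0 < a) (hr : 0 < r) (t : ℝ) :
    {k : ℤ | a * (1 + |(k : ℝ)|) ^ r ≤ t}.Finite := by
  refine (Set.finite_Icc (-⌈(t / a) ^ r⁻¹⌉) ⌈(t / a) ^ r⁻¹⌉).subset fun k hk => ?_
  have h1 : (1 + |(k : ℝ)|) ^ r ≤ t / a := by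
    rw [le_div_iff₀ ha, mul_comm]; exact hk
  have h2 : 1 + |(k : ℝ)| ≤ (t / a) ^ r⁻¹ := by
    rw [Real.le_rpow_inv_iff_of_pos (by positivity) (h1.trans' (by positivity)) hr]
    exact h1
  have h3 : |(k : ℝ)| ≤ ⌈(t / a) ^ r⁻¹⌉ := by linarith [Int.le_ceil ((t / a) ^ r⁻¹)]
  have h4 : |k| ≤ ⌈(t / a) ^ r⁻¹⌉ := by exact_mod_cast h3
  exact abs_le.1 h4

/-- A tail bound for the level sets of `q` by the high frequencies of `q`. -/
theorem volume_lt_norm_mul_le {q : AddCircle (1 : ℝ) → ℂ} (hq : Continuous q) {K t : ℝ}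
    (hK : 0 < K) (ht : 0 < t)
    (hH : ∑' k : ℤ, ENNReal.ofReal ((1 + |(k : ℝ)|) ^ ((2 : ℝ) / 3) * ‖fourierCoeff q k‖ ^ 2) ≤
      ENNReal.ofReal (K ^ 2)) :
    volume {x | t < ‖q x‖} * ENNReal.ofReal (t ^ 5) ≤
      ∑' k : ℤ, ENNReal.ofReal (4 * t ^ 3) *
        (if 5 * K * (1 + |(k : ℝ)|) ^ ((1 : ℝ) / 6) ≤ t then 0 else ‖fourierCoeff q k‖ₑ ^ 2) := by
  have hfin := finite_setOf_mul_rpow_le (a := 5 * K) (r := 1 / 6) (by positivity) (by norm_num) t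
  set s : Finset ℤ := hfin.toFinset with hs
  have hmem : ∀ k, k ∈ s ↔ 5 * K * (1 + |(k : ℝ)|) ^ ((1 : ℝ) / 6) ≤ t := fun k => by simp [hs]
  have hlow : ∑ k ∈ s, ‖fourierCoeff q k‖ ≤ t / 2 := by
    refine sum_norm_le_of_weighted_sum_le hK.le ht.le s (fun k hk => (hmem k).1 hk) ?_
    rw [← ENNReal.ofReal_le_ofReal_iff (by positivity),
      ENNReal.ofReal_sum_of_nonneg fun _ _ => by positivity]
    exact (ENNReal.sum_le_tsum s).trans hH
  have hsub : {x | t < ‖q x‖} ⊆ {x | ENNReal.ofReal (t ^ 2 / 4) ≤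
      ‖q x - ∑ k ∈ s, fourierCoeff q k * fourier k x‖ₑ ^ 2} := by
    intro x hx
    have hpt : ‖∑ k ∈ s, fourierCoeff q k * fourier k x‖ ≤ t / 2 := by
      refine (norm_sum_le _ _).trans (le_trans (le_of_eq ?_) hlow)
      refine Finset.sum_congr rfl fun k _ => ?_
      rw [norm_mul, fourier_apply, Circle.norm_coe, mul_one]
    have hdiff : t / 2 ≤ ‖q x - ∑ k ∈ s, fourierCoeff q k * fourier k x‖ := by
      have := norm_sub_norm_le (q x) (∑ k ∈ s, fourierCoeff q k * fourier k x)
      have hx' : t < ‖q x‖ := hx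
      linarith
    rw [Set.mem_ofPred_eq, ← ofReal_norm, ← ENNReal.ofReal_pow (norm_nonneg _)]
    refine ENNReal.ofReal_le_ofReal ?_
    nlinarith
  have hcont : Continuous fun x => q x - ∑ k ∈ s, fourierCoeff q k * fourier k x :=
    hq.sub (continuous_finsetSum _ fun k _ => continuous_const.mul (fourier k).continuous)
  have hmarkov := mul_meas_ge_le_lintegral₀ (μ := volume)
    (f := fun x => ‖q x - ∑ k ∈ s, fourierCoeff q k * fourier k x‖ₑ ^ 2)
    (by have := hcont.measurable; fun_prop) (ENNReal.ofReal (t ^ 2 / 4))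
  rw [lintegral_enorm_sub_sum_fourier_sq hq s] at hmarkov
  rw [ENNReal.tsum_mul_left]
  calc volume {x | t < ‖q x‖} * ENNReal.ofReal (t ^ 5)
      = ENNReal.ofReal (4 * t ^ 3) * (ENNReal.ofReal (t ^ 2 / 4) * volume {x | t < ‖q x‖}) := by
        rw [← mul_assoc, ← ENNReal.ofReal_mul (by positivity), mul_comm]
        congr 2
        ring
    _ ≤ ENNReal.ofReal (4 * t ^ 3) * ∑' k, if k ∈ s then 0 else ‖fourierCoeff q k‖ₑ ^ 2 := by
        refine mul_le_mul' le_rfl (le_trans ?_ hmarkov)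
        gcongr
    _ = _ := by simp_rw [hmem]

theorem lintegral_enorm_pow_six_le_of_weighted_sum_le {q : AddCircle (1 : ℝ) → ℂ}
    (hq : Continuous q) {K : ℝ} (hK : 0 < K)
    (hH : ∑' k : ℤ, ENNReal.ofReal ((1 + |(k : ℝ)|) ^ ((2 : ℝ) / 3) * ‖fourierCoeff q k‖ ^ 2) ≤
      ENNReal.ofReal (K ^ 2)) :
    ∫⁻ x, ‖q x‖ₑ ^ 6 ≤ ENNReal.ofReal (15000 * K ^ 4) *
      ∑' k : ℤ, ENNReal.ofReal ((1 + |(k : ℝ)|) ^ ((2 : ℝ) / 3) * ‖fourierCoeff q k‖ ^ 2) := by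
  have hcake := lintegral_rpow_eq_lintegral_meas_lt_mul (volume : Measure (AddCircle (1 : ℝ)))
    (f := fun x => ‖q x‖) (ae_of_all _ fun _ => norm_nonneg _) hq.norm.measurable.aemeasurable
    (p := 6) (by norm_num)
  have hsix : ∀ x, ‖q x‖ₑ ^ 6 = ENNReal.ofReal (‖q x‖ ^ (6 : ℝ)) := fun x => by
    rw [← ofReal_norm, ← ENNReal.ofReal_pow (norm_nonneg _)]
    norm_cast
  simp_rw [hsix]
  rw [hcake]
  set L : ℤ → ℝ := fun k => 5 * K * (1 + |(k : ℝ)|) ^ ((1 : ℝ) / 6) with hL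
  have hL0 : ∀ k, 0 ≤ L k := fun k => by positivity
  have hL4 : ∀ k, L k ^ 4 = 625 * K ^ 4 * (1 + |(k : ℝ)|) ^ ((2 : ℝ) / 3) := fun k => by
    rw [hL]
    dsimp only
    rw [mul_pow, ← Real.rpow_mul_natCast (by positivity),
      show (1 : ℝ) / 6 * (4 : ℕ) = 2 / 3 by norm_num]
    ring
  have hterm : ∀ k : ℤ, ∫⁻ t in Set.Ioi (0 : ℝ), ENNReal.ofReal (4 * t ^ 3) *
      (if L k ≤ t then 0 else ‖fourierCoeff q k‖ₑ ^ 2) ≤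
      ENNReal.ofReal (4 * L k ^ 4) * ‖fourierCoeff q k‖ₑ ^ 2 := by
    intro k
    calc _ ≤ ∫⁻ t in Set.Ioi (0 : ℝ), (Set.Iio (L k)).indicator
          (fun _ => ENNReal.ofReal (4 * L k ^ 3) * ‖fourierCoeff q k‖ₑ ^ 2) t := by
          refine setLIntegral_mono' measurableSet_Ioi fun t ht => ?_
          have ht0 : (0 : ℝ) < t := ht
          rcases le_or_gt (L k) t with h | h
          · simp [h]
          · rw [if_neg h.not_ge, Set.indicator_of_mem (Set.mem_Iio.2 h)]
            gcongr
      _ = ENNReal.ofReal (4 * L k ^ 4) * ‖fourierCoeff q k‖ₑ ^ 2 := by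
          rw [lintegral_indicator measurableSet_Iio, setLIntegral_const,
            Measure.restrict_apply measurableSet_Iio, Set.Iio_inter_Ioi, Real.volume_Ioo, sub_zero,
            mul_right_comm, ← ENNReal.ofReal_mul (by have := hL0 k; positivity)]
          congr 2
          ring
  calc ENNReal.ofReal 6 * ∫⁻ t in Set.Ioi (0 : ℝ),
        volume {x | t < ‖q x‖} * ENNReal.ofReal (t ^ ((6 : ℝ) - 1))
      ≤ ENNReal.ofReal 6 * ∫⁻ t in Set.Ioi (0 : ℝ), ∑' k : ℤ, ENNReal.ofReal (4 * t ^ 3) *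
        (if L k ≤ t then 0 else ‖fourierCoeff q k‖ₑ ^ 2) := by
        refine mul_le_mul' le_rfl (setLIntegral_mono' measurableSet_Ioi fun t ht => ?_)
        have := volume_lt_norm_mul_le hq hK (Set.mem_Ioi.1 ht) hH
        rwa [show t ^ ((6 : ℝ) - 1) = t ^ 5 by norm_num]
    _ = ENNReal.ofReal 6 * ∑' k : ℤ, ∫⁻ t in Set.Ioi (0 : ℝ), ENNReal.ofReal (4 * t ^ 3) *
        (if L k ≤ t then 0 else ‖fourierCoeff q k‖ₑ ^ 2) := by
        rw [lintegral_tsum fun k => ?_]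
        refine (Measurable.mul (by fun_prop) ?_).aemeasurable
        exact Measurable.ite measurableSet_Ici measurable_const measurable_const
    _ ≤ ENNReal.ofReal 6 * ∑' k : ℤ, ENNReal.ofReal (4 * L k ^ 4) * ‖fourierCoeff q k‖ₑ ^ 2 :=
        mul_le_mul' le_rfl (ENNReal.tsum_le_tsum hterm)
    _ = _ := by
        rw [← ENNReal.tsum_mul_left, ← ENNReal.tsum_mul_left]
        refine tsum_congr fun k => ?_
        rw [hL4, ← ofReal_norm, ← ENNReal.ofReal_pow (norm_nonneg _),
          ← ENNReal.ofReal_mul (by positivity), ← ENNReal.ofReal_mul (by norm_num),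
          ← ENNReal.ofReal_mul (by positivity)]
        congr 1
        ring

/-- The Sobolev embedding of `H^{1/3}` into `L⁶` on the unit circle. -/
theorem lintegral_enorm_pow_six_le_HthirdNorm {q : AddCircle (1 : ℝ) → ℂ} (hq : Continuous q) :
    ∫⁻ x, ‖q x‖ₑ ^ 6 ≤ ENNReal.ofReal 15000 * HthirdNorm q ^ 6 := by
  set S : ℝ≥0∞ :=
    ∑' k : ℤ, ENNReal.ofReal ((1 + |(k : ℝ)|) ^ ((2 : ℝ) / 3) * ‖fourierCoeff q k‖ ^ 2) with hS
  have hH : HthirdNorm q ^ 6 = S ^ 3 := by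
    simp only [HthirdNorm, fourierCoeffC_eq_fourierCoeff]
    rw [← ENNReal.rpow_mul_natCast, ← ENNReal.rpow_natCast]
    norm_num [hS]
  rw [hH]
  rcases eq_or_ne S ⊤ with htop | htop
  · rw [htop, ENNReal.top_pow (by norm_num), ENNReal.mul_top (by norm_num)]
    exact le_top
  rcases eq_or_ne S 0 with h0 | h0
  · have := lintegral_enorm_pow_six_le_of_weighted_sum_le hq one_pos
      (by rw [← hS, h0]; exact zero_le)
    rw [← hS, h0, mul_zero] at this
    exact this.trans zero_le
  have hpos : 0 < S.toReal := ENNReal.toReal_pos h0 htop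
  have hsq : √S.toReal ^ 2 = S.toReal := Real.sq_sqrt hpos.le
  have := lintegral_enorm_pow_six_le_of_weighted_sum_le hq (Real.sqrt_pos.2 hpos)
    (by rw [← hS, hsq, ENNReal.ofReal_toReal htop])
  refine this.trans_eq ?_
  rw [← hS, show √S.toReal ^ 4 = S.toReal ^ 2 by rw [← congrArg (· ^ 2) hsq]; ring,
    ENNReal.ofReal_mul (by norm_num), ENNReal.ofReal_pow hpos.le, ENNReal.ofReal_toReal htop]
  ring

/-- A measurable majorant of `w` with the same `L^{3/2}` norm. -/
theorem MeasureTheory.MemLp.exists_measurable_majorant_three_halves {α : Type*}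
    [MeasurableSpace α] {μ : Measure α} {w : α → ℝ} (hw : MemLp w (3 / 2) μ) :
    ∃ g : α → ℝ≥0∞, Measurable g ∧ (∀ x, ‖w x‖ₑ ≤ g x) ∧
      (∫⁻ x, g x ^ (3 / 2 : ℝ) ∂μ) ^ (2 / 3 : ℝ) = eLpNorm w (3 / 2) μ := by
  obtain ⟨g, hg, hwg, hae⟩ := hw.1.enorm.exists_measurable_ge_ae_eq
  refine ⟨g, hg, hwg, ?_⟩
  have htop : (3 / 2 : ℝ≥0∞) ≠ ⊤ := ENNReal.div_ne_top (by norm_num) (by norm_num)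
  rw [eLpNorm_eq_lintegral_rpow_enorm_toReal (by norm_num) htop,
    show (3 / 2 : ℝ≥0∞).toReal = 3 / 2 by simp,
    show (1 / (3 / 2) : ℝ) = 2 / 3 by norm_num]
  congr 1
  refine lintegral_congr_ae ?_
  filter_upwards [hae] with x hx
  rw [hx]

/-- **Lemma A.6 (multilinear estimate for the triangle interaction).**  There is a constant
`C > 0` such that for all `w₁, w₂, w₃ ∈ L^{3/2}(Λ;ℝ)` and every continuous `q : Λ → ℂ`,
`|∫∫∫ w₁(x−y) w₂(y−z) w₃(z−x) |q(x)|²|q(y)|²|q(z)|² dx dy dz|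
  ≤ C ‖w₁‖_{L^{3/2}} ‖w₂‖_{L^{3/2}} ‖w₃‖_{L^{3/2}} ‖q‖_{H^{1/3}}⁶`,
the right-hand side being interpreted in `[0,∞]` when `‖q‖_{H^{1/3}} = ∞`. -/
theorem triangle_multilinear_estimate :
    ∃ C : ℝ, 0 < C ∧
      ∀ w₁ w₂ w₃ : AddCircle (1:ℝ) → ℝ,
        MemLp w₁ (3/2) volume → MemLp w₂ (3/2) volume → MemLp w₃ (3/2) volume →
      ∀ q : AddCircle (1:ℝ) → ℂ, Continuous q →
        ENNReal.ofReal
            |∫ x : AddCircle (1:ℝ), ∫ y : AddCircle (1:ℝ), ∫ z : AddCircle (1:ℝ),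
                w₁ (x - y) * w₂ (y - z) * w₃ (z - x) *
                  ‖q x‖ ^ 2 * ‖q y‖ ^ 2 * ‖q z‖ ^ 2| ≤
          ENNReal.ofReal C * eLpNorm w₁ (3/2) volume * eLpNorm w₂ (3/2) volume *
            eLpNorm w₃ (3/2) volume * HthirdNorm q ^ (6:ℕ) := by
  refine ⟨15000, by norm_num, fun w₁ w₂ w₃ h₁ h₂ h₃ q hq => ?_⟩
  obtain ⟨a, ha, hwa, hna⟩ := h₁.exists_measurable_majorant_three_halves
  obtain ⟨b, hb, hwb, hnb⟩ := h₂.exists_measurable_majorant_three_halves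
  obtain ⟨c, hc, hwc, hnc⟩ := h₃.exists_measurable_majorant_three_halves
  have hf : Measurable fun x => ‖q x‖ₑ ^ 2 := by have := hq.measurable; fun_prop
  have htriangle := lintegral_triangle_le (μ := (volume : Measure (AddCircle (1 : ℝ)))) ha hb hc hf
  simp_rw [← pow_mul] at htriangle
  rw [ENNReal.mul_rpow_of_nonneg _ _ (by norm_num), ENNReal.mul_rpow_of_nonneg _ _ (by norm_num),
    hna, hnb, hnc] at htriangle
  rw [← Real.norm_eq_abs, ofReal_norm]
  calc _ ≤ ∫⁻ x : AddCircle (1:ℝ), ∫⁻ y : AddCircle (1:ℝ), ∫⁻ z : AddCircle (1:ℝ),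
        a (x - y) * b (y - z) * c (z - x) * ‖q x‖ₑ ^ 2 * ‖q y‖ₑ ^ 2 * ‖q z‖ₑ ^ 2 := by
        refine (enorm_integral_le_lintegral_enorm _).trans (lintegral_mono fun x => ?_)
        refine (enorm_integral_le_lintegral_enorm _).trans (lintegral_mono fun y => ?_)
        refine (enorm_integral_le_lintegral_enorm _).trans (lintegral_mono fun z => ?_)
        simp only [enorm_mul, enorm_pow, enorm_norm]
        gcongr
        · exact hwa _
        · exact hwb _
        · exact hwc _
    _ ≤ _ := htriangle
    _ ≤ eLpNorm w₁ (3/2) volume * eLpNorm w₂ (3/2) volume * eLpNorm w₃ (3/2) volume *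
        (ENNReal.ofReal 15000 * HthirdNorm q ^ 6) :=
        mul_le_mul' le_rfl (lintegral_enorm_pow_six_le_HthirdNorm hq)
    _ = _ := by ring

end
end

section
/- (Global-in-time quintic multilinear estimate for the triangle nonlinearity, established in the proof of Lemma A.7.) For every s > 0 there exists ε₀ ∈ (0, 1/2) such that for every ε ∈ (0, ε₀) there is a constant C = C(s, ε) > 0 with the following property: for all w₁, w₂, w₃ ∈ L^{3/2}(Λ; ℝ) and all smooth functions v₁, …, v₅ : Λ × ℝ → ℂ with compact support in the time variable, the function ℳ₂(v₁,…,v₅)(x,t) := ∫_Λ ∫_Λ w₁(x−y) w₂(y−z) w₃(z−x) v₁(y,t) conj(v₂(y,t)) v₃(z,t) conj(v₄(z,t)) v₅(x,t) dy dz satisfies ‖ℳ₂(v₁,…,v₅)‖_{X^{s,−1/2+ε}} ≤ C ‖w₁‖_{L^{3/2}} ‖w₂‖_{L^{3/2}} ‖w₃‖_{L^{3/2}} ∏_{j=1}^{5} ‖v_j‖_{X^{s,1/2−ε}}. -/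
open MeasureTheory Complex
open scoped ENNReal

noncomputable section

/-- The spacetime Fourier transform `ṽ(k,η) = ∫_ℝ ∫_Λ v(x,t) e^{−2πikx − 2πiηt} dx dt` of a
function `v : Λ × ℝ → ℂ` on the torus `Λ = ℝ/ℤ` times the real line. -/
def spacetimeFT (v : AddCircle (1:ℝ) → ℝ → ℂ) (k : ℤ) (η : ℝ) : ℂ :=
  ∫ t : ℝ, ∫ x : AddCircle (1:ℝ),
    v x t * fourier (-k) x * Complex.exp (-(2 * Real.pi * η * t) * Complex.I)

/-- The `X^{s,b}` norm
`‖v‖_{X^{s,b}} = ( Σ_{k∈ℤ} ∫_ℝ (1+|2πk|)^{2s} (1+|η+2πk²|)^{2b} |ṽ(k,η)|² dη )^{1/2}`,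
valued in `ℝ≥0∞`. -/
def Xnorm (s b : ℝ) (v : AddCircle (1:ℝ) → ℝ → ℂ) : ℝ≥0∞ :=
  (∑' k : ℤ, ∫⁻ η : ℝ, ENNReal.ofReal
      ((1 + |2 * Real.pi * (k:ℝ)|) ^ (2*s) * (1 + |η + 2 * Real.pi * (k:ℝ)^2|) ^ (2*b) *
        ‖spacetimeFT v k η‖ ^ 2)) ^ ((1:ℝ)/2)

/-- The triangle quintic nonlinearity
`ℳ₂(v₁,…,v₅)(x,t) = ∫∫ w₁(x−y) w₂(y−z) w₃(z−x) v₁(y,t) conj(v₂(y,t)) v₃(z,t) conj(v₄(z,t)) v₅(x,t) dy dz`. -/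
def M2 (w₁ w₂ w₃ : AddCircle (1:ℝ) → ℝ) (v : Fin 5 → AddCircle (1:ℝ) → ℝ → ℂ)
    (x : AddCircle (1:ℝ)) (t : ℝ) : ℂ :=
  ∫ y : AddCircle (1:ℝ), ∫ z : AddCircle (1:ℝ),
    (w₁ (x - y) : ℂ) * (w₂ (y - z) : ℂ) * (w₃ (z - x) : ℂ) *
      v 0 y t * (starRingEnd ℂ) (v 1 y t) * v 2 z t * (starRingEnd ℂ) (v 3 z t) * v 4 x t

theorem Nat.succ_le_const_mul_rpow {δ : ℝ} (hδ : 0 < δ) :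
    ∃ A : ℝ, 1 ≤ A ∧ ∀ e : ℕ, (e + 1 : ℝ) ≤ A * ((2:ℝ) ^ δ) ^ e := by
  have h2 : (1:ℝ) < (2:ℝ) ^ δ := Real.one_lt_rpow (by norm_num) hδ
  set q := (2:ℝ) ^ δ
  refine ⟨max 1 (1 / (q - 1)), le_max_left _ _, fun e => ?_⟩
  have hq : 0 < q - 1 := by linarith
  have hb : 1 + (e:ℝ) * (q - 1) ≤ q ^ e := by
    have := one_add_mul_le_pow (a := q - 1) (by linarith) e
    simpa using this
  have hA1 : 1 ≤ max 1 (1 / (q - 1)) := le_max_left _ _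
  have hA2 : 1 ≤ max 1 (1 / (q - 1)) * (q - 1) := by
    calc (1:ℝ) = 1 / (q - 1) * (q - 1) := by field_simp
      _ ≤ _ := mul_le_mul_of_nonneg_right (le_max_right _ _) hq.le
  calc (e + 1 : ℝ) ≤ max 1 (1 / (q - 1)) * (1 + (e:ℝ) * (q - 1)) := by
        nlinarith [mul_le_mul_of_nonneg_left hA2 (Nat.cast_nonneg (α := ℝ) e)]
    _ ≤ _ := by gcongr

/-- The divisor bound `d(n) ≪ n^δ`. -/
theorem Nat.exists_card_divisors_le_rpow {δ : ℝ} (hδ : 0 < δ) :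
    ∃ C : ℝ, 0 < C ∧ ∀ n : ℕ, n ≠ 0 → (n.divisors.card : ℝ) ≤ C * (n:ℝ) ^ δ := by
  obtain ⟨A, hA, hAe⟩ := Nat.succ_le_const_mul_rpow hδ
  obtain ⟨B, hB⟩ := exists_nat_gt ((2:ℝ) ^ (1 / δ))
  refine ⟨A ^ B, by positivity, fun n hn => ?_⟩
  have hfac : ((n:ℝ)) ^ δ = ∏ p ∈ n.primeFactors, ((p:ℝ) ^ δ) ^ (n.factorization p) := by
    conv_lhs => rw [← Nat.prod_factorization_pow_eq_self hn]
    rw [Finsupp.prod, Nat.support_factorization]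
    push_cast
    rw [← Real.finsetProd_rpow _ _ (fun p _ => by positivity)]
    refine Finset.prod_congr rfl fun p _ => ?_
    rw [← Real.rpow_natCast, ← Real.rpow_natCast, ← Real.rpow_mul (by positivity),
      ← Real.rpow_mul (by positivity), mul_comm]
  rw [Nat.card_divisors hn, hfac]
  push_cast
  have key : ∀ p ∈ n.primeFactors, ((n.factorization p : ℝ) + 1) ≤
      (if p < B then A else 1) * ((p:ℝ) ^ δ) ^ (n.factorization p) := by
    intro p hp
    have hp2 : (2:ℝ) ≤ p := by exact_mod_cast (Nat.prime_of_mem_primeFactors hp).two_le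
    split_ifs with h
    · refine (hAe _).trans ?_
      gcongr
    · have : (2:ℝ) ≤ (p:ℝ) ^ δ := by
        have h1 : (2:ℝ) ^ (1 / δ) ≤ p := hB.le.trans (by exact_mod_cast not_lt.mp h)
        calc (2:ℝ) = ((2:ℝ) ^ (1 / δ)) ^ δ := by
              rw [← Real.rpow_mul (by norm_num), one_div_mul_cancel hδ.ne', Real.rpow_one]
          _ ≤ _ := by gcongr
      rw [one_mul]
      calc ((n.factorization p : ℝ) + 1) ≤ 2 ^ (n.factorization p) := by
            exact_mod_cast Nat.lt_two_pow_self
        _ ≤ _ := by gcongr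
  refine (Finset.prod_le_prod (fun p _ => by positivity) key).trans ?_
  rw [Finset.prod_mul_distrib]
  refine mul_le_mul_of_nonneg_right ?_ (by positivity)
  rw [Finset.prod_ite, Finset.prod_const_one, mul_one, Finset.prod_const]
  refine pow_le_pow_right₀ hA ?_
  calc _ ≤ (Finset.range B).card := Finset.card_le_card fun p hp => by
        simpa using (Finset.mem_filter.mp hp).2
    _ = B := by simp

theorem isCoprime_eisensteinNorm {x y M : ℤ} (h : x ^ 2 + x * y + y ^ 2 = M)
    (hxy : IsCoprime x y) : IsCoprime M y := by
  have h1 : IsCoprime (x ^ 2) y := hxy.pow_left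
  have h2 : M = x ^ 2 + y * (x + y) := by rw [← h]; ring
  rw [h2]
  exact h1.add_mul_left_left (x + y)

/-- Two primitive representations of `M` by `x² + xy + y²` that have the same greatest common
divisor of `M` with their determinants against a third one have determinant divisible by
`M / 3`. -/
theorem dvd_three_mul_det_of_eisensteinNorm {M x₀ y₀ x y x' y' : ℤ} (hM : 0 < M)
    (h₀ : x₀ ^ 2 + x₀ * y₀ + y₀ ^ 2 = M) (c₀ : IsCoprime x₀ y₀)
    (h : x ^ 2 + x * y + y ^ 2 = M) (c : IsCoprime x y)
    (h' : x' ^ 2 + x' * y' + y' ^ 2 = M)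
    (hd : Int.gcd (x * y₀ - x₀ * y) M = Int.gcd (x' * y₀ - x₀ * y') M) :
    M ∣ 3 * (x * y' - x' * y) := by
  set d : ℤ := (Int.gcd (x * y₀ - x₀ * y) M : ℤ) with hdef
  have hM₀ : IsCoprime M y₀ := isCoprime_eisensteinNorm h₀ c₀
  have hMy : IsCoprime M y := isCoprime_eisensteinNorm h c
  have hdA : d ∣ x * y₀ - x₀ * y := Int.gcd_dvd_left _ _
  have hdM : d ∣ M := Int.gcd_dvd_right _ _
  have hdA' : d ∣ x' * y₀ - x₀ * y' := by rw [hdef, hd]; exact Int.gcd_dvd_left _ _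
  obtain ⟨e, he⟩ := hdM
  have hd0 : d ≠ 0 := by rintro h0; rw [h0] at he; simp at he; omega
  have hquot : ∀ {u v : ℤ}, u ^ 2 + u * v + v ^ 2 = M → d = Int.gcd (u * y₀ - x₀ * v) M →
      e ∣ u * y₀ + x₀ * v + v * y₀ := by
    intro u v huv hdu
    obtain ⟨a, ha⟩ : d ∣ u * y₀ - x₀ * v := by rw [hdu]; exact Int.gcd_dvd_left _ _
    have hae : IsCoprime e a := by
      obtain ⟨p, q, hpq⟩ : ∃ p q : ℤ, (u * y₀ - x₀ * v) * p + M * q = d :=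
        ⟨_, _, by rw [hdu]; exact (Int.gcd_eq_gcd_ab _ _).symm⟩
      refine ⟨q, p, mul_left_cancel₀ hd0 ?_⟩
      rw [ha, he] at hpq
      linear_combination hpq
    refine hae.dvd_of_dvd_mul_left ⟨y₀ ^ 2 - v ^ 2, mul_left_cancel₀ hd0 ?_⟩
    have : (u * y₀ - x₀ * v) * (u * y₀ + x₀ * v + v * y₀) = M * (y₀ ^ 2 - v ^ 2) := by
      linear_combination (y₀ ^ 2) * huv - v ^ 2 * h₀
    rw [ha] at this
    rw [he] at this
    linear_combination this
  have heB := hquot h rfl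
  have heB' := hquot h' (by rw [hdef, hd])
  have hdM' : d ∣ M := ⟨e, he⟩
  have heM : e ∣ M := ⟨d, by rw [he]; ring⟩
  have hdD : d ∣ x * y' - x' * y := by
    refine (hM₀.of_isCoprime_of_dvd_left hdM').dvd_of_dvd_mul_left (?_ : d ∣ y₀ * _)
    have : y₀ * (x * y' - x' * y) = y' * (x * y₀ - x₀ * y) - y * (x' * y₀ - x₀ * y') := by ring
    rw [this]
    exact dvd_sub (hdA.mul_left _) (hdA'.mul_left _)
  have heD : e ∣ x * y' - x' * y := by
    refine (hM₀.of_isCoprime_of_dvd_left heM).dvd_of_dvd_mul_left (?_ : e ∣ y₀ * _)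
    have : y₀ * (x * y' - x' * y) =
        y' * (x * y₀ + x₀ * y + y * y₀) - y * (x' * y₀ + x₀ * y' + y' * y₀) := by ring
    rw [this]
    exact dvd_sub (heB.mul_left _) (heB'.mul_left _)
  have hg3 : (Int.gcd d e : ℤ) ∣ 3 := by
    have hgd : (Int.gcd d e : ℤ) ∣ d := Int.gcd_dvd_left _ _
    have hge : (Int.gcd d e : ℤ) ∣ e := Int.gcd_dvd_right _ _
    have hgM := hgd.trans hdM'
    have h1 : (Int.gcd d e : ℤ) ∣ 2 * x + y := by
      refine (hM₀.of_isCoprime_of_dvd_left hgM).dvd_of_dvd_mul_left (?_ : _ ∣ y₀ * _)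
      have : y₀ * (2 * x + y) = (x * y₀ - x₀ * y) + (x * y₀ + x₀ * y + y * y₀) := by ring
      rw [this]
      exact dvd_add (hgd.trans hdA) (hge.trans heB)
    have h2 : (Int.gcd d e : ℤ) ∣ y ^ 2 * 3 := by
      have : y ^ 2 * 3 = 4 * M - (2 * x + y) * (2 * x + y) := by rw [← h]; ring
      rw [this]
      exact dvd_sub (hgM.mul_left _) (h1.mul_left _)
    exact ((hMy.of_isCoprime_of_dvd_left hgM).pow_right).dvd_of_dvd_mul_left h2
  obtain ⟨r, hr⟩ := hg3
  have hbez := Int.gcd_eq_gcd_ab d e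
  rw [hr, hbez, he]
  obtain ⟨p, hp⟩ := hdD
  obtain ⟨q, hq⟩ := heD
  refine ⟨(q * Int.gcdA d e + p * Int.gcdB d e) * r, ?_⟩
  linear_combination (d * Int.gcdA d e * r) * hq + (e * Int.gcdB d e * r) * hp

theorem card_le_of_dvd_three_mul_det {M x y : ℤ} (hM : 0 < M)
    (h : x ^ 2 + x * y + y ^ 2 = M) (T : Finset (ℤ × ℤ))
    (hT : ∀ p ∈ T, p.1 ^ 2 + p.1 * p.2 + p.2 ^ 2 = M)
    (hD : ∀ p ∈ T, M ∣ 3 * (x * p.2 - p.1 * y)) : T.card ≤ 14 := by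
  let D : ℤ × ℤ → ℤ := fun p => x * p.2 - p.1 * y
  let E : ℤ × ℤ → ℤ := fun p => x * p.1 + y * p.2 + p.1 * y
  have hDE : ∀ p ∈ T, E p ^ 2 + E p * D p + D p ^ 2 = M ^ 2 := by
    intro p hp
    have := hT p hp
    simp only [D, E]
    linear_combination M * this + (p.1 ^ 2 + p.1 * p.2 + p.2 ^ 2) * h
  have hcard : (Finset.Icc (-3 : ℤ) 3 ×ˢ (Finset.univ : Finset Bool)).card = 14 := by simp
  rw [← hcard]
  refine Finset.card_le_card_of_injOn (fun p => (3 * D p / M, decide (0 ≤ 2 * E p + D p))) ?_ ?_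
  · intro p hp
    obtain ⟨j, hj⟩ := hD p hp
    have hj' : 3 * D p = M * j := hj
    have h1 := hDE p hp
    have h2 : (M * j) ^ 2 ≤ 12 * M ^ 2 := by rw [← hj']; nlinarith [sq_nonneg (2 * E p + D p)]
    have h3 : j ^ 2 ≤ 12 := by
      have : 0 < M ^ 2 := by positivity
      nlinarith
    simp only [Finset.coe_product, Set.mem_prod, Finset.mem_coe, Finset.mem_Icc, Finset.mem_univ,
      and_true]
    rw [hj', Int.mul_ediv_cancel_left _ hM.ne']
    constructor <;> nlinarith
  · intro p hp q hq hpq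
    simp only [Prod.mk.injEq, decide_eq_decide] at hpq
    obtain ⟨j, hj⟩ : M ∣ 3 * D p := hD p hp
    obtain ⟨k, hk⟩ : M ∣ 3 * D q := hD q hq
    rw [hj, hk, Int.mul_ediv_cancel_left _ hM.ne', Int.mul_ediv_cancel_left _ hM.ne'] at hpq
    have hDD : D p = D q := by
      have := hpq.1
      subst this
      linarith
    have hEE : E p = E q := by
      have h1 := hDE p hp
      have h2 := hDE q hq
      rw [hDD] at h1
      have h3 : (E p - E q) * (E p + E q + D q) = 0 := by linear_combination h1 - h2
      rcases mul_eq_zero.mp h3 with h4 | h4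
      · linarith
      · have h5 := hpq.2
        rw [hDD] at h5
        by_cases h6 : 0 ≤ 2 * E p + D q
        · have := h5.mp h6
          linarith
        · have := mt h5.mpr h6
          push Not at this h6
          linarith
    have hx : M * p.1 = M * q.1 := by
      have e1 : M * p.1 = E p * x - D p * y := by simp only [D, E]; rw [← h]; ring
      have e2 : M * q.1 = E q * x - D q * y := by simp only [D, E]; rw [← h]; ring
      rw [e1, e2, hDD, hEE]
    have hy : M * p.2 = M * q.2 := by
      have e1 : M * p.2 = E p * y + D p * (x + y) := by simp only [D, E]; rw [← h]; ring
      have e2 : M * q.2 = E q * y + D q * (x + y) := by simp only [D, E]; rw [← h]; ring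
      rw [e1, e2, hDD, hEE]
    exact Prod.ext (mul_left_cancel₀ hM.ne' hx) (mul_left_cancel₀ hM.ne' hy)

theorem card_primitive_eisensteinNorm_le {M : ℕ} (hM : 0 < M) (T : Finset (ℤ × ℤ))
    (hT : ∀ p ∈ T, p.1 ^ 2 + p.1 * p.2 + p.2 ^ 2 = (M : ℤ))
    (hc : ∀ p ∈ T, IsCoprime p.1 p.2) : T.card ≤ 14 * M.divisors.card := by
  rcases T.eq_empty_or_nonempty with rfl | ⟨p₀, hp₀⟩
  · simp
  have hMz : (0:ℤ) < M := by exact_mod_cast hM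
  let φ : ℤ × ℤ → ℕ := fun p => Int.gcd (p.1 * p₀.2 - p₀.1 * p.2) M
  refine Finset.card_le_mul_card_image_of_maps_to (f := φ) ?_ 14 ?_
  · intro p _
    exact Nat.mem_divisors.mpr ⟨Int.natCast_dvd_natCast.mp (Int.gcd_dvd_right _ _), hM.ne'⟩
  · intro d _
    rcases (T.filter fun p => φ p = d).eq_empty_or_nonempty with h | ⟨p, hp⟩
    · rw [h]; simp
    · obtain ⟨hpT, hpd⟩ := Finset.mem_filter.mp hp
      refine card_le_of_dvd_three_mul_det hMz (hT p hpT) _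
        (fun q hq => hT q (Finset.mem_filter.mp hq).1) fun q hq => ?_
      obtain ⟨hqT, hqd⟩ := Finset.mem_filter.mp hq
      exact dvd_three_mul_det_of_eisensteinNorm hMz (hT p₀ hp₀) (hc p₀ hp₀) (hT p hpT) (hc p hpT)
        (hT q hqT) (hpd.trans hqd.symm)

/-- The number of representations of `M` by `x² + xy + y²` is at most `14 d(M)²`. -/
theorem card_eisensteinNorm_le {M : ℕ} (hM : 0 < M) (T : Finset (ℤ × ℤ))
    (hT : ∀ p ∈ T, p.1 ^ 2 + p.1 * p.2 + p.2 ^ 2 = (M : ℤ)) :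
    T.card ≤ 14 * M.divisors.card * M.divisors.card := by
  let φ : ℤ × ℤ → ℕ := fun p => Int.gcd p.1 p.2
  have hsq : ∀ p ∈ T, φ p ^ 2 ∣ M := by
    intro p hp
    rw [← Int.natCast_dvd_natCast, ← hT p hp]
    push_cast
    have h1 : (φ p : ℤ) ∣ p.1 := Int.gcd_dvd_left _ _
    have h2 : (φ p : ℤ) ∣ p.2 := Int.gcd_dvd_right _ _
    rw [sq, sq, sq]
    exact dvd_add (dvd_add (mul_dvd_mul h1 h1) (mul_dvd_mul h1 h2)) (mul_dvd_mul h2 h2)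
  refine Finset.card_le_mul_card_image_of_maps_to (f := φ) ?_ _ ?_
  · intro p hp
    exact Nat.mem_divisors.mpr ⟨(dvd_pow_self _ two_ne_zero).trans (hsq p hp), hM.ne'⟩
  · intro g _
    rcases (T.filter fun p => φ p = g).eq_empty_or_nonempty with h | ⟨p₁, hp₁⟩
    · rw [h]; simp
    obtain ⟨hp₁T, rfl⟩ := Finset.mem_filter.mp hp₁
    set g := φ p₁
    obtain ⟨M', hM'⟩ := hsq p₁ hp₁T
    have hg : 0 < g := by
      rcases Nat.eq_zero_or_pos g with h | h
      · change M = g ^ 2 * M' at hM'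
        simp [h] at hM'
        omega
      · exact h
    have hgz : (g:ℤ) ≠ 0 := by exact_mod_cast hg.ne'
    have hM'0 : 0 < M' := by
      rcases Nat.eq_zero_or_pos M' with h | h
      · simp [h] at hM'
        omega
      · exact h
    have hinj : Set.InjOn (fun p : ℤ × ℤ => (p.1 / (g:ℤ), p.2 / (g:ℤ)))
        (T.filter fun p => φ p = g : Finset _) := by
      intro p hp q hq hpq
      obtain ⟨_, hpg⟩ := Finset.mem_filter.mp hp
      obtain ⟨_, hqg⟩ := Finset.mem_filter.mp hq
      have a1 : (g:ℤ) ∣ p.1 := hpg ▸ Int.gcd_dvd_left _ _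
      have a2 : (g:ℤ) ∣ p.2 := hpg ▸ Int.gcd_dvd_right _ _
      have b1 : (g:ℤ) ∣ q.1 := hqg ▸ Int.gcd_dvd_left _ _
      have b2 : (g:ℤ) ∣ q.2 := hqg ▸ Int.gcd_dvd_right _ _
      simp only [Prod.mk.injEq] at hpq
      exact Prod.ext ((Int.ediv_left_inj a1 b1).mp hpq.1) ((Int.ediv_left_inj a2 b2).mp hpq.2)
    rw [← Finset.card_image_of_injOn hinj]
    refine (card_primitive_eisensteinNorm_le hM'0 _ ?_ ?_).trans ?_
    · intro r hr
      obtain ⟨p, hp, rfl⟩ := Finset.mem_image.mp hr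
      obtain ⟨hpT, hpg⟩ := Finset.mem_filter.mp hp
      obtain ⟨u, hu⟩ : (g:ℤ) ∣ p.1 := hpg ▸ Int.gcd_dvd_left _ _
      obtain ⟨v, hv⟩ : (g:ℤ) ∣ p.2 := hpg ▸ Int.gcd_dvd_right _ _
      have := hT p hpT
      simp only [hu, hv, Int.mul_ediv_cancel_left _ hgz] at this ⊢
      refine mul_left_cancel₀ (pow_ne_zero 2 hgz) ?_
      have h3 : ((g:ℤ) ^ 2 * M') = M := by exact_mod_cast hM'.symm
      rw [h3, ← this]; ring
    · intro r hr
      obtain ⟨p, hp, rfl⟩ := Finset.mem_image.mp hr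
      obtain ⟨hpT, hpg⟩ := Finset.mem_filter.mp hp
      rw [Int.isCoprime_iff_gcd_eq_one]
      have hpg' : Int.gcd p.1 p.2 = g := hpg
      have := Int.gcd_ediv_gcd_ediv_gcd (i := p.1) (j := p.2) (by rw [hpg']; exact hg)
      rwa [hpg'] at this
    · gcongr
      exact ⟨g ^ 2, by rw [hM', mul_comm]⟩

/-- The quadratic phase `k₁² + k₂² + k₃²` on the plane `k₁ + k₂ + k₃ = k`. -/
def quadPhase (k : ℤ) (p : ℤ × ℤ) : ℤ := (k - p.1 - p.2) ^ 2 + p.1 ^ 2 + p.2 ^ 2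

theorem card_quadPhase_eq_le_two {k m N : ℤ} (hk : 3 * N ^ 2 < |k|) (T : Finset (ℤ × ℤ))
    (hb : ∀ p ∈ T, |p.1| ≤ N ∧ |p.2| ≤ N) (hT : ∀ p ∈ T, quadPhase k p = m) : T.card ≤ 2 := by
  rcases T.eq_empty_or_nonempty with rfl | ⟨q, hq⟩
  · simp
  have hsize : ∀ p ∈ T, 0 ≤ p.1 ^ 2 + p.1 * p.2 + p.2 ^ 2 ∧
      p.1 ^ 2 + p.1 * p.2 + p.2 ^ 2 ≤ 3 * N ^ 2 := by
    intro p hp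
    obtain ⟨h1, h2⟩ := hb p hp
    have h3 := sq_le_sq' (abs_le.mp h1).1 (abs_le.mp h1).2
    have h4 := sq_le_sq' (abs_le.mp h2).1 (abs_le.mp h2).2
    constructor <;> nlinarith [sq_nonneg (p.1 + p.2), sq_nonneg (p.1 - p.2)]
  have hsub : T ⊆ {(q.1, q.2), (q.2, q.1)} := by
    intro p hp
    have e : (p.1 ^ 2 + p.1 * p.2 + p.2 ^ 2) - (q.1 ^ 2 + q.1 * q.2 + q.2 ^ 2) =
        k * ((p.1 + p.2) - (q.1 + q.2)) := by
      have h1 := hT p hp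
      have h2 := hT q hq
      unfold quadPhase at h1 h2
      linarith [h1, h2]
    have hsum : p.1 + p.2 = q.1 + q.2 := by
      by_contra hne
      have h1 : 1 ≤ |(p.1 + p.2) - (q.1 + q.2)| := Int.one_le_abs (sub_ne_zero.mpr hne)
      have h2 : |(p.1 ^ 2 + p.1 * p.2 + p.2 ^ 2) - (q.1 ^ 2 + q.1 * q.2 + q.2 ^ 2)| ≤ 3 * N ^ 2 := by
        rw [abs_le]
        constructor <;> linarith [hsize p hp, hsize q hq]
      rw [e, abs_mul] at h2
      nlinarith [abs_nonneg k]
    have hprod : (p.1 - q.1) * (p.1 - q.2) = 0 := by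
      rw [hsum, sub_self, mul_zero] at e
      have : p.2 = q.1 + q.2 - p.1 := by linarith
      rw [this] at e
      linarith [e]
    simp only [Finset.mem_insert, Finset.mem_singleton]
    rcases mul_eq_zero.mp hprod with h | h
    · left; ext <;> simp <;> linarith
    · right; ext <;> simp <;> linarith
  exact (Finset.card_le_card hsub).trans Finset.card_le_two

theorem exists_card_eisensteinNorm_le_rpow {δ : ℝ} (hδ : 0 < δ) :
    ∃ C : ℝ, 0 < C ∧ ∀ (M : ℤ) (T : Finset (ℤ × ℤ)),
      (∀ p ∈ T, p.1 ^ 2 + p.1 * p.2 + p.2 ^ 2 = M) → (T.card : ℝ) ≤ C * (1 + |(M:ℝ)|) ^ δ := by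
  obtain ⟨C, hC, hd⟩ := Nat.exists_card_divisors_le_rpow (half_pos hδ)
  refine ⟨14 * C * C + 1, by positivity, fun M T hT => ?_⟩
  have hone : (1:ℝ) ≤ (1 + |(M:ℝ)|) ^ δ :=
    Real.one_le_rpow (by linarith [abs_nonneg (M:ℝ)]) hδ.le
  rcases lt_or_ge 0 M with hM | hM
  · lift M to ℕ using hM.le
    have hM0 : 0 < M := by exact_mod_cast hM
    have h1 : (T.card : ℝ) ≤ 14 * M.divisors.card * M.divisors.card := by
      exact_mod_cast card_eisensteinNorm_le hM0 T hT
    have h2 := hd M hM0.ne'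
    have h3 : ((M:ℝ) ^ (δ / 2)) * ((M:ℝ) ^ (δ / 2)) = (M:ℝ) ^ δ := by
      rw [← Real.rpow_add (by exact_mod_cast hM0)]; congr 1; ring
    calc (T.card : ℝ) ≤ 14 * (C * (M:ℝ) ^ (δ / 2)) * (C * (M:ℝ) ^ (δ / 2)) := by
          refine h1.trans ?_; gcongr
      _ = 14 * C * C * (M:ℝ) ^ δ := by rw [← h3]; ring
      _ ≤ (14 * C * C + 1) * (1 + |((M:ℤ):ℝ)|) ^ δ := by
          gcongr
          · linarith
          · simp
  · have : T ⊆ {(0, 0)} := by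
      intro p hp
      have h := hT p hp
      have h1 : p.1 = 0 := by nlinarith [sq_nonneg (p.1 + 2 * p.2), sq_nonneg p.1, sq_nonneg (2 * p.1 + p.2), sq_nonneg p.2]
      have h2 : p.2 = 0 := by rw [h1] at h; nlinarith [sq_nonneg p.2]
      simp [Prod.ext_iff, h1, h2]
    have hc : (T.card : ℝ) ≤ 1 := by exact_mod_cast Finset.card_le_card this
    nlinarith [mul_pos (mul_pos (show (0:ℝ) < 14 by norm_num) hC) hC]

/-- Lattice points in a box of side `N` on a level set of `quadPhase k`: at most `C N^δ`,
uniformly in `k` and in the level. -/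
theorem exists_card_quadPhase_le_rpow {δ : ℝ} (hδ : 0 < δ) :
    ∃ C : ℝ, 0 < C ∧ ∀ (k m : ℤ) (N : ℕ), 1 ≤ N → ∀ T : Finset (ℤ × ℤ),
      (∀ p ∈ T, |p.1| ≤ N ∧ |p.2| ≤ N) → (∀ p ∈ T, quadPhase k p = m) →
      (T.card : ℝ) ≤ C * (N:ℝ) ^ δ := by
  obtain ⟨C, hC, hcard⟩ := exists_card_eisensteinNorm_le_rpow (δ := δ / 4) (by positivity)
  refine ⟨C * 200 ^ (δ / 4) + 2, by positivity, fun k m N hN T hb hT => ?_⟩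
  have hN1 : (1:ℝ) ≤ N := by exact_mod_cast hN
  have hone : (1:ℝ) ≤ (N:ℝ) ^ δ := Real.one_le_rpow hN1 hδ.le
  have hC' : 0 < C * (200:ℝ) ^ (δ / 4) := by positivity
  rcases lt_or_ge (3 * (N:ℤ) ^ 2) |k| with hk | hk
  · have : (T.card : ℝ) ≤ 2 := by exact_mod_cast card_quadPhase_eq_le_two hk T hb hT
    nlinarith
  · rcases T.eq_empty_or_nonempty with rfl | ⟨q, hq⟩
    · simp only [Finset.card_empty, Nat.cast_zero]; positivity
    let f : ℤ × ℤ → ℤ × ℤ := fun p => (3 * p.1 - k, 3 * p.2 - k)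
    have hf : Function.Injective f := by
      intro a b hab
      simp only [f, Prod.mk.injEq] at hab
      ext <;> linarith [hab.1, hab.2]
    set M : ℤ := (f q).1 ^ 2 + (f q).1 * (f q).2 + (f q).2 ^ 2 with hMdef
    have hM : ∀ p ∈ T.image f, p.1 ^ 2 + p.1 * p.2 + p.2 ^ 2 = M := by
      intro p hp
      obtain ⟨r, hr, rfl⟩ := Finset.mem_image.mp hp
      have h1 := hT r hr
      have h2 := hT q hq
      simp only [hMdef, f]
      unfold quadPhase at h1 h2
      linarith [h1, h2]
    have hNz : (1:ℤ) ≤ N := by exact_mod_cast hN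
    have hfb : |(f q).1| ≤ 6 * (N:ℤ) ^ 2 ∧ |(f q).2| ≤ 6 * (N:ℤ) ^ 2 := by
      obtain ⟨h1, h2⟩ := hb q hq
      rw [abs_le] at h1 h2 hk
      simp only [f, abs_le]
      refine ⟨⟨?_, ?_⟩, ?_, ?_⟩ <;> nlinarith
    have hMb : |(M:ℝ)| ≤ 108 * (N:ℝ) ^ 4 := by
      have h3 := sq_le_sq' (abs_le.mp hfb.1).1 (abs_le.mp hfb.1).2
      have h4 := sq_le_sq' (abs_le.mp hfb.2).1 (abs_le.mp hfb.2).2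
      have : |M| ≤ 108 * (N:ℤ) ^ 4 := by
        rw [abs_le, hMdef]
        constructor <;> nlinarith [sq_nonneg ((f q).1 + (f q).2), sq_nonneg ((f q).1 - (f q).2)]
      exact_mod_cast this
    have h := hcard M _ hM
    rw [Finset.card_image_of_injective _ hf] at h
    have hN4 : (1:ℝ) ≤ (N:ℝ) ^ 4 := one_le_pow₀ hN1
    calc (T.card : ℝ) ≤ C * (1 + |(M:ℝ)|) ^ (δ / 4) := h
      _ ≤ C * (200 * (N:ℝ) ^ 4) ^ (δ / 4) := by gcongr; linarith
      _ = C * 200 ^ (δ / 4) * (N:ℝ) ^ δ := by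
          rw [Real.mul_rpow (by norm_num) (by positivity), ← Real.rpow_natCast,
            ← Real.rpow_mul (by positivity)]
          rw [show ((4:ℕ):ℝ) * (δ / 4) = δ by push_cast; ring]; ring
      _ ≤ _ := by gcongr; linarith

theorem tsum_int_one_add_abs_rpow_lt_top {a : ℝ} (ha : 1 < a) :
    ∑' j : ℤ, ENNReal.ofReal ((1 + |(j:ℝ)|) ^ (-a)) < ⊤ := by
  have hs : Summable fun j : ℤ => (1 + |(j:ℝ)|) ^ (-a) := by
    refine Summable.of_norm_bounded_eventually (g := fun j : ℤ => |(j:ℝ)| ^ (-a))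
      (Real.summable_abs_int_rpow ha) ?_
    rw [Filter.eventually_cofinite]
    refine (Set.finite_singleton (0:ℤ)).subset fun j hj => ?_
    by_contra hne
    refine hj ?_
    have hpos : 0 < |(j:ℝ)| := abs_pos.mpr (by exact_mod_cast hne)
    rw [Real.norm_of_nonneg (by positivity)]
    exact Real.rpow_le_rpow_of_nonpos hpos (by linarith) (by linarith)
  exact (ENNReal.ofReal_tsum_of_nonneg (fun j => by positivity) hs) ▸ ENNReal.ofReal_lt_top

theorem tsum_int_shift_le {a : ℝ} (ha : 0 < a) (η : ℝ) :
    ∑' m : ℤ, ENNReal.ofReal ((1 + |η + 2 * Real.pi * (m:ℝ)|) ^ (-a)) ≤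
      ∑' j : ℤ, ENNReal.ofReal ((1 + |(j:ℝ)|) ^ (-a)) := by
  set m₀ := round (η / (2 * Real.pi)) with hm₀
  rw [← (Equiv.addRight m₀).tsum_eq fun j : ℤ => ENNReal.ofReal ((1 + |(j:ℝ)|) ^ (-a))]
  refine ENNReal.tsum_le_tsum fun m => ENNReal.ofReal_le_ofReal ?_
  refine Real.rpow_le_rpow_of_nonpos (by positivity) ?_ (by linarith)
  have hpi := Real.pi_gt_three
  have h1 : |η - 2 * Real.pi * m₀| ≤ Real.pi := by
    have h := abs_sub_round (η / (2 * Real.pi))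
    rw [← hm₀] at h
    have e : η - 2 * Real.pi * m₀ = (2 * Real.pi) * (η / (2 * Real.pi) - m₀) := by
      field_simp
    rw [e, abs_mul, abs_of_pos (by positivity)]
    nlinarith
  simp only [Equiv.coe_addRight, Int.cast_add]
  rcases eq_or_ne (m + m₀) 0 with h0 | h0
  · have : (m:ℝ) + m₀ = 0 := by exact_mod_cast h0
    rw [this]; simp
  · have hj : (1:ℝ) ≤ |(m:ℝ) + m₀| := by exact_mod_cast Int.one_le_abs h0
    have h2 : 2 * Real.pi * |(m:ℝ) + m₀| ≤ |η + 2 * Real.pi * m| + |η - 2 * Real.pi * m₀| := by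
      have e : 2 * Real.pi * ((m:ℝ) + m₀) = (η + 2 * Real.pi * m) - (η - 2 * Real.pi * m₀) := by ring
      rw [← abs_of_pos (show 0 < 2 * Real.pi by positivity), ← abs_mul,
        abs_of_pos (show 0 < 2 * Real.pi by positivity), e]
      exact abs_sub _ _
    nlinarith

/-- The size `1 + max(|a|, |b|)` of a lattice point. -/
def latticeSize (p : ℤ × ℤ) : ℕ := 1 + max p.1.natAbs p.2.natAbs

theorem latticeSize_pos (p : ℤ × ℤ) : 0 < latticeSize p := by unfold latticeSize; omega

theorem exists_tsum_quadPhase_level_le {s : ℝ} (hs : 0 < s) :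
    ∃ C : ℝ≥0∞, C ≠ ⊤ ∧ ∀ k m : ℤ,
      ∑' p : ℤ × ℤ, (if quadPhase k p = m then ENNReal.ofReal ((latticeSize p : ℝ) ^ (-s)) else 0)
        ≤ C := by
  obtain ⟨C, hC, hcard⟩ := exists_card_quadPhase_le_rpow (half_pos hs)
  let g : ℕ → ℝ := fun i => ((2:ℝ) ^ i) ^ (-s) * (C * ((2:ℝ) ^ (i + 1)) ^ (s / 2))
  have hg : ∀ i, g i = C * 2 ^ (s / 2) * ((2:ℝ) ^ (-(s / 2))) ^ i := by
    intro i
    simp only [g]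
    rw [pow_succ, Real.mul_rpow (by positivity) (by norm_num), ← Real.rpow_natCast,
      ← Real.rpow_natCast, ← Real.rpow_mul (by norm_num), ← Real.rpow_mul (by norm_num),
      ← Real.rpow_mul (by norm_num)]
    have : (2:ℝ) ^ (-(s / 2) * i) = 2 ^ ((i:ℝ) * -s) * 2 ^ ((i:ℝ) * (s / 2)) := by
      rw [← Real.rpow_add (by norm_num)]; congr 1; ring
    rw [this]; ring
  have hgs : Summable g := by
    have h1 : (2:ℝ) ^ (-(s / 2)) < 1 := Real.rpow_lt_one_of_one_lt_of_neg (by norm_num) (by linarith)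
    exact ((summable_geometric_of_lt_one (by positivity) h1).mul_left _).congr fun i => (hg i).symm
  have hg0 : ∀ i, 0 ≤ g i := fun i => by positivity
  refine ⟨ENNReal.ofReal (∑' i, g i), ENNReal.ofReal_ne_top, fun k m => ?_⟩
  have hbox : ∀ i : ℕ, {p : ℤ × ℤ | latticeSize p ≤ 2 ^ (i + 1) ∧ quadPhase k p = m}.Finite := by
    intro i
    refine ((Set.finite_Icc (-(2 ^ (i + 1) : ℤ)) (2 ^ (i + 1))).prod
      (Set.finite_Icc (-(2 ^ (i + 1) : ℤ)) (2 ^ (i + 1)))).subset ?_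
    rintro p ⟨hp, _⟩
    unfold latticeSize at hp
    have h1 : (p.1.natAbs : ℤ) ≤ 2 ^ (i + 1) := by
      exact_mod_cast (show p.1.natAbs ≤ 2 ^ (i + 1) by omega)
    have h2 : (p.2.natAbs : ℤ) ≤ 2 ^ (i + 1) := by
      exact_mod_cast (show p.2.natAbs ≤ 2 ^ (i + 1) by omega)
    simp only [Set.mem_prod, Set.mem_Icc]
    omega
  calc _ ≤ ∑' p : ℤ × ℤ, ∑' i : ℕ, (if p ∈ (hbox i).toFinset then
          ENNReal.ofReal (((2:ℝ) ^ i) ^ (-s)) else 0) := by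
        refine ENNReal.tsum_le_tsum fun p => ?_
        split_ifs with hp
        · let i := Nat.log 2 (latticeSize p)
          have h1 : 2 ^ i ≤ latticeSize p := Nat.pow_log_le_self 2 (latticeSize_pos p).ne'
          have h2 : latticeSize p < 2 ^ (i + 1) := Nat.lt_pow_succ_log_self (by norm_num) _
          refine le_trans ?_ (ENNReal.le_tsum i)
          rw [if_pos (by simpa using ⟨h2.le, hp⟩)]
          refine ENNReal.ofReal_le_ofReal
            (Real.rpow_le_rpow_of_nonpos (by positivity) (by exact_mod_cast h1) (by linarith))
        · exact zero_le
    _ = ∑' i : ℕ, ∑' p : ℤ × ℤ, (if p ∈ (hbox i).toFinset then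
          ENNReal.ofReal (((2:ℝ) ^ i) ^ (-s)) else 0) := ENNReal.tsum_comm
    _ ≤ ∑' i : ℕ, ENNReal.ofReal (g i) := by
        refine ENNReal.tsum_le_tsum fun i => ?_
        rw [tsum_eq_sum (s := (hbox i).toFinset) (fun p hp => if_neg hp),
          Finset.sum_congr rfl (fun p hp => if_pos hp), Finset.sum_const, nsmul_eq_mul,
          ← ENNReal.ofReal_natCast, ← ENNReal.ofReal_mul (by positivity)]
        refine ENNReal.ofReal_le_ofReal ?_
        rw [mul_comm]
        refine mul_le_mul_of_nonneg_left ?_ (by positivity)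
        have := hcard k m (2 ^ (i + 1)) Nat.one_le_two_pow (hbox i).toFinset ?_ ?_
        · simpa using this
        · intro p hp
          have hp := ((hbox i).mem_toFinset.mp hp).1
          unfold latticeSize at hp
          push_cast
          have h1 : (p.1.natAbs : ℤ) ≤ 2 ^ (i + 1) := by
            exact_mod_cast (show p.1.natAbs ≤ 2 ^ (i + 1) by omega)
          have h2 : (p.2.natAbs : ℤ) ≤ 2 ^ (i + 1) := by
            exact_mod_cast (show p.2.natAbs ≤ 2 ^ (i + 1) by omega)
          rw [Int.natCast_natAbs] at h1 h2
          exact ⟨h1, h2⟩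
        · intro p hp
          exact ((hbox i).mem_toFinset.mp hp).2
    _ = _ := (ENNReal.ofReal_tsum_of_nonneg hg0 hgs).symm

theorem cast_latticeSize (p : ℤ × ℤ) :
    (latticeSize p : ℝ) = 1 + max |(p.1:ℝ)| |(p.2:ℝ)| := by
  have e : ∀ j : ℤ, (j.natAbs : ℝ) = |(j:ℝ)| := fun j => by
    rw [← Int.cast_abs, Int.abs_eq_natAbs]; rfl
  unfold latticeSize
  push_cast
  rw [e, e]

theorem latticeSize_rpow_neg_three_le (p : ℤ × ℤ) : (latticeSize p : ℝ) ^ (-3 : ℝ) ≤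
    (1 + |(p.1:ℝ)|) ^ (-(3/2) : ℝ) * (1 + |(p.2:ℝ)|) ^ (-(3/2) : ℝ) := by
  have h1 : 1 + |(p.1:ℝ)| ≤ latticeSize p := by
    rw [cast_latticeSize]
    gcongr
    exact le_max_left _ _
  have h2 : 1 + |(p.2:ℝ)| ≤ latticeSize p := by
    rw [cast_latticeSize]
    gcongr
    exact le_max_right _ _
  have hp : (0:ℝ) < latticeSize p := by exact_mod_cast latticeSize_pos p
  have : (latticeSize p : ℝ) ^ (-3 : ℝ) =
      (latticeSize p : ℝ) ^ (-(3/2) : ℝ) * (latticeSize p : ℝ) ^ (-(3/2) : ℝ) := by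
    rw [← Real.rpow_add hp]; norm_num
  rw [this]
  gcongr ?_ * ?_
  · exact Real.rpow_le_rpow_of_nonpos (by positivity) h1 (by norm_num)
  · exact Real.rpow_le_rpow_of_nonpos (by positivity) h2 (by norm_num)

theorem weight_mul_le_latticeSize {s : ℝ} (hs : 0 < s) (p : ℤ × ℤ) :
    (1 + |2 * Real.pi * (p.1:ℝ)|) ^ (-(2 * s)) * (1 + |2 * Real.pi * (p.2:ℝ)|) ^ (-(2 * s)) ≤
      (latticeSize p : ℝ) ^ (-(2 * s)) := by
  have hpi : (1:ℝ) ≤ 2 * Real.pi := by linarith [Real.pi_gt_three]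
  rw [← Real.mul_rpow (by positivity) (by positivity)]
  have hp : (0:ℝ) < latticeSize p := by exact_mod_cast latticeSize_pos p
  refine Real.rpow_le_rpow_of_nonpos hp ?_ (by linarith)
  rw [cast_latticeSize, abs_mul (2 * Real.pi), abs_mul (2 * Real.pi),
    abs_of_pos (show 0 < 2 * Real.pi by positivity)]
  have h1 := abs_nonneg (p.1:ℝ)
  have h2 := abs_nonneg (p.2:ℝ)
  have h3 : |(p.1:ℝ)| ≤ 2 * Real.pi * |(p.1:ℝ)| := by nlinarith
  have h4 : |(p.2:ℝ)| ≤ 2 * Real.pi * |(p.2:ℝ)| := by nlinarith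
  have h5 : 0 ≤ (2 * Real.pi * |(p.1:ℝ)|) * (2 * Real.pi * |(p.2:ℝ)|) := by positivity
  rcases max_cases |(p.1:ℝ)| |(p.2:ℝ)| with ⟨h, _⟩ | ⟨h, _⟩ <;> rw [h] <;> nlinarith

theorem weight_split {s ε n τ : ℝ} (hε : 0 < ε) (h1 : ε ≤ 1 / 40) (h2 : 36 * ε ≤ s)
    (hn : 1 ≤ n) (hτ : 1 ≤ τ) :
    n ^ (-(2 * s)) * τ ^ (-(1 - 8 * ε)) ≤ n ^ (-3 : ℝ) + n ^ (-s) * τ ^ (-(1 + ε)) := by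
  have hn0 : 0 < n := by linarith
  have hτ0 : 0 < τ := by linarith
  rcases le_total (n ^ (4:ℝ)) τ with h | h
  · have a1 : n ^ (-(2 * s)) ≤ 1 := Real.rpow_le_one_of_one_le_of_nonpos hn (by linarith)
    have a2 : τ ^ (-(1 - 8 * ε)) ≤ n ^ (-3 : ℝ) := by
      calc τ ^ (-(1 - 8 * ε)) ≤ (n ^ (4:ℝ)) ^ (-(1 - 8 * ε)) :=
            Real.rpow_le_rpow_of_nonpos (by positivity) h (by linarith)
        _ = n ^ (4 * (-(1 - 8 * ε))) := by rw [← Real.rpow_mul hn0.le]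
        _ ≤ _ := Real.rpow_le_rpow_of_exponent_le hn (by linarith)
    have a3 : 0 ≤ n ^ (-s) * τ ^ (-(1 + ε)) := by positivity
    calc _ ≤ 1 * n ^ (-3 : ℝ) := by gcongr
      _ ≤ _ := by linarith
  · have a1 : τ ^ (9 * ε) ≤ n ^ s := by
      calc τ ^ (9 * ε) ≤ (n ^ (4:ℝ)) ^ (9 * ε) := by gcongr
        _ = n ^ (4 * (9 * ε)) := by rw [← Real.rpow_mul hn0.le]
        _ ≤ _ := Real.rpow_le_rpow_of_exponent_le hn (by linarith)
    have e1 : τ ^ (-(1 - 8 * ε)) = τ ^ (9 * ε) * τ ^ (-(1 + ε)) := by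
      rw [← Real.rpow_add hτ0]; congr 1; ring
    have e2 : n ^ (-(2 * s)) * n ^ s = n ^ (-s) := by
      rw [← Real.rpow_add hn0]; congr 1; ring
    calc _ ≤ n ^ (-(2 * s)) * (n ^ s * τ ^ (-(1 + ε))) := by rw [e1]; gcongr
      _ = n ^ (-s) * τ ^ (-(1 + ε)) := by rw [← e2]; ring
      _ ≤ _ := by linarith [show 0 ≤ n ^ (-3 : ℝ) by positivity]

theorem exists_tsum_weight_quadPhase_le {s ε : ℝ} (hs : 0 < s) (hε : 0 < ε) (h1 : ε ≤ 1 / 40)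
    (h2 : 36 * ε ≤ s) :
    ∃ C : ℝ≥0∞, C ≠ ⊤ ∧ ∀ (k : ℤ) (η : ℝ),
      ∑' p : ℤ × ℤ, ENNReal.ofReal
        ((1 + |2 * Real.pi * (p.1:ℝ)|) ^ (-(2 * s)) * (1 + |2 * Real.pi * (p.2:ℝ)|) ^ (-(2 * s)) *
          (1 + |η + 2 * Real.pi * (quadPhase k p : ℝ)|) ^ (-(1 - 8 * ε))) ≤ C := by
  obtain ⟨C, hC, hlev⟩ := exists_tsum_quadPhase_level_le hs
  set S₁ := ∑' j : ℤ, ENNReal.ofReal ((1 + |(j:ℝ)|) ^ (-(3/2) : ℝ)) with hS₁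
  set S₂ := ∑' j : ℤ, ENNReal.ofReal ((1 + |(j:ℝ)|) ^ (-(1 + ε))) with hS₂
  have hS₁t : S₁ ≠ ⊤ := (tsum_int_one_add_abs_rpow_lt_top (by norm_num)).ne
  have hS₂t : S₂ ≠ ⊤ := (tsum_int_one_add_abs_rpow_lt_top (by linarith)).ne
  refine ⟨S₁ * S₁ + C * S₂, by finiteness, fun k η => ?_⟩
  let τ : ℤ → ℝ := fun m => 1 + |η + 2 * Real.pi * (m:ℝ)|
  have hτ : ∀ m, 1 ≤ τ m := fun m => by simp [τ]
  have hτ0 : ∀ m, 0 ≤ τ m := fun m => zero_le_one.trans (hτ m)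
  have hn : ∀ p, (1:ℝ) ≤ latticeSize p := fun p => by exact_mod_cast latticeSize_pos p
  calc _ ≤ ∑' p : ℤ × ℤ, (ENNReal.ofReal ((latticeSize p : ℝ) ^ (-3 : ℝ)) +
        ENNReal.ofReal ((latticeSize p : ℝ) ^ (-s)) *
          ENNReal.ofReal (τ (quadPhase k p) ^ (-(1 + ε)))) := by
        refine ENNReal.tsum_le_tsum fun p => ?_
        rw [← ENNReal.ofReal_mul (by positivity), ← ENNReal.ofReal_add (by positivity)
          (mul_nonneg (by positivity) (Real.rpow_nonneg (hτ0 _) _))]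
        refine ENNReal.ofReal_le_ofReal ?_
        refine le_trans ?_ (weight_split hε h1 h2 (hn p) (hτ _))
        exact mul_le_mul_of_nonneg_right (weight_mul_le_latticeSize hs p)
          (Real.rpow_nonneg (hτ0 _) _)
    _ = ∑' p : ℤ × ℤ, ENNReal.ofReal ((latticeSize p : ℝ) ^ (-3 : ℝ)) +
        ∑' p : ℤ × ℤ, ENNReal.ofReal ((latticeSize p : ℝ) ^ (-s)) *
          ENNReal.ofReal (τ (quadPhase k p) ^ (-(1 + ε))) := ENNReal.tsum_add
    _ ≤ _ := by
        gcongr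
        · calc _ ≤ ∑' p : ℤ × ℤ, ENNReal.ofReal ((1 + |(p.1:ℝ)|) ^ (-(3/2) : ℝ)) *
                ENNReal.ofReal ((1 + |(p.2:ℝ)|) ^ (-(3/2) : ℝ)) := by
                refine ENNReal.tsum_le_tsum fun p => ?_
                rw [← ENNReal.ofReal_mul (by positivity)]
                exact ENNReal.ofReal_le_ofReal (latticeSize_rpow_neg_three_le p)
            _ = S₁ * S₁ := by
                rw [ENNReal.tsum_prod']
                simp only [ENNReal.tsum_mul_left, ENNReal.tsum_mul_right, hS₁]
        · calc _ = ∑' p : ℤ × ℤ, ∑' m : ℤ, (if quadPhase k p = m then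
                  ENNReal.ofReal ((latticeSize p : ℝ) ^ (-s)) else 0) *
                  ENNReal.ofReal (τ m ^ (-(1 + ε))) := by
                congr 1; ext p
                rw [tsum_eq_single (quadPhase k p) (fun m hm => by rw [if_neg hm.symm, zero_mul]),
                  if_pos rfl]
            _ = ∑' m : ℤ, (∑' p : ℤ × ℤ, (if quadPhase k p = m then
                  ENNReal.ofReal ((latticeSize p : ℝ) ^ (-s)) else 0)) *
                  ENNReal.ofReal (τ m ^ (-(1 + ε))) := by
                rw [ENNReal.tsum_comm]
                simp only [ENNReal.tsum_mul_right]
            _ ≤ ∑' m : ℤ, C * ENNReal.ofReal (τ m ^ (-(1 + ε))) := by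
                gcongr with m
                exact hlev k m
            _ ≤ C * S₂ := by
                rw [ENNReal.tsum_mul_left]
                gcongr
                exact tsum_int_shift_le (by linarith) η

section Kernel

theorem rpow_mul_rpow_mul_rpow_le {a b c m ε : ℝ} (hε : 0 < ε) (hε' : ε ≤ 1 / 8) (hb : 1 ≤ b)
    (hc : 1 ≤ c) (hm : 1 ≤ m) (hba : b ≤ a) (hca : c ≤ a) (hma : m ≤ 3 * a) :
    a ^ (-(1 - 2 * ε)) * b ^ (-(1 - 2 * ε)) * c ^ (-(1 - 2 * ε)) ≤
      3 * m ^ (-(1 - 8 * ε)) * (b ^ (-(1 + ε)) * c ^ (-(1 + ε))) := by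
  have ha : 0 < a := by linarith
  have hb0 : 0 < b := by linarith
  have hc0 : 0 < c := by linarith
  have hm0 : 0 < m := by linarith
  have e1 : a ^ (-(1 - 2 * ε)) = a ^ (-(1 - 8 * ε)) * (a ^ (-(3 * ε)) * a ^ (-(3 * ε))) := by
    rw [← Real.rpow_add ha, ← Real.rpow_add ha]; congr 1; ring
  have e2 : ∀ x : ℝ, 0 < x → x ^ (-(1 + ε)) = x ^ (-(3 * ε)) * x ^ (-(1 - 2 * ε)) := by
    intro x hx
    rw [← Real.rpow_add hx]; congr 1; ring
  have h1 : a ^ (-(1 - 8 * ε)) ≤ 3 * m ^ (-(1 - 8 * ε)) := by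
    calc a ^ (-(1 - 8 * ε)) ≤ (m / 3) ^ (-(1 - 8 * ε)) :=
          Real.rpow_le_rpow_of_nonpos (by positivity) (by linarith) (by linarith)
      _ = 3 ^ (1 - 8 * ε) * m ^ (-(1 - 8 * ε)) := by
          rw [Real.div_rpow hm0.le (by norm_num), Real.rpow_neg (by norm_num : (0:ℝ) ≤ 3)]
          field_simp
      _ ≤ 3 ^ (1:ℝ) * m ^ (-(1 - 8 * ε)) := by
          gcongr
          · norm_num
          · linarith
      _ = _ := by rw [Real.rpow_one]
  have h2 : a ^ (-(3 * ε)) ≤ b ^ (-(3 * ε)) :=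
    Real.rpow_le_rpow_of_nonpos hb0 hba (by linarith)
  have h3 : a ^ (-(3 * ε)) ≤ c ^ (-(3 * ε)) :=
    Real.rpow_le_rpow_of_nonpos hc0 hca (by linarith)
  calc a ^ (-(1 - 2 * ε)) * b ^ (-(1 - 2 * ε)) * c ^ (-(1 - 2 * ε))
      ≤ (3 * m ^ (-(1 - 8 * ε)) * (b ^ (-(3 * ε)) * c ^ (-(3 * ε)))) * b ^ (-(1 - 2 * ε)) *
          c ^ (-(1 - 2 * ε)) := by
        rw [e1]; gcongr
    _ = _ := by rw [e2 b hb0, e2 c hc0]; ring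

theorem rpow_triple_le {x y z ε : ℝ} (hε : 0 < ε) (hε' : ε ≤ 1 / 8) :
    (1 + |x|) ^ (-(1 - 2 * ε)) * (1 + |y|) ^ (-(1 - 2 * ε)) * (1 + |z|) ^ (-(1 - 2 * ε)) ≤
      3 * (1 + |x + y + z|) ^ (-(1 - 8 * ε)) *
        ((1 + |x|) ^ (-(1 + ε)) * (1 + |y|) ^ (-(1 + ε)) +
          ((1 + |x|) ^ (-(1 + ε)) * (1 + |z|) ^ (-(1 + ε)) +
            (1 + |y|) ^ (-(1 + ε)) * (1 + |z|) ^ (-(1 + ε)))) := by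
  have hx := abs_nonneg x
  have hy := abs_nonneg y
  have hz := abs_nonneg z
  have hm := abs_nonneg (x + y + z)
  have htri : |x + y + z| ≤ |x| + |y| + |z| := abs_add_three x y z
  set r := -(1 - 2 * ε)
  set q := -(1 + ε)
  have p : ∀ u : ℝ, 0 ≤ (1 + |u|) ^ q := fun u => by positivity
  have pxy := mul_nonneg (p x) (p y)
  have pxz := mul_nonneg (p x) (p z)
  have pyz := mul_nonneg (p y) (p z)
  have hM : 0 ≤ 3 * (1 + |x + y + z|) ^ (-(1 - 8 * ε)) := by positivity
  by_cases h1 : |y| ≤ |x| ∧ |z| ≤ |x|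
  · have := rpow_mul_rpow_mul_rpow_le hε hε' (a := 1 + |x|) (b := 1 + |y|) (c := 1 + |z|)
      (m := 1 + |x + y + z|) (by linarith) (by linarith) (by linarith) (by linarith [h1.1])
      (by linarith [h1.2]) (by linarith [h1.1, h1.2])
    refine this.trans (mul_le_mul_of_nonneg_left ?_ hM)
    linarith
  by_cases h2 : |x| ≤ |y| ∧ |z| ≤ |y|
  · have := rpow_mul_rpow_mul_rpow_le hε hε' (a := 1 + |y|) (b := 1 + |x|) (c := 1 + |z|)
      (m := 1 + |x + y + z|) (by linarith) (by linarith) (by linarith) (by linarith [h2.1])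
      (by linarith [h2.2]) (by linarith [h2.1, h2.2])
    rw [mul_comm ((1 + |y|) ^ _)] at this
    refine this.trans (mul_le_mul_of_nonneg_left ?_ hM)
    linarith
  have h3 : |x| ≤ |z| ∧ |y| ≤ |z| := by grind
  have := rpow_mul_rpow_mul_rpow_le hε hε' (a := 1 + |z|) (b := 1 + |x|) (c := 1 + |y|)
      (m := 1 + |x + y + z|) (by linarith) (by linarith) (by linarith) (by linarith [h3.1])
      (by linarith [h3.2]) (by linarith [h3.1, h3.2])
  rw [mul_assoc, mul_comm ((1 + |z|) ^ _)] at this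
  refine this.trans (mul_le_mul_of_nonneg_left ?_ hM)
  linarith

theorem exists_lintegral_rpow_triple_le {ε : ℝ} (hε : 0 < ε) (hε' : ε ≤ 1 / 8) :
    ∃ J : ℝ≥0∞, J ≠ ⊤ ∧ ∀ m : ℝ, ∫⁻ x : ℝ, ∫⁻ y : ℝ,
      ENNReal.ofReal ((1 + |x|) ^ (-(1 - 2 * ε)) * (1 + |y|) ^ (-(1 - 2 * ε)) *
        (1 + |m - x - y|) ^ (-(1 - 2 * ε))) ≤
      J * ENNReal.ofReal ((1 + |m|) ^ (-(1 - 8 * ε))) := by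
  set F : ℝ → ℝ≥0∞ := fun x => ENNReal.ofReal ((1 + |x|) ^ (-(1 + ε))) with hF
  have hFm : Measurable F := by fun_prop
  set J : ℝ≥0∞ := ∫⁻ x, F x with hJ
  have hJt : J ≠ ⊤ := by
    have := finite_integral_one_add_norm (E := ℝ) (μ := volume) (r := 1 + ε)
      (by simp; linarith)
    simpa [hJ, hF] using this.ne
  refine ⟨3 * (J * J + (J * J + J * J)), by
    simp [ENNReal.mul_eq_top, hJt], fun m => ?_⟩
  have hsub : ∀ c : ℝ, ∫⁻ y, F (c - y) = J := fun c => lintegral_sub_left_eq_self F c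
  have i1 : ∫⁻ x, ∫⁻ y, F x * F y = J * J := by
    simp_rw [lintegral_const_mul _ hFm]
    rw [lintegral_mul_const _ hFm]
  have i2 : ∫⁻ x, ∫⁻ y, F x * F (m - x - y) = J * J := by
    have : ∀ x, ∫⁻ y, F x * F (m - x - y) = F x * J := fun x => by
      rw [lintegral_const_mul _ (by fun_prop), hsub]
    simp_rw [this]
    rw [lintegral_mul_const _ hFm]
  have i3 : ∫⁻ x, ∫⁻ y, F y * F (m - x - y) = J * J := by
    rw [lintegral_lintegral_swap (by fun_prop)]
    have : ∀ y, ∫⁻ x, F y * F (m - x - y) = F y * J := fun y => by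
      rw [lintegral_const_mul _ (by fun_prop), ← hsub (m - y)]
      simp_rw [sub_right_comm m]
    simp_rw [this]
    rw [lintegral_mul_const _ hFm]
  calc _ ≤ ∫⁻ x, ∫⁻ y, 3 * ENNReal.ofReal ((1 + |m|) ^ (-(1 - 8 * ε))) *
        (F x * F y + (F x * F (m - x - y) + F y * F (m - x - y))) := by
        refine lintegral_mono fun x => lintegral_mono fun y => ?_
        have := rpow_triple_le (x := x) (y := y) (z := m - x - y) hε hε'
        rw [show x + y + (m - x - y) = m by ring] at this
        refine (ENNReal.ofReal_le_ofReal this).trans_eq ?_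
        simp only [hF]
        rw [ENNReal.ofReal_mul (by positivity), ENNReal.ofReal_mul (by positivity),
          ENNReal.ofReal_add (by positivity) (by positivity),
          ENNReal.ofReal_add (by positivity) (by positivity), ENNReal.ofReal_mul (by positivity),
          ENNReal.ofReal_mul (by positivity), ENNReal.ofReal_mul (by positivity)]
        norm_num
    _ = 3 * ENNReal.ofReal ((1 + |m|) ^ (-(1 - 8 * ε))) * (J * J + (J * J + J * J)) := by
        have : ∀ x, ∫⁻ y, 3 * ENNReal.ofReal ((1 + |m|) ^ (-(1 - 8 * ε))) *
            (F x * F y + (F x * F (m - x - y) + F y * F (m - x - y))) =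
            3 * ENNReal.ofReal ((1 + |m|) ^ (-(1 - 8 * ε))) * ((∫⁻ y, F x * F y) +
              ((∫⁻ y, F x * F (m - x - y)) + ∫⁻ y, F y * F (m - x - y))) := fun x => by
          rw [lintegral_const_mul _ (by fun_prop), lintegral_add_left (by fun_prop),
            lintegral_add_left (by fun_prop)]
        simp_rw [this]
        rw [lintegral_const_mul _ (by fun_prop), lintegral_add_left (by fun_prop),
            lintegral_add_left (by fun_prop), i1, i2, i3]
    _ = _ := by ring

/-- The measure `dk dη` on the frequency space `ℤ × ℝ`. -/
abbrev freqMeasure : Measure (ℤ × ℝ) := (Measure.count : Measure ℤ).prod volume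

instance : freqMeasure.IsNegInvariant where
  neg_eq_self := by
    have h := (Measure.measurePreserving_neg (Measure.count : Measure ℤ)).prod
      (Measure.measurePreserving_neg (volume : Measure ℝ))
    exact h.map_eq

theorem lintegral_freqMeasure {f : ℤ × ℝ → ℝ≥0∞} (hf : Measurable f) :
    ∫⁻ ξ, f ξ ∂freqMeasure = ∑' k : ℤ, ∫⁻ η : ℝ, f (k, η) := by
  rw [lintegral_prod _ hf.aemeasurable, lintegral_count]

/-- The spatial weight `(1 + |2πk|) ^ s`. -/
def spaceWeight (s : ℝ) (ξ : ℤ × ℝ) : ℝ≥0∞ := ENNReal.ofReal ((1 + |2 * Real.pi * (ξ.1:ℝ)|) ^ s)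

/-- The dispersive weight `(1 + |η + 2πk²|) ^ b`. -/
def modWeight (b : ℝ) (ξ : ℤ × ℝ) : ℝ≥0∞ :=
  ENNReal.ofReal ((1 + |ξ.2 + 2 * Real.pi * (ξ.1:ℝ) ^ 2|) ^ b)

@[fun_prop]
theorem measurable_spaceWeight (s : ℝ) : Measurable (spaceWeight s) := by
  unfold spaceWeight; fun_prop

@[fun_prop]
theorem measurable_modWeight (b : ℝ) : Measurable (modWeight b) := by
  unfold modWeight; fun_prop

theorem spaceWeight_ne_top (s : ℝ) (ξ : ℤ × ℝ) : spaceWeight s ξ ≠ ⊤ := ENNReal.ofReal_ne_top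

theorem modWeight_ne_top (b : ℝ) (ξ : ℤ × ℝ) : modWeight b ξ ≠ ⊤ := ENNReal.ofReal_ne_top

theorem spaceWeight_ne_zero (s : ℝ) (ξ : ℤ × ℝ) : spaceWeight s ξ ≠ 0 :=
  (ENNReal.ofReal_pos.2 (by positivity)).ne'

theorem modWeight_ne_zero (b : ℝ) (ξ : ℤ × ℝ) : modWeight b ξ ≠ 0 :=
  (ENNReal.ofReal_pos.2 (by positivity)).ne'

theorem spaceWeight_neg (s : ℝ) (ξ : ℤ × ℝ) : spaceWeight s (-ξ) = spaceWeight s ξ := by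
  simp [spaceWeight]

theorem inv_sq_ofReal_rpow {a : ℝ} (ha : 0 < a) (b : ℝ) :
    (ENNReal.ofReal (a ^ b) ^ 2)⁻¹ = ENNReal.ofReal (a ^ (-(2 * b))) := by
  rw [← ENNReal.ofReal_pow (by positivity), ← ENNReal.ofReal_inv_of_pos (by positivity),
    ← Real.rpow_natCast, ← Real.rpow_mul ha.le, ← Real.rpow_neg ha.le]
  congr 2
  push_cast
  ring

theorem modWeight_inv (b : ℝ) (ξ : ℤ × ℝ) : (modWeight b ξ)⁻¹ = modWeight (-b) ξ := by
  unfold modWeight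
  rw [← ENNReal.ofReal_inv_of_pos (by positivity), Real.rpow_neg (by positivity)]

theorem spaceWeight_add_le {s : ℝ} (hs : 0 ≤ s) (ξ ζ : ℤ × ℝ) :
    spaceWeight s (ξ + ζ) ≤ ENNReal.ofReal (2 ^ s) * (spaceWeight s ξ + spaceWeight s ζ) := by
  unfold spaceWeight
  rw [← ENNReal.ofReal_add (by positivity) (by positivity), ← ENNReal.ofReal_mul (by positivity)]
  refine ENNReal.ofReal_le_ofReal ?_
  set a := 1 + |2 * Real.pi * (ξ.1:ℝ)| with ha
  set b := 1 + |2 * Real.pi * (ζ.1:ℝ)| with hb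
  have ha0 : 0 < a := by positivity
  have hb0 : 0 < b := by positivity
  have h1 : 1 + |2 * Real.pi * ((ξ + ζ).1:ℝ)| ≤ 2 * max a b := by
    have : |2 * Real.pi * ((ξ + ζ).1:ℝ)| ≤ |2 * Real.pi * (ξ.1:ℝ)| + |2 * Real.pi * (ζ.1:ℝ)| := by
      push_cast [Prod.fst_add]
      rw [mul_add]
      exact abs_add_le _ _
    linarith [le_max_left a b, le_max_right a b]
  calc (1 + |2 * Real.pi * ((ξ + ζ).1:ℝ)|) ^ s ≤ (2 * max a b) ^ s := by gcongr
    _ = 2 ^ s * (max a b) ^ s := Real.mul_rpow (by norm_num) (by positivity)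
    _ ≤ 2 ^ s * (a ^ s + b ^ s) := by
      gcongr
      rcases max_choice a b with h | h <;> rw [h]
      · linarith [Real.rpow_nonneg hb0.le s]
      · linarith [Real.rpow_nonneg ha0.le s]

/-- The convolution of the inverse squared weights is bounded. -/
theorem exists_lconvolution_weight_le {s ε : ℝ} (hs : 0 < s) (hε : 0 < ε) (h1 : ε ≤ 1 / 40)
    (h2 : 36 * ε ≤ s) : ∃ K : ℝ≥0∞, K ≠ ⊤ ∧ ∀ ξ,
      ((fun y => ((spaceWeight s y * modWeight (1 / 2 - ε) y) ^ 2)⁻¹) ⋆ₗ[freqMeasure]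
        ((fun y => ((spaceWeight s y * modWeight (1 / 2 - ε) y) ^ 2)⁻¹) ⋆ₗ[freqMeasure]
          (fun y => (modWeight (1 / 2 - ε) y ^ 2)⁻¹))) ξ ≤ K := by
  obtain ⟨C, hC, hCb⟩ := exists_tsum_weight_quadPhase_le hs hε h1 h2
  obtain ⟨J, hJ, hJb⟩ := exists_lintegral_rpow_triple_le hε (by linarith)
  refine ⟨J * C, ENNReal.mul_ne_top hJ hC, ?_⟩
  rintro ⟨k, η⟩
  have hmod : ∀ ξ : ℤ × ℝ, (modWeight (1 / 2 - ε) ξ ^ 2)⁻¹ =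
      ENNReal.ofReal ((1 + |ξ.2 + 2 * Real.pi * (ξ.1:ℝ) ^ 2|) ^ (-(1 - 2 * ε))) := fun ξ => by
    rw [modWeight, inv_sq_ofReal_rpow (by positivity)]
    ring_nf
  have hspace : ∀ ξ : ℤ × ℝ, ((spaceWeight s ξ * modWeight (1 / 2 - ε) ξ) ^ 2)⁻¹ =
      ENNReal.ofReal ((1 + |2 * Real.pi * (ξ.1:ℝ)|) ^ (-(2 * s))) *
      ENNReal.ofReal ((1 + |ξ.2 + 2 * Real.pi * (ξ.1:ℝ) ^ 2|) ^ (-(1 - 2 * ε))) := fun ξ => by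
    rw [mul_pow, ENNReal.mul_inv (Or.inl (pow_ne_zero 2 (spaceWeight_ne_zero s ξ)))
      (Or.inl (ENNReal.pow_ne_top (spaceWeight_ne_top s ξ))), hmod, spaceWeight,
      inv_sq_ofReal_rpow (by positivity)]
  simp only [lconvolution_def, hmod, hspace]
  rw [lintegral_freqMeasure (by fun_prop)]
  calc _ = ∑' a : ℤ, ∑' b : ℤ, ENNReal.ofReal ((1 + |2 * Real.pi * (a:ℝ)|) ^ (-(2 * s)) *
        (1 + |2 * Real.pi * (b:ℝ)|) ^ (-(2 * s))) * ∫⁻ x : ℝ, ∫⁻ y : ℝ,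
        ENNReal.ofReal ((1 + |x|) ^ (-(1 - 2 * ε)) * (1 + |y|) ^ (-(1 - 2 * ε)) *
          (1 + |(η + 2 * Real.pi * (quadPhase k (a, b):ℝ)) - x - y|) ^ (-(1 - 2 * ε))) := by
        refine tsum_congr fun a => ?_
        rw [← lintegral_add_right_eq_self (μ := (volume : Measure ℝ)) _
          (-(2 * Real.pi * (a:ℝ) ^ 2))]
        have inner : ∀ x : ℝ, ∫⁻ q, ENNReal.ofReal ((1 + |2 * Real.pi * (q.1:ℝ)|) ^ (-(2 * s))) *
            ENNReal.ofReal ((1 + |q.2 + 2 * Real.pi * (q.1:ℝ) ^ 2|) ^ (-(1 - 2 * ε))) *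
            ENNReal.ofReal ((1 + |(-q + (-(a, x + -(2 * Real.pi * (a:ℝ) ^ 2)) + (k, η))).2 +
              2 * Real.pi * (((-q + (-(a, x + -(2 * Real.pi * (a:ℝ) ^ 2)) + (k, η))).1 : ℤ):ℝ) ^ 2|)
                ^ (-(1 - 2 * ε))) ∂freqMeasure =
            ∑' b : ℤ, ∫⁻ y : ℝ, ENNReal.ofReal ((1 + |2 * Real.pi * (b:ℝ)|) ^ (-(2 * s)) *
              ((1 + |y|) ^ (-(1 - 2 * ε)) *
          (1 + |(η + 2 * Real.pi * (quadPhase k (a, b):ℝ)) - x - y|) ^ (-(1 - 2 * ε)))) := by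
          intro x
          rw [lintegral_freqMeasure (by fun_prop)]
          refine tsum_congr fun b => ?_
          rw [← lintegral_add_right_eq_self (μ := (volume : Measure ℝ)) _
            (-(2 * Real.pi * (b:ℝ) ^ 2))]
          refine lintegral_congr fun y => ?_
          rw [← ENNReal.ofReal_mul (by positivity), ← ENNReal.ofReal_mul (by positivity), mul_assoc]
          simp only [Prod.neg_mk, Prod.mk_add_mk, quadPhase]
          push_cast
          ring_nf
        simp only [inner]
        simp_rw [← ENNReal.tsum_mul_left]
        rw [lintegral_tsum (fun b => by fun_prop)]
        refine tsum_congr fun b => ?_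
        rw [← lintegral_const_mul _ (by fun_prop)]
        refine lintegral_congr fun x => ?_
        rw [← lintegral_const_mul _ (by fun_prop), ← lintegral_const_mul _ (by fun_prop)]
        refine lintegral_congr fun y => ?_
        rw [← ENNReal.ofReal_mul (by positivity), ← ENNReal.ofReal_mul (by positivity),
          ← ENNReal.ofReal_mul (by positivity)]
        simp only [neg_add_cancel_right]
        ring_nf
    _ ≤ ∑' a : ℤ, ∑' b : ℤ, J * ENNReal.ofReal ((1 + |2 * Real.pi * (a:ℝ)|) ^ (-(2 * s)) *
        (1 + |2 * Real.pi * (b:ℝ)|) ^ (-(2 * s)) *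
          (1 + |η + 2 * Real.pi * (quadPhase k (a, b):ℝ)|) ^ (-(1 - 8 * ε))) := by
        refine ENNReal.tsum_le_tsum fun a => ENNReal.tsum_le_tsum fun b => ?_
        rw [ENNReal.ofReal_mul (q := (1 + |η + _|) ^ _) (by positivity), mul_left_comm J]
        gcongr
        exact hJb _
    _ = J * ∑' p : ℤ × ℤ, ENNReal.ofReal ((1 + |2 * Real.pi * (p.1:ℝ)|) ^ (-(2 * s)) *
        (1 + |2 * Real.pi * (p.2:ℝ)|) ^ (-(2 * s)) *
          (1 + |η + 2 * Real.pi * (quadPhase k p:ℝ)|) ^ (-(1 - 8 * ε))) := by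
        rw [ENNReal.tsum_prod']
        simp_rw [ENNReal.tsum_mul_left]
    _ ≤ J * C := by
        gcongr
        exact hCb k η

end Kernel

section Convolution

variable {G : Type*} [MeasurableSpace G] {μ : Measure G}

/-- The Cauchy–Schwarz inequality for lower Lebesgue integrals, in squared form. -/
theorem lintegral_mul_sq_le {f g : G → ℝ≥0∞} (hf : AEMeasurable f μ) (hg : AEMeasurable g μ) :
    (∫⁻ x, f x * g x ∂μ) ^ 2 ≤ (∫⁻ x, f x ^ 2 ∂μ) * ∫⁻ x, g x ^ 2 ∂μ := by
  have h := ENNReal.lintegral_mul_le_Lp_mul_Lq μ Real.HolderConjugate.two_two hf hg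
  simp only [ENNReal.rpow_two, Pi.mul_apply] at h
  calc (∫⁻ x, f x * g x ∂μ) ^ 2
      ≤ ((∫⁻ x, f x ^ 2 ∂μ) ^ (1 / (2:ℝ)) * (∫⁻ x, g x ^ 2 ∂μ) ^ (1 / (2:ℝ))) ^ 2 := by gcongr
    _ = _ := by
      rw [mul_pow, ← ENNReal.rpow_natCast, ← ENNReal.rpow_natCast, ← ENNReal.rpow_mul,
        ← ENNReal.rpow_mul]
      norm_num

/-- If `f ^ 2 ≤ a * b` pointwise, then `(∫ f) ^ 2 ≤ (∫ a) * (∫ b)`. -/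
theorem lintegral_sq_le_of_sq_le_mul {f a b : G → ℝ≥0∞} (ha : AEMeasurable a μ)
    (hb : AEMeasurable b μ) (h : ∀ x, f x ^ 2 ≤ a x * b x) :
    (∫⁻ x, f x ∂μ) ^ 2 ≤ (∫⁻ x, a x ∂μ) * ∫⁻ x, b x ∂μ := by
  have hsq : ∀ c : ℝ≥0∞, (c ^ (1 / (2:ℝ))) ^ 2 = c := fun c => by
    rw [← ENNReal.rpow_natCast, ← ENNReal.rpow_mul]; norm_num
  calc (∫⁻ x, f x ∂μ) ^ 2
      ≤ (∫⁻ x, a x ^ (1 / (2:ℝ)) * b x ^ (1 / (2:ℝ)) ∂μ) ^ 2 := by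
        gcongr with x
        rw [← ENNReal.mul_rpow_of_nonneg _ _ (by norm_num)]
        calc f x = (f x ^ 2) ^ (1 / (2:ℝ)) := by
              rw [← ENNReal.rpow_natCast, ← ENNReal.rpow_mul]; norm_num
          _ ≤ _ := ENNReal.rpow_le_rpow (h x) (by norm_num)
    _ ≤ (∫⁻ x, (a x ^ (1 / (2:ℝ))) ^ 2 ∂μ) * ∫⁻ x, (b x ^ (1 / (2:ℝ))) ^ 2 ∂μ :=
        lintegral_mul_sq_le (ha.pow_const _) (hb.pow_const _)
    _ = _ := by simp_rw [hsq]

/-- A converse to the Cauchy–Schwarz inequality: the `L²` norm by duality. -/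
theorem lintegral_sq_le_of_duality [SigmaFinite μ] {g : G → ℝ≥0∞} (hg : Measurable g) {A : ℝ≥0∞}
    (h : ∀ f : G → ℝ≥0∞, Measurable f → (∫⁻ x, f x * g x ∂μ) ^ 2 ≤ A * ∫⁻ x, f x ^ 2 ∂μ) :
    ∫⁻ x, g x ^ 2 ∂μ ≤ A := by
  set f : ℕ → G → ℝ≥0∞ := fun n => (spanningSets μ n).indicator fun x => min (g x) n with hf
  have hfm : ∀ n, Measurable (f n) := fun n =>
    (hg.min measurable_const).indicator (measurableSet_spanningSets μ n)
  have hmono : Monotone f := by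
    intro m n hmn x
    by_cases hx : x ∈ spanningSets μ m
    · have hx' : x ∈ spanningSets μ n := monotone_spanningSets μ hmn hx
      simp only [hf, Set.indicator_of_mem hx, Set.indicator_of_mem hx']
      gcongr
    · simp [hf, Set.indicator_of_notMem hx]
  have hle : ∀ n x, f n x ≤ g x := fun n x => by
    by_cases hx : x ∈ spanningSets μ n
    · simp [hf, Set.indicator_of_mem hx]
    · simp [hf, Set.indicator_of_notMem hx]
  have hbd : ∀ n, ∫⁻ x, f n x ^ 2 ∂μ ≤ A := by
    intro n
    have hfin : ∫⁻ x, f n x ^ 2 ∂μ ≠ ⊤ := by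
      have : ∫⁻ x, f n x ^ 2 ∂μ ≤ (n:ℝ≥0∞) ^ 2 * μ (spanningSets μ n) := by
        rw [← lintegral_indicator_const (measurableSet_spanningSets μ n)]
        refine lintegral_mono fun x => ?_
        by_cases hx : x ∈ spanningSets μ n
        · simp only [hf, Set.indicator_of_mem hx]
          gcongr
          exact min_le_right _ _
        · simp [hf, Set.indicator_of_notMem hx]
      refine ne_top_of_le_ne_top (ENNReal.mul_ne_top (by simp) ?_) this
      exact (measure_spanningSets_lt_top μ n).ne
    by_cases h0 : ∫⁻ x, f n x ^ 2 ∂μ = 0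
    · simp [h0]
    have h1 : (∫⁻ x, f n x ^ 2 ∂μ) * ∫⁻ x, f n x ^ 2 ∂μ ≤ A * ∫⁻ x, f n x ^ 2 ∂μ := by
      refine le_trans ?_ (h (f n) (hfm n))
      rw [sq (∫⁻ x, f n x * g x ∂μ)]
      have : ∫⁻ x, f n x ^ 2 ∂μ ≤ ∫⁻ x, f n x * g x ∂μ := by
        refine lintegral_mono fun x => ?_
        rw [sq]
        gcongr
        exact hle n x
      gcongr
    exact (ENNReal.mul_le_mul_iff_left h0 hfin).1 h1
  have hsup : ∀ x, ⨆ n, f n x ^ 2 = g x ^ 2 := by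
    intro x
    have ht : Filter.Tendsto (fun n => f n x) Filter.atTop (nhds (g x)) := by
      obtain ⟨N, hN⟩ : ∃ N, x ∈ spanningSets μ N := by
        have := iUnion_spanningSets μ
        exact Set.mem_iUnion.1 (this ▸ Set.mem_univ x)
      have h2 : Filter.Tendsto (fun n : ℕ => min (g x) (n:ℝ≥0∞)) Filter.atTop
          (nhds (min (g x) ⊤)) :=
        tendsto_const_nhds.min ENNReal.tendsto_nat_nhds_top
      rw [min_eq_left le_top] at h2
      refine h2.congr' ?_
      filter_upwards [Filter.eventually_ge_atTop N] with n hn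
      simp [hf, Set.indicator_of_mem (monotone_spanningSets μ hn hN)]
    have ht2 : Filter.Tendsto (fun n => f n x ^ 2) Filter.atTop (nhds (g x ^ 2)) :=
      ((ENNReal.continuous_pow 2).tendsto _).comp ht
    refine tendsto_nhds_unique (tendsto_atTop_iSup ?_) ht2
    intro m n hmn
    exact pow_le_pow_left' (hmono hmn x) 2
  calc ∫⁻ x, g x ^ 2 ∂μ = ∫⁻ x, ⨆ n, f n x ^ 2 ∂μ := by simp_rw [hsup]
    _ = ⨆ n, ∫⁻ x, f n x ^ 2 ∂μ := by
      refine lintegral_iSup (fun n => (hfm n).pow_const 2) ?_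
      intro m n hmn x
      exact pow_le_pow_left' (hmono hmn x) 2
    _ ≤ A := iSup_le hbd

variable [AddCommGroup G]

theorem lconvolution_mono {f f' g g' : G → ℝ≥0∞} (hf : ∀ x, f x ≤ f' x) (hg : ∀ x, g x ≤ g' x)
    (x : G) : (f ⋆ₗ[μ] g) x ≤ (f' ⋆ₗ[μ] g') x :=
  lintegral_mono fun y => mul_le_mul' (hf y) (hg _)

variable [MeasurableAdd₂ G] [MeasurableNeg G]

theorem lconvolution_add_right {f g g' : G → ℝ≥0∞} (hf : Measurable f) (hg : Measurable g)
    (x : G) : (f ⋆ₗ[μ] (fun y => g y + g' y)) x = (f ⋆ₗ[μ] g) x + (f ⋆ₗ[μ] g') x := by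
  simp only [lconvolution_def, mul_add]
  exact lintegral_add_left (by fun_prop) _

theorem lconvolution_sq_le {f g a b a' b' : G → ℝ≥0∞} (ha : Measurable a) (hb : Measurable b)
    (ha' : Measurable a') (hb' : Measurable b') (hf : ∀ x, f x ^ 2 ≤ a x * a' x)
    (hg : ∀ x, g x ^ 2 ≤ b x * b' x) (x : G) :
    (f ⋆ₗ[μ] g) x ^ 2 ≤ (a ⋆ₗ[μ] b) x * (a' ⋆ₗ[μ] b') x := by
  simp only [lconvolution_def]
  refine lintegral_sq_le_of_sq_le_mul (by fun_prop) (by fun_prop) fun y => ?_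
  rw [mul_pow, mul_mul_mul_comm]
  exact mul_le_mul' (hf y) (hg _)

theorem lintegral_lconvolution [SFinite μ] [μ.IsAddLeftInvariant] {f g : G → ℝ≥0∞}
    (hf : Measurable f) (hg : Measurable g) :
    ∫⁻ x, (f ⋆ₗ[μ] g) x ∂μ = (∫⁻ x, f x ∂μ) * ∫⁻ x, g x ∂μ := by
  simp only [lconvolution_def]
  rw [lintegral_lintegral_swap (by fun_prop)]
  have : ∀ y, ∫⁻ x, f y * g (-y + x) ∂μ = f y * ∫⁻ x, g x ∂μ := fun y => by
    rw [lintegral_const_mul _ (by fun_prop), lintegral_add_left_eq_self]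
  simp_rw [this]
  exact lintegral_mul_const _ hf

/-- A weight that is quasi-subadditive with constant `c` obeys a Leibniz rule for convolutions. -/
theorem mul_lconvolution_le {W x Y Z : G → ℝ≥0∞} {c C : ℝ≥0∞} (hW : Measurable W)
    (hc : ∀ ξ ζ, W (ξ + ζ) ≤ c * (W ξ + W ζ)) (hC : 1 ≤ C) (hx : Measurable x) (hY : Measurable Y)
    (hZ : Measurable Z) (hYZ : ∀ ξ, W ξ * Y ξ ≤ C * Z ξ) (ξ : G) :
    W ξ * (x ⋆ₗ[μ] Y) ξ ≤
      c * C * (((fun ζ => W ζ * x ζ) ⋆ₗ[μ] Y) ξ + (x ⋆ₗ[μ] Z) ξ) := by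
  simp only [lconvolution_def]
  rw [← lintegral_const_mul _ (by fun_prop), ← lintegral_add_left (by fun_prop),
    ← lintegral_const_mul _ (by fun_prop)]
  refine lintegral_mono fun y => ?_
  calc W ξ * (x y * Y (-y + ξ)) ≤ c * (W y + W (-y + ξ)) * (x y * Y (-y + ξ)) := by
        gcongr
        simpa using hc y (-y + ξ)
    _ = c * (W y * x y * Y (-y + ξ) + x y * (W (-y + ξ) * Y (-y + ξ))) := by ring
    _ ≤ c * (C * (W y * x y * Y (-y + ξ)) + x y * (C * Z (-y + ξ))) := by
        refine mul_le_mul' le_rfl (add_le_add ?_ (mul_le_mul' le_rfl (hYZ _)))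
        exact le_mul_of_one_le_left' hC
    _ = _ := by ring

end Convolution

section ConvolutionAlgebra

variable {G : Type*} [MeasurableSpace G]

/-- Measurable `ℝ≥0∞`-valued functions on a group, with convolution against `μ` as product. -/
def ConvFun (_μ : Measure G) : Type _ := {f : G → ℝ≥0∞ // Measurable f}

namespace ConvFun

variable {μ : Measure G}

instance : Add (ConvFun μ) where
  add f g := ⟨fun x => f.1 x + g.1 x, f.2.add g.2⟩

theorem add_val (f g : ConvFun μ) (x : G) : (f + g).1 x = f.1 x + g.1 x := rfl

variable [AddCommGroup G] [MeasurableNeg G]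

/-- The reflection `ξ ↦ f (-ξ)`. -/
def reflect (f : ConvFun μ) : ConvFun μ := ⟨fun x => f.1 (-x), f.2.comp measurable_neg⟩

theorem reflect_val (f : ConvFun μ) (x : G) : f.reflect.1 x = f.1 (-x) := rfl

theorem reflect_reflect (f : ConvFun μ) : f.reflect.reflect = f :=
  Subtype.ext (funext fun x => congrArg f.1 (neg_neg x))

/-- The square of the `L²` norm. -/
def l2Sq (f : ConvFun μ) : ℝ≥0∞ := ∫⁻ x, f.1 x ^ 2 ∂μ

/-- Pointwise multiplication by a measurable weight. -/
def weight (W : G → ℝ≥0∞) (hW : Measurable W) (f : ConvFun μ) : ConvFun μ :=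
  ⟨fun x => W x * f.1 x, hW.mul f.2⟩

/-- Equality up to reflection. -/
def EqUpToReflect (f g : ConvFun μ) : Prop := f = g ∨ f = g.reflect

variable [MeasurableAdd₂ G] [SFinite μ] [μ.IsAddLeftInvariant] [μ.IsNegInvariant]

instance : CommSemigroup (ConvFun μ) where
  mul f g := ⟨f.1 ⋆ₗ[μ] g.1, measurable_lconvolution μ f.2 g.2⟩
  mul_assoc f g h := Subtype.ext (lconvolution_assoc f.2 g.2 h.2).symm
  mul_comm _ _ := Subtype.ext lconvolution_comm

theorem mul_val (f g : ConvFun μ) (x : G) : (f * g).1 x = ∫⁻ y, f.1 y * g.1 (-y + x) ∂μ := rfl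

theorem mul_add_eq (f g h : ConvFun μ) : f * (g + h) = f * g + f * h :=
  Subtype.ext (funext (lconvolution_add_right f.2 g.2))

theorem reflect_mul (f g : ConvFun μ) : (f * g).reflect = f.reflect * g.reflect := by
  refine Subtype.ext (funext fun x => ?_)
  rw [reflect_val, mul_val, mul_val, ← lintegral_neg_eq_self]
  simp [reflect_val, add_comm]

theorem l2Sq_eq (f : ConvFun μ) : f.l2Sq = (f * f.reflect).1 0 := by
  simp [l2Sq, mul_val, reflect_val, sq]

theorem l2Sq_reflect_mul (f g : ConvFun μ) : (f.reflect * g).l2Sq = (f * g).l2Sq := by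
  simp only [l2Sq_eq, reflect_mul, reflect_reflect]
  ac_rfl

theorem mul_apply_zero_sq_le (f g : ConvFun μ) : (f * g).1 0 ^ 2 ≤ f.l2Sq * g.l2Sq := by
  have hg : g.l2Sq = ∫⁻ x, g.1 (-x) ^ 2 ∂μ := (lintegral_neg_eq_self (fun x => g.1 x ^ 2)).symm
  rw [hg, l2Sq, mul_val]
  simp only [add_zero]
  exact lintegral_mul_sq_le f.2.aemeasurable (g.2.comp measurable_neg).aemeasurable

theorem lintegral_mul_eq (h f : ConvFun μ) : ∫⁻ x, h.1 x * f.1 x ∂μ = (h.reflect * f).1 0 := by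
  rw [mul_val, ← lintegral_neg_eq_self]
  simp [reflect_val]

theorem EqUpToReflect.l2Sq_mul {f f' : ConvFun μ} (h : EqUpToReflect f f') (g : ConvFun μ) :
    (f * g).l2Sq = (f' * g).l2Sq := by
  rcases h with rfl | rfl
  · rfl
  · exact l2Sq_reflect_mul _ _

theorem EqUpToReflect.l2Sq_mul_mul {a a' b b' c c' : ConvFun μ} (ha : EqUpToReflect a a')
    (hb : EqUpToReflect b b') (hc : EqUpToReflect c c') :
    (a * b * c).l2Sq = (a' * b' * c').l2Sq := by
  rw [mul_assoc, ha.l2Sq_mul, show a' * (b * c) = b * (a' * c) by ac_rfl, hb.l2Sq_mul,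
    show b' * (a' * c) = c * (a' * b') by ac_rfl, hc.l2Sq_mul, mul_comm]

/-- A six-fold convolution at the origin, split into two three-fold convolutions. -/
theorem lintegral_mul_sq_le (h a u v p q z : ConvFun μ) (hz : z = a * u * v * p * q) :
    (∫⁻ x, h.1 x * z.1 x ∂μ) ^ 2 ≤ (p * q * h.reflect).l2Sq * (u * v * a).l2Sq := by
  subst hz
  rw [lintegral_mul_eq]
  convert mul_apply_zero_sq_le (p * q * h.reflect) (u * v * a) using 3
  ac_rfl

/-- The trilinear `L²` estimate that follows from a pointwise bound on the convolution of
the inverse squares of the weights. -/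
theorem l2Sq_mul_mul_le {ρ σ : G → ℝ≥0∞} (hρ : Measurable ρ) (hσ : Measurable σ)
    (hρ0 : ∀ x, ρ x ≠ 0) (hρt : ∀ x, ρ x ≠ ⊤) (hσ0 : ∀ x, σ x ≠ 0) (hσt : ∀ x, σ x ≠ ⊤)
    {K : ℝ≥0∞}
    (hK : ∀ x, ((fun y => (σ y ^ 2)⁻¹) ⋆ₗ[μ] ((fun y => (σ y ^ 2)⁻¹) ⋆ₗ[μ]
      (fun y => (ρ y ^ 2)⁻¹))) x ≤ K) (f g h : ConvFun μ) :
    (f * g * h).l2Sq ≤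
      K * ((f.weight σ hσ).l2Sq * (g.weight σ hσ).l2Sq * (h.weight ρ hρ).l2Sq) := by
  have key : ∀ {τ : G → ℝ≥0∞}, (∀ x, τ x ≠ 0) → (∀ x, τ x ≠ ⊤) → ∀ (f : ConvFun μ) (x : G),
      f.1 x ^ 2 ≤ (τ x * f.1 x) ^ 2 * (τ x ^ 2)⁻¹ := by
    intro τ h0 ht f x
    rw [mul_pow, mul_right_comm, ENNReal.mul_inv_cancel (by simp [h0]) (by simp [ht]), one_mul]
  have hf := f.2
  have hg := g.2
  have hh := h.2
  have hpt := lconvolution_sq_le (μ := μ) (f := f.1) (g := g.1 ⋆ₗ[μ] h.1)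
    (by fun_prop) (by fun_prop) (by fun_prop) (by fun_prop) (key hσ0 hσt f)
    (lconvolution_sq_le (by fun_prop) (by fun_prop) (by fun_prop) (by fun_prop) (key hσ0 hσt g)
      (key hρ0 hρt h))
  rw [mul_assoc, mul_comm K]
  refine (lintegral_mono fun x => (hpt x).trans (mul_le_mul' le_rfl (hK x))).trans_eq ?_
  rw [lintegral_mul_const _ (by fun_prop), lintegral_lconvolution (by fun_prop) (by fun_prop),
    lintegral_lconvolution (by fun_prop) (by fun_prop), ← mul_assoc]
  rfl

end ConvFun

variable [AddCommGroup G] [MeasurableNeg G] {μ : Measure G} [MeasurableAdd₂ G]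
  [μ.IsAddLeftInvariant] [μ.IsNegInvariant]

open ConvFun in
/-- The quintic convolution estimate: a weight `W` satisfying a Leibniz rule and a weight `ρ` such
that the inverse squares of `W * ρ`, `W * ρ` and `ρ` have a bounded convolution. -/
theorem lintegral_sq_quintic_le [SigmaFinite μ] {W ρ : G → ℝ≥0∞} (hW : Measurable W)
    (hρ : Measurable ρ) (hρ0 : ∀ x, ρ x ≠ 0) (hρt : ∀ x, ρ x ≠ ⊤) (hW0 : ∀ x, W x ≠ 0)
    (hWt : ∀ x, W x ≠ ⊤) (hWn : ∀ x, W (-x) = W x) {c K : ℝ≥0∞} (hc1 : 1 ≤ c)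
    (hc : ∀ ξ ζ, W (ξ + ζ) ≤ c * (W ξ + W ζ))
    (hK : ∀ x, ((fun y => ((W y * ρ y) ^ 2)⁻¹) ⋆ₗ[μ] ((fun y => ((W y * ρ y) ^ 2)⁻¹) ⋆ₗ[μ]
      (fun y => (ρ y ^ 2)⁻¹))) x ≤ K)
    {f₁ f₂ f₃ f₄ f₅ : G → ℝ≥0∞} (h₁ : Measurable f₁) (h₂ : Measurable f₂) (h₃ : Measurable f₃)
    (h₄ : Measurable f₄) (h₅ : Measurable f₅) :
    ∫⁻ x, (W x * (ρ x)⁻¹ * (f₁ ⋆ₗ[μ] ((fun y => f₂ (-y)) ⋆ₗ[μ] (f₃ ⋆ₗ[μ]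
      ((fun y => f₄ (-y)) ⋆ₗ[μ] f₅)))) x) ^ 2 ∂μ ≤
    (c ^ 4 * 5 * K) ^ 2 * ((∫⁻ x, (W x * ρ x * f₁ x) ^ 2 ∂μ) * (∫⁻ x, (W x * ρ x * f₂ x) ^ 2 ∂μ) *
      (∫⁻ x, (W x * ρ x * f₃ x) ^ 2 ∂μ) * (∫⁻ x, (W x * ρ x * f₄ x) ^ 2 ∂μ) *
      ∫⁻ x, (W x * ρ x * f₅ x) ^ 2 ∂μ) := by
  set F₁ : ConvFun μ := ⟨f₁, h₁⟩ with hF₁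
  set F₂ : ConvFun μ := ⟨f₂, h₂⟩ with hF₂
  set F₃ : ConvFun μ := ⟨f₃, h₃⟩ with hF₃
  set F₄ : ConvFun μ := ⟨f₄, h₄⟩ with hF₄
  set F₅ : ConvFun μ := ⟨f₅, h₅⟩ with hF₅
  set D : ConvFun μ → ConvFun μ := fun f => f.weight W hW with hD
  have hσ : Measurable fun x => W x * ρ x := hW.mul hρ
  set q : ConvFun μ → ℝ≥0∞ := fun f => (f.weight _ hσ).l2Sq with hq
  have hDq : ∀ f : ConvFun μ, ((D f).weight ρ hρ).l2Sq = q f := by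
    intro f
    simp only [hq, hD, weight, mul_comm (W _) (ρ _), mul_assoc]
  have hDreflect : ∀ f : ConvFun μ, D f.reflect = (D f).reflect := by
    intro f
    refine Subtype.ext (funext fun x => ?_)
    change W x * f.1 (-x) = W (-x) * f.1 (-x)
    rw [hWn]
  have T : ∀ {a b d a' b' d' : ConvFun μ}, EqUpToReflect a a' → EqUpToReflect b b' →
      EqUpToReflect d d' → (a * b * d).l2Sq ≤ K * (q a' * q b' * (d'.weight ρ hρ).l2Sq) := by
    intro a b d a' b' d' ha hb hd
    rw [ha.l2Sq_mul_mul hb hd]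
    exact l2Sq_mul_mul_le hρ hσ hρ0 hρt (fun x => mul_ne_zero (hW0 x) (hρ0 x))
      (fun x => ENNReal.mul_ne_top (hWt x) (hρt x)) hK _ _ _
  set A : ℝ≥0∞ := q F₁ * q F₂ * q F₃ * q F₄ * q F₅ with hA
  set Y₄ := F₄.reflect * F₅ with hY₄
  set Y₃ := F₃ * Y₄ with hY₃
  set Y₂ := F₂.reflect * Y₃ with hY₂
  change ∫⁻ x, (W x * (ρ x)⁻¹ * (F₁ * Y₂).1 x) ^ 2 ∂μ ≤ (c ^ 4 * 5 * K) ^ 2 * A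
  set Z₄ := D F₄.reflect * F₅ + F₄.reflect * D F₅ with hZ₄
  set Z₃ := D F₃ * Y₄ + F₃ * Z₄ with hZ₃
  set Z₂ := D F₂.reflect * Y₃ + F₂.reflect * Z₃ with hZ₂
  have L₄ : ∀ ξ, W ξ * Y₄.1 ξ ≤ c * Z₄.1 ξ := fun ξ => by
    have := mul_lconvolution_le (μ := μ) hW hc le_rfl F₄.reflect.2 F₅.2 (D F₅).2
      (fun ξ => (one_mul (W ξ * F₅.1 ξ)).ge) ξ
    rwa [mul_one] at this
  have L₃ : ∀ ξ, W ξ * Y₃.1 ξ ≤ (c * c) * Z₃.1 ξ :=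
    mul_lconvolution_le (μ := μ) hW hc hc1 F₃.2 Y₄.2 Z₄.2 L₄
  have L₂ : ∀ ξ, W ξ * Y₂.1 ξ ≤ (c * (c * c)) * Z₂.1 ξ :=
    mul_lconvolution_le (μ := μ) hW hc (one_le_mul hc1 hc1) F₂.reflect.2 Y₃.2 Z₃.2 L₃
  have L₁ : ∀ ξ, W ξ * (F₁ * Y₂).1 ξ ≤
      (c * (c * (c * c))) * ((D F₁ * Y₂).1 ξ + (F₁ * Z₂).1 ξ) :=
    mul_lconvolution_le (μ := μ) hW hc (one_le_mul hc1 (one_le_mul hc1 hc1)) F₁.2 Y₂.2 Z₂.2 L₂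
  have expand : ∀ ξ, (D F₁ * Y₂).1 ξ + (F₁ * Z₂).1 ξ =
      (D F₁ * Y₂).1 ξ + ((F₁ * (D F₂.reflect * Y₃)).1 ξ + ((F₁ * (F₂.reflect * (D F₃ * Y₄))).1 ξ +
        ((F₁ * (F₂.reflect * (F₃ * (D F₄.reflect * F₅)))).1 ξ +
          (F₁ * (F₂.reflect * (F₃ * (F₄.reflect * D F₅)))).1 ξ))) := by
    intro ξ
    simp only [hZ₂, hZ₃, hZ₄, mul_add_eq, add_val]
  refine lintegral_sq_le_of_duality
    ((hW.mul hρ.inv).mul (F₁ * Y₂).2) fun h hh => ?_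
  set H : ConvFun μ := ⟨fun x => (ρ x)⁻¹ * h x, hρ.inv.mul hh⟩ with hH
  have hHn : (H.weight ρ hρ).l2Sq = ∫⁻ x, h x ^ 2 ∂μ := by
    simp only [ConvFun.l2Sq, weight, hH, ← mul_assoc, ENNReal.mul_inv_cancel (hρ0 _) (hρt _), one_mul]
  have term : ∀ {a u v p r : ConvFun μ} {a' u' v' p' r' : ConvFun μ} (z : ConvFun μ),
      EqUpToReflect a (D a') → EqUpToReflect u u' → EqUpToReflect v v' → EqUpToReflect p p' →
      EqUpToReflect r r' → z = a * u * v * p * r → q a' * q u' * q v' * q p' * q r' = A →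
      ∫⁻ x, H.1 x * z.1 x ∂μ ≤ K * (A * ∫⁻ x, h x ^ 2 ∂μ) ^ (1 / (2:ℝ)) := by
    intro a u v p r a' u' v' p' r' z ha hu hv hp hr hz hA'
    have h1 := ConvFun.lintegral_mul_sq_le H a u v p r z hz
    have h2 := T hp hr (Or.inr rfl : EqUpToReflect H.reflect H)
    have h3 := T hu hv ha
    rw [hDq] at h3
    rw [hHn] at h2
    have h4 : (∫⁻ x, H.1 x * z.1 x ∂μ) ^ 2 ≤ K ^ 2 * (A * ∫⁻ x, h x ^ 2 ∂μ) := by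
      refine (h1.trans (mul_le_mul' h2 h3)).trans_eq ?_
      rw [← hA']
      ring
    have h5 := ENNReal.rpow_le_rpow h4 (by norm_num : (0:ℝ) ≤ 1 / 2)
    rw [ENNReal.mul_rpow_of_nonneg _ _ (by norm_num), ← ENNReal.rpow_natCast,
      ← ENNReal.rpow_natCast, ← ENNReal.rpow_mul, ← ENNReal.rpow_mul] at h5
    norm_num at h5 ⊢
    exact h5
  have eR : ∀ f : ConvFun μ, EqUpToReflect f.reflect f := fun f => Or.inr rfl
  have eI : ∀ f : ConvFun μ, EqUpToReflect f f := fun f => Or.inl rfl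
  have hpt : ∀ x, h x * (W x * (ρ x)⁻¹ * (F₁ * Y₂).1 x) ≤
      c ^ 4 * (H.1 x * ((D F₁ * Y₂).1 x + (F₁ * Z₂).1 x)) := by
    intro x
    calc h x * (W x * (ρ x)⁻¹ * (F₁ * Y₂).1 x) = H.1 x * (W x * (F₁ * Y₂).1 x) := by
          simp only [hH]; ring
      _ ≤ H.1 x * ((c * (c * (c * c))) * ((D F₁ * Y₂).1 x + (F₁ * Z₂).1 x)) :=
          mul_le_mul' le_rfl (L₁ x)
      _ = _ := by ring
  have hsum : ∫⁻ x, h x * (W x * (ρ x)⁻¹ * (F₁ * Y₂).1 x) ∂μ ≤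
      c ^ 4 * (5 * (K * (A * ∫⁻ x, h x ^ 2 ∂μ) ^ (1 / (2:ℝ)))) := by
    refine (lintegral_mono hpt).trans ?_
    simp only [expand, mul_add]
    have m : ∀ z : ConvFun μ, Measurable fun x => H.1 x * z.1 x := fun z => H.2.mul z.2
    rw [lintegral_add_left ((m _).const_mul _), lintegral_add_left ((m _).const_mul _),
      lintegral_add_left ((m _).const_mul _), lintegral_add_left ((m _).const_mul _)]
    simp only [lintegral_const_mul _ (m _)]
    simp only [← mul_add]
    refine mul_le_mul' le_rfl ?_
    rw [show ∀ y : ℝ≥0∞, 5 * y = y + (y + (y + (y + y))) from fun y => by ring]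
    refine add_le_add ?_ (add_le_add ?_ (add_le_add ?_ (add_le_add ?_ ?_)))
    · exact term (u := F₂.reflect) (v := F₃) (p := F₄.reflect) (r := F₅) _ (eI (D F₁)) (eR _) (eI _)
        (eR _) (eI _) (by simp only [hY₂, hY₃, hY₄]; ac_rfl) (by rw [hA])
    · exact term (u := F₁) (v := F₃) (p := F₄.reflect) (r := F₅) _ (eR (D F₂)) (eI _) (eI _)
        (eR _) (eI _) (by simp only [hY₃, hY₄, hDreflect]; ac_rfl) (by rw [hA]; ring)
    · exact term (u := F₁) (v := F₂.reflect) (p := F₄.reflect) (r := F₅) _ (eI (D F₃)) (eI _) (eR _)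
        (eR _) (eI _) (by simp only [hY₄]; ac_rfl) (by rw [hA]; ring)
    · exact term (u := F₁) (v := F₂.reflect) (p := F₃) (r := F₅) _ (eR (D F₄)) (eI _) (eR _)
        (eI _) (eI _) (by simp only [hDreflect]; ac_rfl) (by rw [hA]; ring)
    · exact term (u := F₁) (v := F₂.reflect) (p := F₃) (r := F₄.reflect) _ (eI (D F₅)) (eI _) (eR _)
        (eI _) (eR _) (by ac_rfl) (by rw [hA]; ring)
  refine (pow_le_pow_left' hsum 2).trans_eq ?_
  have hsq : ∀ y : ℝ≥0∞, (y ^ (1 / (2:ℝ))) ^ 2 = y := fun y => by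
    rw [← ENNReal.rpow_natCast, ← ENNReal.rpow_mul]; norm_num
  rw [mul_pow, mul_pow, mul_pow K, hsq]
  ring

end ConvolutionAlgebra

section PlaneWave

/-- The character `e^{2πi(kx + ηt)}` of `Λ × ℝ`; points are written `(t, x)`. -/
def planeWave (ξ : ℤ × ℝ) (z : ℝ × AddCircle (1:ℝ)) : ℂ :=
  fourier ξ.1 z.2 * Complex.exp (2 * Real.pi * ξ.2 * z.1 * Complex.I)

theorem planeWave_add (ξ ζ : ℤ × ℝ) (z : ℝ × AddCircle (1:ℝ)) :
    planeWave (ξ + ζ) z = planeWave ξ z * planeWave ζ z := by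
  simp only [planeWave, Prod.fst_add, Prod.snd_add, fourier_add, ofReal_add]
  rw [mul_mul_mul_comm, ← Complex.exp_add]
  ring_nf

theorem norm_planeWave (ξ : ℤ × ℝ) (z : ℝ × AddCircle (1:ℝ)) : ‖planeWave ξ z‖ = 1 := by
  have h : ‖Complex.exp (2 * Real.pi * ξ.2 * z.1 * Complex.I)‖ = 1 := by
    rw [show (2 * Real.pi * ξ.2 * z.1 * Complex.I : ℂ) =
      ((2 * Real.pi * ξ.2 * z.1 : ℝ) : ℂ) * Complex.I by push_cast; ring]
    exact Complex.norm_exp_ofReal_mul_I _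
  rw [planeWave, norm_mul, h, fourier_apply, Circle.norm_coe, mul_one]

theorem conj_planeWave (ξ : ℤ × ℝ) (z : ℝ × AddCircle (1:ℝ)) :
    (starRingEnd ℂ) (planeWave ξ z) = planeWave (-ξ) z := by
  simp only [planeWave, map_mul, Prod.fst_neg, Prod.snd_neg, fourier_neg, ← Complex.exp_conj,
    conj_I, conj_ofReal, map_ofNat, ofReal_neg]
  ring_nf

theorem planeWave_translate (ξ : ℤ × ℝ) (t : ℝ) (x a : AddCircle (1:ℝ)) :
    planeWave ξ (t, x - a) = fourier ξ.1 (-a) * planeWave ξ (t, x) := by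
  simp only [planeWave, fourier_apply, sub_eq_add_neg, smul_add, AddCircle.toCircle_add,
    Circle.coe_mul]
  ring

@[fun_prop]
theorem continuous_planeWave_apply (ξ : ℤ × ℝ) : Continuous (planeWave ξ) := by
  unfold planeWave
  fun_prop

theorem continuous_planeWave :
    Continuous fun p : (ℤ × ℝ) × (ℝ × AddCircle (1:ℝ)) => planeWave p.1 p.2 := by
  have hf : Continuous fun p : ℤ × AddCircle (1:ℝ) => (fourier p.1 p.2 : ℂ) := by
    simp only [fourier_apply]
    fun_prop
  unfold planeWave
  exact (hf.comp (by fun_prop : Continuous fun p : (ℤ × ℝ) × (ℝ × AddCircle (1:ℝ)) =>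
    (p.1.1, p.2.2))).mul (by fun_prop)

/-- The spacetime Fourier transform, as a single integral over `ℝ × Λ`. -/
def planeFT (H : ℝ × AddCircle (1:ℝ) → ℂ) (ξ : ℤ × ℝ) : ℂ :=
  ∫ z, H z * planeWave (-ξ) z

theorem Integrable.mul_planeWave {H : ℝ × AddCircle (1:ℝ) → ℂ} (hH : Integrable H) (ξ : ℤ × ℝ) :
    Integrable fun z => H z * planeWave ξ z :=
  hH.mul_bdd (c := 1) (by fun_prop) (.of_forall fun z => (norm_planeWave ξ z).le)

theorem spacetimeFT_eq_planeFT {v : AddCircle (1:ℝ) → ℝ → ℂ}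
    (hv : Integrable fun z : ℝ × AddCircle (1:ℝ) => v z.2 z.1) (k : ℤ) (η : ℝ) :
    spacetimeFT v k η = planeFT (fun z => v z.2 z.1) (k, η) := by
  rw [planeFT, Measure.volume_eq_prod, integral_prod _ (by
    simpa only [Measure.volume_eq_prod] using Integrable.mul_planeWave hv _)]
  refine integral_congr_ae (.of_forall fun t => integral_congr_ae (.of_forall fun x => ?_))
  simp only [planeWave, Prod.fst_neg, Prod.snd_neg, ofReal_neg]
  ring_nf

/-- The function with Fourier density `m`. -/
def IsFourierIntegral (u : ℝ × AddCircle (1:ℝ) → ℂ) (m : ℤ × ℝ → ℂ) : Prop :=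
  Integrable m freqMeasure ∧ ∀ z, u z = ∫ ξ, m ξ * planeWave ξ z ∂freqMeasure

theorem IsFourierIntegral.conj {u : ℝ × AddCircle (1:ℝ) → ℂ} {m : ℤ × ℝ → ℂ}
    (h : IsFourierIntegral u m) :
    IsFourierIntegral (fun z => (starRingEnd ℂ) (u z)) (fun ξ => (starRingEnd ℂ) (m (-ξ))) := by
  refine ⟨?_, fun z => ?_⟩
  · exact (LinearIsometryEquiv.integrable_comp_iff conjLIE).2 h.1.comp_neg
  · beta_reduce
    rw [h.2 z, ← integral_conj, ← integral_neg_eq_self]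
    simp [conj_planeWave]

theorem IsFourierIntegral.translate {u : ℝ × AddCircle (1:ℝ) → ℂ} {m : ℤ × ℝ → ℂ}
    (h : IsFourierIntegral u m) (a : AddCircle (1:ℝ)) :
    IsFourierIntegral (fun z => u (z.1, z.2 - a)) (fun ξ => m ξ * fourier ξ.1 (-a)) := by
  refine ⟨?_, fun z => ?_⟩
  · refine h.1.mul_bdd (c := 1) ?_ (.of_forall fun ξ => ?_)
    · exact (measurable_from_prod_countable_right fun k =>
        (measurable_const : Measurable fun _ : ℝ => (fourier k (-a) : ℂ))).aestronglyMeasurable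
    · rw [fourier_apply, Circle.norm_coe]
  · beta_reduce
    rw [h.2]
    simp only [planeWave_translate, mul_assoc]

theorem IsFourierIntegral.integrable_mul {u H : ℝ × AddCircle (1:ℝ) → ℂ} {m : ℤ × ℝ → ℂ}
    (h : IsFourierIntegral u m) (hH : Integrable H) (hu : Continuous u) :
    Integrable fun z => u z * H z := by
  refine hH.bdd_mul (c := ∫ ξ, ‖m ξ‖ ∂freqMeasure) (by fun_prop) (.of_forall fun z => ?_)
  rw [h.2]
  refine (norm_integral_le_integral_norm _).trans_eq ?_
  simp [norm_planeWave]

/-- The Fourier transform of a product is dominated by the convolution of the absolute values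
of the Fourier transforms. -/
theorem IsFourierIntegral.enorm_planeFT_mul_le {u H : ℝ × AddCircle (1:ℝ) → ℂ} {m : ℤ × ℝ → ℂ}
    (h : IsFourierIntegral u m) (hH : Integrable H) (ξ : ℤ × ℝ) :
    ‖planeFT (fun z => u z * H z) ξ‖ₑ ≤
      ((fun ζ => ‖m ζ‖ₑ) ⋆ₗ[freqMeasure] (fun ζ => ‖planeFT H ζ‖ₑ)) ξ := by
  have key : planeFT (fun z => u z * H z) ξ =
      ∫ ζ, m ζ * planeFT H (-ζ + ξ) ∂freqMeasure := by
    have hint : Integrable (fun p : (ℝ × AddCircle (1:ℝ)) × (ℤ × ℝ) =>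
        (H p.1 * m p.2) * planeWave (-(-p.2 + ξ)) p.1) (volume.prod freqMeasure) := by
      refine (hH.mul_prod h.1).mul_bdd (c := 1) ?_ (.of_forall fun p => (norm_planeWave _ _).le)
      exact (continuous_planeWave.comp (by fun_prop : Continuous
        fun p : (ℝ × AddCircle (1:ℝ)) × (ℤ × ℝ) => (-(-p.2 + ξ), p.1))).aestronglyMeasurable
    calc planeFT (fun z => u z * H z) ξ
        = ∫ z, ∫ ζ, (H z * m ζ) * planeWave (-(-ζ + ξ)) z ∂freqMeasure := by
          unfold planeFT
          refine integral_congr_ae (.of_forall fun z => ?_)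
          simp only [h.2 z]
          rw [mul_assoc, ← integral_mul_const]
          refine integral_congr_ae (.of_forall fun ζ => ?_)
          simp only [neg_add, neg_neg, planeWave_add]
          ring
      _ = ∫ ζ, (∫ z, (H z * m ζ) * planeWave (-(-ζ + ξ)) z) ∂freqMeasure :=
          integral_integral_swap hint
      _ = _ := by
          refine integral_congr_ae (.of_forall fun ζ => ?_)
          simp only [planeFT, ← integral_const_mul]
          refine integral_congr_ae (.of_forall fun z => ?_)
          simp only
          ring
  rw [key, lconvolution_def]
  refine (enorm_integral_le_lintegral_enorm _).trans_eq ?_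
  simp only [enorm_mul]

end PlaneWave

section BoxDecay

/-- Smooth functions of `(x, t)` that are `1`-periodic in `x` and vanish for `|t| > R`. -/
structure IsPeriodicBump (R : ℝ) (u : ℝ × ℝ → ℂ) : Prop where
  contDiff : ContDiff ℝ (⊤ : ℕ∞) u
  periodic : ∀ p, u (p + (1, 0)) = u p
  support : ∀ p : ℝ × ℝ, R < |p.2| → u p = 0

theorem IsPeriodicBump.fderiv_apply {R : ℝ} {u : ℝ × ℝ → ℂ} (h : IsPeriodicBump R u)
    (e : ℝ × ℝ) : IsPeriodicBump R fun p => fderiv ℝ u p e where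
  contDiff := (h.contDiff.fderiv_right (m := (⊤ : ℕ∞)) (by simp)).clm_apply contDiff_const
  periodic p := by
    have : (fun q => u (q + (1, 0))) = u := funext h.periodic
    rw [← fderiv_comp_add_right, this]
  support p hp := by
    have : u =ᶠ[nhds p] fun _ => 0 := by
      have hopen : IsOpen {q : ℝ × ℝ | R < |q.2|} :=
        isOpen_lt continuous_const (by fun_prop)
      filter_upwards [hopen.mem_nhds hp] with q hq using h.support q hq
    rw [this.fderiv_eq]
    simp

/-- The character `e^{-2πi(kx + ηt)}` in the coordinates `(x, t)` of the plane. -/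
def boxWave (k : ℤ) (η : ℝ) (p : ℝ × ℝ) : ℂ :=
  Complex.exp (-(2 * Real.pi * (k * p.1 + η * p.2)) * Complex.I)

theorem norm_boxWave (k : ℤ) (η : ℝ) (p : ℝ × ℝ) : ‖boxWave k η p‖ = 1 := by
  rw [boxWave, show (-(2 * Real.pi * (k * p.1 + η * p.2)) * Complex.I : ℂ) =
    ((-(2 * Real.pi * (k * p.1 + η * p.2)) : ℝ) : ℂ) * Complex.I by push_cast; ring]
  exact Complex.norm_exp_ofReal_mul_I _

@[fun_prop]
theorem continuous_boxWave (k : ℤ) (η : ℝ) : Continuous (boxWave k η) := by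
  unfold boxWave
  fun_prop

theorem boxWave_one (k : ℤ) (η t : ℝ) : boxWave k η (1, t) = boxWave k η (0, t) := by
  rw [boxWave, boxWave, Complex.exp_eq_exp_iff_exists_int]
  refine ⟨-k, ?_⟩
  push_cast
  ring

/-- The Fourier integral over a box containing one period of the support. -/
def boxFT (R : ℝ) (u : ℝ × ℝ → ℂ) (k : ℤ) (η : ℝ) : ℂ :=
  ∫ t in (-(R + 1))..(R + 1), ∫ x in (0:ℝ)..1, u (x, t) * boxWave k η (x, t)

theorem IsPeriodicBump.boxFT_fderiv_fst {R : ℝ} {u : ℝ × ℝ → ℂ} (h : IsPeriodicBump R u)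
    (k : ℤ) (η : ℝ) : boxFT R (fun p => fderiv ℝ u p (1, 0)) k η =
      2 * Real.pi * k * Complex.I * boxFT R u k η := by
  have hc := h.contDiff.continuous
  have hc' := (h.fderiv_apply (1, 0)).contDiff.continuous
  unfold boxFT
  rw [← intervalIntegral.integral_const_mul]
  refine intervalIntegral.integral_congr fun t _ => ?_
  simp only
  rw [← intervalIntegral.integral_const_mul, ← sub_eq_zero, ← intervalIntegral.integral_sub
    (Continuous.intervalIntegrable (by fun_prop) _ _)
    (Continuous.intervalIntegrable (by fun_prop) _ _)]
  have hd : ∀ x : ℝ, HasDerivAt (fun x : ℝ => u (x, t) * boxWave k η (x, t))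
      (fderiv ℝ u (x, t) (1, 0) * boxWave k η (x, t) -
        2 * Real.pi * k * Complex.I * (u (x, t) * boxWave k η (x, t))) x := by
    intro x
    have h1 : HasDerivAt (fun x : ℝ => u (x, t)) (fderiv ℝ u (x, t) (1, 0)) x := by
      have := (h.contDiff.differentiable (by simp) (x, t)).hasFDerivAt
      exact this.comp_hasDerivAt x ((hasDerivAt_id x).prodMk (hasDerivAt_const x t))
    have h2 : HasDerivAt (fun x : ℝ => boxWave k η (x, t))
        (-(2 * Real.pi * k * Complex.I) * boxWave k η (x, t)) x := by
      have h3 : HasDerivAt (fun x : ℝ => (-(2 * Real.pi * (k * (x:ℂ) + η * (t:ℂ))) * Complex.I))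
          (-(2 * Real.pi * k * Complex.I)) x := by
        have := ((((hasDerivAt_id x).ofReal_comp.const_mul (k:ℂ)).add_const ((η:ℂ) * t)).const_mul
          (2 * (Real.pi:ℂ))).neg.mul_const Complex.I
        exact this.congr_deriv (by push_cast; ring)
      exact h3.cexp.congr_deriv (mul_comm _ _)
    exact (h1.mul h2).congr_deriv (by ring)
  rw [intervalIntegral.integral_eq_sub_of_hasDerivAt (fun x _ => hd x)
    (Continuous.intervalIntegrable (by fun_prop) _ _), boxWave_one]
  have := h.periodic (0, t)
  simp only [Prod.mk_add_mk, zero_add, add_zero] at this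
  rw [this, sub_self]

theorem IsPeriodicBump.boxFT_fderiv_snd {R : ℝ} (hR : 0 ≤ R) {u : ℝ × ℝ → ℂ}
    (h : IsPeriodicBump R u) (k : ℤ) (η : ℝ) : boxFT R (fun p => fderiv ℝ u p (0, 1)) k η =
      2 * Real.pi * η * Complex.I * boxFT R u k η := by
  have hc := h.contDiff.continuous
  have hc' := (h.fderiv_apply (0, 1)).contDiff.continuous
  have hsw : ∀ w : ℝ × ℝ → ℂ, Continuous w → boxFT R w k η =
      ∫ x in (0:ℝ)..1, ∫ t in (-(R + 1))..(R + 1), w (x, t) * boxWave k η (x, t) := by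
    intro w hw
    refine intervalIntegral_intervalIntegral_swap ?_
    have : Continuous (Function.uncurry fun t x : ℝ => w (x, t) * boxWave k η (x, t)) := by
      unfold Function.uncurry
      fun_prop
    exact (this.continuousOn.integrableOn_compact (μ := volume)
      (isCompact_uIcc.prod isCompact_uIcc)).mono_set
        (Set.prod_mono Set.uIoc_subset_uIcc Set.uIoc_subset_uIcc)
  rw [hsw _ hc', hsw _ hc, ← intervalIntegral.integral_const_mul]
  refine intervalIntegral.integral_congr fun x _ => ?_
  rw [← intervalIntegral.integral_const_mul, ← sub_eq_zero, ← intervalIntegral.integral_sub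
    (Continuous.intervalIntegrable (by fun_prop) _ _)
    (Continuous.intervalIntegrable (by fun_prop) _ _)]
  have hd : ∀ t : ℝ, HasDerivAt (fun t : ℝ => u (x, t) * boxWave k η (x, t))
      (fderiv ℝ u (x, t) (0, 1) * boxWave k η (x, t) -
        2 * Real.pi * η * Complex.I * (u (x, t) * boxWave k η (x, t))) t := by
    intro t
    have h1 : HasDerivAt (fun t : ℝ => u (x, t)) (fderiv ℝ u (x, t) (0, 1)) t := by
      have := (h.contDiff.differentiable (by simp) (x, t)).hasFDerivAt
      exact this.comp_hasDerivAt t ((hasDerivAt_const t x).prodMk (hasDerivAt_id t))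
    have h2 : HasDerivAt (fun t : ℝ => boxWave k η (x, t))
        (-(2 * Real.pi * η * Complex.I) * boxWave k η (x, t)) t := by
      have h3 : HasDerivAt (fun t : ℝ => (-(2 * Real.pi * (k * (x:ℂ) + η * (t:ℂ))) * Complex.I))
          (-(2 * Real.pi * η * Complex.I)) t := by
        have := ((((hasDerivAt_id t).ofReal_comp.const_mul (η:ℂ)).const_add ((k:ℂ) * x)).const_mul
          (2 * (Real.pi:ℂ))).neg.mul_const Complex.I
        exact this.congr_deriv (by push_cast; ring)
      exact h3.cexp.congr_deriv (mul_comm _ _)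
    exact (h1.mul h2).congr_deriv (by ring)
  rw [intervalIntegral.integral_eq_sub_of_hasDerivAt (fun t _ => hd t)
    (Continuous.intervalIntegrable (by fun_prop) _ _), h.support (x, R + 1), h.support]
  · simp
  · simp only
    rw [abs_neg, abs_of_nonneg (by linarith)]
    linarith
  · simp only
    rw [abs_of_nonneg (by linarith)]
    linarith

theorem IsPeriodicBump.exists_norm_boxFT_le {R : ℝ} {u : ℝ × ℝ → ℂ}
    (h : IsPeriodicBump R u) : ∃ C : ℝ, ∀ k η, ‖boxFT R u k η‖ ≤ C := by
  obtain ⟨C, hC⟩ := ((isCompact_uIcc (a := (0:ℝ)) (b := 1)).prod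
    (isCompact_uIcc (a := -(R + 1)) (b := R + 1))).exists_bound_of_continuousOn
    h.contDiff.continuous.continuousOn
  refine ⟨C * |1 - 0| * |(R + 1) - -(R + 1)|, fun k η => ?_⟩
  refine intervalIntegral.norm_integral_le_of_norm_le_const fun t ht => ?_
  refine intervalIntegral.norm_integral_le_of_norm_le_const fun x hx => ?_
  rw [norm_mul, norm_boxWave, mul_one]
  exact hC (x, t) ⟨Set.uIoc_subset_uIcc hx, Set.uIoc_subset_uIcc ht⟩

/-- Quadratic decay of the Fourier integral in each frequency. -/
theorem IsPeriodicBump.exists_norm_boxFT_mul_le {R : ℝ} (hR : 0 ≤ R) {u : ℝ × ℝ → ℂ}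
    (h : IsPeriodicBump R u) :
    ∃ C : ℝ, ∀ (k : ℤ) (η : ℝ), (1 + (k:ℝ) ^ 2) * (1 + η ^ 2) * ‖boxFT R u k η‖ ≤ C := by
  have decay_fst : ∀ {w : ℝ × ℝ → ℂ}, IsPeriodicBump R w →
      ∃ C : ℝ, ∀ (k : ℤ) (η : ℝ), (1 + (k:ℝ) ^ 2) * ‖boxFT R w k η‖ ≤ C := by
    intro w hw
    obtain ⟨C₀, h₀⟩ := hw.exists_norm_boxFT_le
    obtain ⟨C₁, h₁⟩ := ((hw.fderiv_apply (1, 0)).fderiv_apply (1, 0)).exists_norm_boxFT_le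
    refine ⟨C₀ + C₁, fun k η => ?_⟩
    have e := h₁ k η
    rw [(hw.fderiv_apply (1, 0)).boxFT_fderiv_fst, hw.boxFT_fderiv_fst, ← mul_assoc,
      norm_mul, norm_mul (2 * Real.pi * k * Complex.I : ℂ)] at e
    have hn : ‖(2 * Real.pi * k * Complex.I : ℂ)‖ = 2 * Real.pi * |(k:ℝ)| := by
      simp [abs_of_pos Real.pi_pos]
    rw [hn] at e
    have hk : (k:ℝ) ^ 2 ≤ 2 * Real.pi * |(k:ℝ)| * (2 * Real.pi * |(k:ℝ)|) := by
      have : |(k:ℝ)| ≤ 2 * Real.pi * |(k:ℝ)| := by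
        nlinarith [Real.pi_gt_three, abs_nonneg (k:ℝ)]
      rw [← sq_abs]
      nlinarith [abs_nonneg (k:ℝ)]
    nlinarith [h₀ k η, norm_nonneg (boxFT R w k η)]
  obtain ⟨C₀, h₀⟩ := decay_fst h
  obtain ⟨C₁, h₁⟩ := decay_fst ((h.fderiv_apply (0, 1)).fderiv_apply (0, 1))
  refine ⟨C₀ + C₁, fun k η => ?_⟩
  have e := h₁ k η
  rw [(h.fderiv_apply (0, 1)).boxFT_fderiv_snd hR, h.boxFT_fderiv_snd hR, ← mul_assoc,
    norm_mul, norm_mul (2 * Real.pi * η * Complex.I : ℂ)] at e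
  have hn : ‖(2 * Real.pi * η * Complex.I : ℂ)‖ = 2 * Real.pi * |η| := by
    simp [abs_of_pos Real.pi_pos]
  rw [hn] at e
  have hk : η ^ 2 ≤ 2 * Real.pi * |η| * (2 * Real.pi * |η|) := by
    have : |η| ≤ 2 * Real.pi * |η| := by
      nlinarith [Real.pi_gt_three, abs_nonneg η]
    rw [← sq_abs]
    nlinarith [abs_nonneg η]
  have hp : 0 ≤ (1 + (k:ℝ) ^ 2) * ‖boxFT R u k η‖ := by positivity
  nlinarith [h₀ k η, mul_le_mul_of_nonneg_left hk hp]

end BoxDecay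

section Inversion

/-- Smooth functions on `Λ × ℝ` with compact support in time. -/
structure IsTestFunction (v : AddCircle (1:ℝ) → ℝ → ℂ) : Prop where
  contDiff : ContDiff ℝ (⊤ : ℕ∞) (fun p : ℝ × ℝ => v ((p.1 : ℝ) : AddCircle (1:ℝ)) p.2)
  support : ∃ R : ℝ, ∀ (x : AddCircle (1:ℝ)) (t : ℝ), R ≤ |t| → v x t = 0

variable {v : AddCircle (1:ℝ) → ℝ → ℂ}

theorem IsTestFunction.continuous (hv : IsTestFunction v) :
    Continuous fun z : ℝ × AddCircle (1:ℝ) => v z.2 z.1 := by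
  have hq : IsOpenQuotientMap (Prod.map id ((↑) : ℝ → AddCircle (1:ℝ)) : ℝ × ℝ → _) :=
    IsOpenQuotientMap.id.prodMap QuotientAddGroup.isOpenQuotientMap_mk
  rw [← hq.continuous_comp_iff]
  exact hv.contDiff.continuous.comp continuous_swap

theorem IsTestFunction.hasCompactSupport (hv : IsTestFunction v) :
    HasCompactSupport fun z : ℝ × AddCircle (1:ℝ) => v z.2 z.1 := by
  obtain ⟨R, hR⟩ := hv.support
  refine HasCompactSupport.intro
    ((isCompact_Icc (a := -R) (b := R)).prod (isCompact_univ (X := AddCircle (1:ℝ)))) ?_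
  intro z hz
  refine hR _ _ (le_of_lt ?_)
  by_contra! h
  exact hz ⟨abs_le.1 h, trivial⟩

theorem IsTestFunction.integrable (hv : IsTestFunction v) :
    Integrable fun z : ℝ × AddCircle (1:ℝ) => v z.2 z.1 :=
  hv.continuous.integrable_of_hasCompactSupport hv.hasCompactSupport

theorem IsTestFunction.exists_isPeriodicBump (hv : IsTestFunction v) :
    ∃ R : ℝ, 0 ≤ R ∧
      IsPeriodicBump R fun p : ℝ × ℝ => v ((p.1 : ℝ) : AddCircle (1:ℝ)) p.2 := by
  obtain ⟨R, hR⟩ := hv.support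
  refine ⟨max R 0, le_max_right _ _, hv.contDiff, fun p => ?_, fun p hp =>
    hR _ _ ((le_max_left _ _).trans hp.le)⟩
  simp

theorem spacetimeFT_eq_boxFT {R : ℝ}
    (h : IsPeriodicBump R fun p : ℝ × ℝ => v ((p.1 : ℝ) : AddCircle (1:ℝ)) p.2)
    (k : ℤ) (η : ℝ) : spacetimeFT v k η =
      boxFT R (fun p : ℝ × ℝ => v ((p.1 : ℝ) : AddCircle (1:ℝ)) p.2) k η := by
  have hx : ∀ t : ℝ, (∫ x : AddCircle (1:ℝ), v x t * fourier (-k) x *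
      Complex.exp (-(2 * Real.pi * η * t) * Complex.I)) =
      ∫ x in (0:ℝ)..1, v (x : AddCircle (1:ℝ)) t * boxWave k η (x, t) := by
    intro t
    have := UnitAddCircle.intervalIntegral_preimage 0 fun x : AddCircle (1:ℝ) =>
      v x t * fourier (-k) x * Complex.exp (-(2 * Real.pi * η * t) * Complex.I)
    rw [zero_add] at this
    rw [← this]
    refine intervalIntegral.integral_congr fun x _ => ?_
    simp only [boxWave, fourier_coe_apply]
    rw [mul_assoc, ← Complex.exp_add]
    congr 2
    push_cast
    ring
  simp only [spacetimeFT, boxFT, hx]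
  refine (intervalIntegral.integral_eq_integral_of_support_subset fun t ht => ?_).symm
  by_contra hn
  refine ht ?_
  have : R < |t| := by
    by_contra! hle
    rw [abs_le] at hle
    exact hn ⟨by linarith, by linarith⟩
  have h0 : ∀ x : ℝ, v (x : AddCircle (1:ℝ)) t = 0 := fun x => h.support (x, t) this
  simp [h0]

theorem continuous_planeFT {H : ℝ × AddCircle (1:ℝ) → ℂ} (hH : Integrable H) :
    Continuous (planeFT H) := by
  refine continuous_of_dominated (bound := fun z => ‖H z‖)
    (fun ξ => (Integrable.mul_planeWave hH _).aestronglyMeasurable)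
    (fun ξ => .of_forall fun z => by rw [norm_mul, norm_planeWave, mul_one]) hH.norm
    (.of_forall fun z => continuous_const.mul ?_)
  exact continuous_planeWave.comp (by fun_prop : Continuous fun ξ : ℤ × ℝ => (-ξ, z))

theorem IsTestFunction.continuous_spacetimeFT (hv : IsTestFunction v) :
    Continuous fun ξ : ℤ × ℝ => spacetimeFT v ξ.1 ξ.2 := by
  simp only [spacetimeFT_eq_planeFT hv.integrable]
  exact continuous_planeFT hv.integrable

theorem IsTestFunction.integrable_spacetimeFT (hv : IsTestFunction v) :
    Integrable (fun ξ : ℤ × ℝ => spacetimeFT v ξ.1 ξ.2) freqMeasure := by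
  obtain ⟨R, hR, hb⟩ := hv.exists_isPeriodicBump
  obtain ⟨C, hC⟩ := hb.exists_norm_boxFT_mul_le hR
  have hsum : Integrable (fun k : ℤ => C * (1 + (k:ℝ) ^ 2)⁻¹) Measure.count := by
    refine Integrable.const_mul ?_ C
    rw [integrable_count_iff]
    refine Summable.of_norm_bounded_eventually (g := fun k : ℤ => ((k:ℝ) ^ 2)⁻¹) ?_ ?_
    · simpa using Real.summable_one_div_int_pow.2 (le_refl 2)
    · filter_upwards [Filter.eventually_cofinite_ne 0] with k hk
      rw [norm_norm, Real.norm_of_nonneg (by positivity)]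
      have : (k:ℝ) ≠ 0 := by exact_mod_cast hk
      gcongr
      linarith
  refine (hsum.mul_prod integrable_inv_one_add_sq).mono'
    hv.continuous_spacetimeFT.aestronglyMeasurable (.of_forall fun ξ => ?_)
  rw [spacetimeFT_eq_boxFT hb, mul_assoc, ← mul_inv, ← div_eq_mul_inv, le_div_iff₀ (by positivity),
    mul_comm]
  exact hC _ _

theorem fourier_fourierCoeff_eq_spacetimeFT (k : ℤ) :
    FourierTransform.fourier (fun t => fourierCoeff (fun x => v x t) k) = spacetimeFT v k := by
  ext η
  rw [Real.fourier_real_eq_integral_exp_smul, spacetimeFT]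
  refine integral_congr_ae (.of_forall fun t => ?_)
  simp only [fourierCoeff, AddCircle.integral_haarAddCircle, inv_one, one_smul, smul_eq_mul]
  rw [← integral_const_mul]
  refine integral_congr_ae (.of_forall fun x => ?_)
  push_cast
  ring_nf

theorem fourierCoeff_eq_integral (k : ℤ) (t : ℝ) : fourierCoeff (fun x => v x t) k =
    ∫ x : AddCircle (1:ℝ), fourier (-k) x * v x t := by
  simp only [fourierCoeff, AddCircle.integral_haarAddCircle, inv_one, one_smul, smul_eq_mul]

theorem IsTestFunction.continuous_fourierCoeff (hv : IsTestFunction v) (k : ℤ) :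
    Continuous fun t => fourierCoeff (fun x => v x t) k := by
  simp only [fourierCoeff_eq_integral]
  have := continuous_parametric_integral_of_continuous (μ := (volume : Measure (AddCircle (1:ℝ))))
    (f := fun (t : ℝ) (x : AddCircle (1:ℝ)) => fourier (-k) x * v x t) (by
      exact ((map_continuous (fourier (-k))).comp continuous_snd).mul hv.continuous) isCompact_univ
  simpa using this

theorem IsTestFunction.integrable_fourierCoeff (hv : IsTestFunction v) (k : ℤ) :
    Integrable fun t => fourierCoeff (fun x => v x t) k := by
  refine (hv.continuous_fourierCoeff k).integrable_of_hasCompactSupport ?_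
  obtain ⟨R, hR⟩ := hv.support
  refine HasCompactSupport.intro (isCompact_Icc (a := -R) (b := R)) fun t ht => ?_
  have h0 : ∀ x, v x t = 0 := fun x => hR x t (le_of_lt (by
    by_contra! h
    exact ht (abs_le.1 h)))
  simp [fourierCoeff, h0]

theorem IsTestFunction.integrable_spacetimeFT_right (hv : IsTestFunction v) (k : ℤ) :
    Integrable (spacetimeFT v k) :=
  Measure.ae_count_iff.1 hv.integrable_spacetimeFT.prod_right_ae k

theorem IsTestFunction.integral_spacetimeFT (hv : IsTestFunction v) (k : ℤ) (t : ℝ) :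
    ∫ η, spacetimeFT v k η * Complex.exp (2 * Real.pi * η * t * Complex.I) =
      fourierCoeff (fun x => v x t) k := by
  have := congrFun ((hv.continuous_fourierCoeff k).fourierInv_fourier_eq
    (hv.integrable_fourierCoeff k) (by
      rw [fourier_fourierCoeff_eq_spacetimeFT]
      exact hv.integrable_spacetimeFT_right k)) t
  rw [fourier_fourierCoeff_eq_spacetimeFT, Real.fourierInv_eq'] at this
  rw [← this]
  refine integral_congr_ae (.of_forall fun η => ?_)
  simp only [smul_eq_mul]
  rw [mul_comm]
  congr 2
  simp
  ring

theorem IsTestFunction.summable_fourierCoeff (hv : IsTestFunction v) (t : ℝ) :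
    Summable (fourierCoeff fun x => v x t) := by
  have := hv.integrable_spacetimeFT.integral_norm_prod_left
  rw [integrable_count_iff] at this
  refine Summable.of_norm_bounded this fun k => ?_
  rw [← hv.integral_spacetimeFT]
  refine (norm_integral_le_integral_norm _).trans (le_trans (le_of_eq ?_) (le_abs_self _))
  refine integral_congr_ae (.of_forall fun η => ?_)
  simp only [norm_mul]
  rw [show (2 * Real.pi * η * t * Complex.I : ℂ) =
      ((2 * Real.pi * η * t : ℝ) : ℂ) * Complex.I by push_cast; ring,
    Complex.norm_exp_ofReal_mul_I, mul_one]

/-- Fourier inversion on `Λ × ℝ`. -/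
theorem IsTestFunction.isFourierIntegral (hv : IsTestFunction v) :
    IsFourierIntegral (fun z => v z.2 z.1) fun ξ => spacetimeFT v ξ.1 ξ.2 := by
  refine ⟨hv.integrable_spacetimeFT, fun z => ?_⟩
  have hint : Integrable (fun ξ : ℤ × ℝ => spacetimeFT v ξ.1 ξ.2 * planeWave ξ z)
      freqMeasure := by
    refine hv.integrable_spacetimeFT.mul_bdd (c := 1) ?_
      (.of_forall fun ξ => (norm_planeWave ξ z).le)
    exact (continuous_planeWave.comp
      (by fun_prop : Continuous fun ξ : ℤ × ℝ => (ξ, z))).aestronglyMeasurable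
  rw [integral_prod _ hint, integral_countable hint.integral_prod_left]
  have hcont : Continuous fun x => v x z.1 := by
    have := hv.continuous
    exact this.comp (by fun_prop : Continuous fun x : AddCircle (1:ℝ) => (z.1, x))
  have hs := has_pointwise_sum_fourier_series_of_summable
    (f := ⟨fun x => v x z.1, hcont⟩) (hv.summable_fourierCoeff z.1) z.2
  refine hs.tsum_eq.symm.trans ?_
  refine tsum_congr fun k => ?_
  simp only [ContinuousMap.coe_mk, count_real_singleton, one_smul, smul_eq_mul, planeWave]
  rw [← hv.integral_spacetimeFT, ← integral_mul_const]
  refine integral_congr_ae (.of_forall fun η => ?_)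
  simp only
  ring

end Inversion

section Triangle

variable {G : Type*} [AddCommGroup G] [MeasurableSpace G] [MeasurableAdd₂ G] [MeasurableNeg G]
  {μ : Measure G} [SFinite μ] [μ.IsAddLeftInvariant] [μ.IsNegInvariant]

theorem quasiMeasurePreserving_neg_sub :
    Measure.QuasiMeasurePreserving (fun p : G × G => -p.1 - p.2) (μ.prod μ) μ := by
  have h := (Measure.measurePreserving_neg μ).quasiMeasurePreserving.comp
    (Measure.quasiMeasurePreserving_snd.comp
      (measurePreserving_prod_add μ μ).quasiMeasurePreserving)
  convert h using 1
  ext p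
  simp [sub_eq_add_neg, add_comm]

/-- A Young-type inequality for a triangle of kernels, with three `L^{3/2}` norms. -/
theorem lintegral_triangle_le_s13 {f₁ f₂ f₃ : G → ℝ≥0∞} (h₁ : AEMeasurable f₁ μ)
    (h₂ : AEMeasurable f₂ μ) (h₃ : AEMeasurable f₃ μ) :
    ∫⁻ p : G × G, f₁ p.1 * f₂ p.2 * f₃ (-p.1 - p.2) ∂(μ.prod μ) ≤
      (∫⁻ x, f₁ x ^ (3 / 2 : ℝ) ∂μ) ^ (2 / 3 : ℝ) * (∫⁻ x, f₂ x ^ (3 / 2 : ℝ) ∂μ) ^ (2 / 3 : ℝ) *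
        (∫⁻ x, f₃ x ^ (3 / 2 : ℝ) ∂μ) ^ (2 / 3 : ℝ) := by
  have g₁ := h₁.pow_const (3 / 2 : ℝ)
  have g₂ := h₂.pow_const (3 / 2 : ℝ)
  have g₃ := h₃.pow_const (3 / 2 : ℝ)
  have q₁ : AEMeasurable (fun p : G × G => f₁ p.1 ^ (3 / 2 : ℝ)) (μ.prod μ) := g₁.comp_fst
  have q₂ : AEMeasurable (fun p : G × G => f₂ p.2 ^ (3 / 2 : ℝ)) (μ.prod μ) := g₂.comp_snd
  have q₃ : AEMeasurable (fun p : G × G => f₃ (-p.1 - p.2) ^ (3 / 2 : ℝ)) (μ.prod μ) :=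
    g₃.comp_quasiMeasurePreserving quasiMeasurePreserving_neg_sub
  have q₁₃ : AEMeasurable (fun p : G × G => f₁ p.1 ^ (3 / 2 : ℝ) * f₃ (-p.1 - p.2) ^ (3 / 2 : ℝ))
      (μ.prod μ) := q₁.mul q₃
  have q₂₃ : AEMeasurable (fun p : G × G => f₂ p.2 ^ (3 / 2 : ℝ) * f₃ (-p.1 - p.2) ^ (3 / 2 : ℝ))
      (μ.prod μ) := q₂.mul q₃
  have hhold := ENNReal.lintegral_prod_norm_pow_le (μ := μ.prod μ) (Finset.univ : Finset (Fin 3))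
    (f := ![fun p => f₁ p.1 ^ (3 / 2 : ℝ) * f₂ p.2 ^ (3 / 2 : ℝ),
      fun p => f₁ p.1 ^ (3 / 2 : ℝ) * f₃ (-p.1 - p.2) ^ (3 / 2 : ℝ),
      fun p => f₂ p.2 ^ (3 / 2 : ℝ) * f₃ (-p.1 - p.2) ^ (3 / 2 : ℝ)])
    (by
      intro i _
      fin_cases i
      · exact q₁.mul q₂
      · exact q₁₃
      · exact q₂₃) (p := fun _ => 1 / 3) (by simp) (by intro i _; norm_num)
  have hroot : ∀ a : ℝ≥0∞, a ^ (1 / 3 : ℝ) * a ^ (1 / 3 : ℝ) = a ^ (2 / 3 : ℝ) := fun a => by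
    rw [← ENNReal.rpow_add_of_nonneg _ _ (by norm_num) (by norm_num)]
    norm_num
  have hcancel : ∀ a : ℝ≥0∞, (a ^ (3 / 2 : ℝ)) ^ (2 / 3 : ℝ) = a := fun a => by
    rw [← ENNReal.rpow_mul]
    norm_num
  have htri : ∀ a b c : ℝ≥0∞, (a * b) ^ (1 / 3 : ℝ) * (a * c) ^ (1 / 3 : ℝ) *
      (b * c) ^ (1 / 3 : ℝ) = a ^ (2 / 3 : ℝ) * b ^ (2 / 3 : ℝ) * c ^ (2 / 3 : ℝ) := fun a b c => by
    simp only [ENNReal.mul_rpow_of_nonneg _ _ (by norm_num : (0:ℝ) ≤ 1 / 3), ← hroot]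
    ring
  simp only [Fin.prod_univ_three, Matrix.cons_val_zero, Matrix.cons_val_one, Matrix.cons_val,
    htri, hcancel] at hhold
  refine hhold.trans_eq ?_
  rw [lintegral_prod_mul g₁ g₂, lintegral_prod _ q₁₃, lintegral_prod_symm _ q₂₃]
  have e₁ : ∀ x, ∫⁻ y, f₁ x ^ (3 / 2 : ℝ) * f₃ (-x - y) ^ (3 / 2 : ℝ) ∂μ =
      f₁ x ^ (3 / 2 : ℝ) * ∫⁻ y, f₃ y ^ (3 / 2 : ℝ) ∂μ := fun x => by
    rw [lintegral_const_mul'' _ ?_, lintegral_sub_left_eq_self fun y => f₃ y ^ (3 / 2 : ℝ)]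
    exact g₃.comp_quasiMeasurePreserving (quasiMeasurePreserving_sub_left μ _)
  have e₂ : ∀ y, ∫⁻ x, f₂ y ^ (3 / 2 : ℝ) * f₃ (-x - y) ^ (3 / 2 : ℝ) ∂μ =
      f₂ y ^ (3 / 2 : ℝ) * ∫⁻ y, f₃ y ^ (3 / 2 : ℝ) ∂μ := fun y => by
    simp only [show ∀ x, -x - y = -y - x from fun x => by abel]
    rw [lintegral_const_mul'' _ ?_, lintegral_sub_left_eq_self fun y => f₃ y ^ (3 / 2 : ℝ)]
    exact g₃.comp_quasiMeasurePreserving (quasiMeasurePreserving_sub_left μ _)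
  simp only [e₁, e₂]
  rw [lintegral_mul_const'' _ g₁, lintegral_mul_const'' _ g₂, htri]

end Triangle

section TriangleNonlinearity

/-- The kernel of the triangle nonlinearity in the coordinates `(x - y, y - z)`. -/
def triangleKernel (w₁ w₂ w₃ : AddCircle (1:ℝ) → ℝ) (p : AddCircle (1:ℝ) × AddCircle (1:ℝ)) : ℂ :=
  w₁ p.1 * w₂ p.2 * w₃ (-p.1 - p.2)

/-- The integrand of the triangle nonlinearity for a fixed position `p` of the two translates. -/
def translatedProduct (v : Fin 5 → AddCircle (1:ℝ) → ℝ → ℂ)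
    (p : AddCircle (1:ℝ) × AddCircle (1:ℝ)) (z : ℝ × AddCircle (1:ℝ)) : ℂ :=
  v 0 (z.2 - p.1) z.1 * ((starRingEnd ℂ) (v 1 (z.2 - p.1) z.1) *
    (v 2 (z.2 - (p.1 + p.2)) z.1 * ((starRingEnd ℂ) (v 3 (z.2 - (p.1 + p.2)) z.1) * v 4 z.2 z.1)))

theorem M2_eq_integral_integral (w₁ w₂ w₃ : AddCircle (1:ℝ) → ℝ)
    (v : Fin 5 → AddCircle (1:ℝ) → ℝ → ℂ) (z : ℝ × AddCircle (1:ℝ)) :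
    M2 w₁ w₂ w₃ v z.2 z.1 =
      ∫ a, ∫ b, triangleKernel w₁ w₂ w₃ (a, b) * translatedProduct v (a, b) z := by
  rw [M2, ← integral_sub_left_eq_self _ volume z.2]
  refine integral_congr_ae (.of_forall fun a => ?_)
  beta_reduce
  rw [← integral_sub_left_eq_self _ volume (z.2 - a)]
  refine integral_congr_ae (.of_forall fun b => ?_)
  simp only [triangleKernel, translatedProduct, sub_sub_cancel, sub_sub,
    show z.2 - (a + b) - z.2 = -a - b by abel]
  rw [show z.2 - (a + (z.2 - (a + b))) = b by abel]
  ring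

theorem aestronglyMeasurable_triangleKernel {w₁ w₂ w₃ : AddCircle (1:ℝ) → ℝ}
    (h₁ : AEStronglyMeasurable w₁) (h₂ : AEStronglyMeasurable w₂) (h₃ : AEStronglyMeasurable w₃) :
    AEStronglyMeasurable (triangleKernel w₁ w₂ w₃) (volume.prod volume) := by
  have g : ∀ {w : AddCircle (1:ℝ) → ℝ}, AEStronglyMeasurable w →
      AEStronglyMeasurable fun x => (w x : ℂ) := fun h =>
    Complex.continuous_ofReal.comp_aestronglyMeasurable h
  exact ((g h₁).comp_fst.mul (g h₂).comp_snd).mul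
    ((g h₃).comp_quasiMeasurePreserving quasiMeasurePreserving_neg_sub)

theorem lintegral_enorm_triangleKernel_le {w₁ w₂ w₃ : AddCircle (1:ℝ) → ℝ}
    (h₁ : AEStronglyMeasurable w₁) (h₂ : AEStronglyMeasurable w₂) (h₃ : AEStronglyMeasurable w₃) :
    ∫⁻ p, ‖triangleKernel w₁ w₂ w₃ p‖ₑ ∂(volume.prod volume) ≤
      eLpNorm w₁ (3/2) volume * eLpNorm w₂ (3/2) volume * eLpNorm w₃ (3/2) volume := by
  have hp : ((3 / 2 : ℝ≥0∞)).toReal = 3 / 2 := by simp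
  have h0 : (3 / 2 : ℝ≥0∞) ≠ 0 := by simp
  have ht : (3 / 2 : ℝ≥0∞) ≠ ⊤ := by finiteness
  simp only [eLpNorm_eq_lintegral_rpow_enorm_toReal h0 ht, hp,
    show (1 / (3 / 2) : ℝ) = 2 / 3 by norm_num]
  refine le_trans (le_of_eq ?_) (lintegral_triangle_le_s13 h₁.enorm h₂.enorm h₃.enorm)
  refine lintegral_congr fun p => ?_
  simp only [triangleKernel, enorm_mul]
  simp only [← ofReal_norm, Complex.norm_real]

theorem integrable_triangleKernel {w₁ w₂ w₃ : AddCircle (1:ℝ) → ℝ}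
    (h₁ : MemLp w₁ (3/2) volume) (h₂ : MemLp w₂ (3/2) volume) (h₃ : MemLp w₃ (3/2) volume) :
    Integrable (triangleKernel w₁ w₂ w₃) (volume.prod volume) := by
  refine ⟨aestronglyMeasurable_triangleKernel h₁.1 h₂.1 h₃.1,
    (lintegral_enorm_triangleKernel_le h₁.1 h₂.1 h₃.1).trans_lt ?_⟩
  exact ENNReal.mul_lt_top (ENNReal.mul_lt_top h₁.2 h₂.2) h₃.2

theorem IsTestFunction.exists_norm_le {v : AddCircle (1:ℝ) → ℝ → ℂ} (hv : IsTestFunction v) :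
    ∃ C : ℝ, ∀ x t, ‖v x t‖ ≤ C := by
  obtain ⟨C, hC⟩ := hv.hasCompactSupport.exists_bound_of_continuous hv.continuous
  exact ⟨C, fun x t => hC (t, x)⟩

theorem integrable_triangleKernel_mul {w₁ w₂ w₃ : AddCircle (1:ℝ) → ℝ}
    (h₁ : MemLp w₁ (3/2) volume) (h₂ : MemLp w₂ (3/2) volume) (h₃ : MemLp w₃ (3/2) volume)
    {v : Fin 5 → AddCircle (1:ℝ) → ℝ → ℂ} (hv : ∀ j, IsTestFunction (v j)) :
    Integrable (fun q : (ℝ × AddCircle (1:ℝ)) × (AddCircle (1:ℝ) × AddCircle (1:ℝ)) =>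
      triangleKernel w₁ w₂ w₃ q.2 * translatedProduct v q.2 q.1)
      (volume.prod (volume.prod volume)) := by
  choose C hC using fun j => (hv j).exists_norm_le
  have hc : ∀ j, Continuous fun z : ℝ × AddCircle (1:ℝ) => v j z.2 z.1 := fun j => (hv j).continuous
  have hmain := (hv 4).integrable.mul_prod (integrable_triangleKernel h₁ h₂ h₃)
  have hbdd := hmain.mul_bdd (c := C 0 * C 1 * C 2 * C 3)
    (g := fun q : (ℝ × AddCircle (1:ℝ)) × (AddCircle (1:ℝ) × AddCircle (1:ℝ)) =>
      v 0 (q.1.2 - q.2.1) q.1.1 * (starRingEnd ℂ) (v 1 (q.1.2 - q.2.1) q.1.1) *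
      v 2 (q.1.2 - (q.2.1 + q.2.2)) q.1.1 *
        (starRingEnd ℂ) (v 3 (q.1.2 - (q.2.1 + q.2.2)) q.1.1)) ?_ (.of_forall fun q => ?_)
  · refine hbdd.congr (.of_forall fun q => ?_)
    simp only [translatedProduct]
    ring
  · have e₁ : Continuous fun q : (ℝ × AddCircle (1:ℝ)) × (AddCircle (1:ℝ) × AddCircle (1:ℝ)) =>
        (q.1.1, q.1.2 - q.2.1) := by fun_prop
    have e₂ : Continuous fun q : (ℝ × AddCircle (1:ℝ)) × (AddCircle (1:ℝ) × AddCircle (1:ℝ)) =>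
        (q.1.1, q.1.2 - (q.2.1 + q.2.2)) := by fun_prop
    exact ((((hc 0).comp e₁).mul (Complex.continuous_conj.comp ((hc 1).comp e₁))).mul
      ((hc 2).comp e₂)).mul (Complex.continuous_conj.comp ((hc 3).comp e₂))
      |>.aestronglyMeasurable
  · have hC0 : ∀ j, 0 ≤ C j := fun j => (norm_nonneg _).trans (hC j 0 0)
    have := hC0 0
    have := hC0 1
    have := hC0 2
    simp only [norm_mul, RCLike.norm_conj]
    gcongr <;> exact hC _ _ _

/-- The Fourier transform of each translated product is dominated by the quintic convolution. -/
theorem enorm_planeFT_translatedProduct_le {v : Fin 5 → AddCircle (1:ℝ) → ℝ → ℂ}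
    (hv : ∀ j, IsTestFunction (v j)) (p : AddCircle (1:ℝ) × AddCircle (1:ℝ)) (ξ : ℤ × ℝ) :
    ‖planeFT (translatedProduct v p) ξ‖ₑ ≤
      ((fun ζ => ‖spacetimeFT (v 0) ζ.1 ζ.2‖ₑ) ⋆ₗ[freqMeasure]
      ((fun ζ => ‖spacetimeFT (v 1) (-ζ).1 (-ζ).2‖ₑ) ⋆ₗ[freqMeasure]
      ((fun ζ => ‖spacetimeFT (v 2) ζ.1 ζ.2‖ₑ) ⋆ₗ[freqMeasure]
      ((fun ζ => ‖spacetimeFT (v 3) (-ζ).1 (-ζ).2‖ₑ) ⋆ₗ[freqMeasure]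
        (fun ζ => ‖spacetimeFT (v 4) ζ.1 ζ.2‖ₑ))))) ξ := by
  have hf : ∀ (k : ℤ) (a : AddCircle (1:ℝ)), ‖(fourier k a : ℂ)‖ₑ = 1 := fun k a => by
    rw [← ofReal_norm, fourier_apply, Circle.norm_coe, ENNReal.ofReal_one]
  have hstar : ∀ w : ℂ, ‖(starRingEnd ℂ) w‖ₑ = ‖w‖ₑ := fun w => by
    rw [← ofReal_norm, RCLike.norm_conj, ofReal_norm]
  have hcont : ∀ j a, Continuous fun z : ℝ × AddCircle (1:ℝ) => v j (z.2 - a) z.1 := fun j a =>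
    (hv j).continuous.comp (by fun_prop : Continuous
      fun z : ℝ × AddCircle (1:ℝ) => (z.1, z.2 - a))
  have hmul : ∀ (j : Fin 5) (a : AddCircle (1:ℝ)) {H : ℝ × AddCircle (1:ℝ) → ℂ}
      {g : ℤ × ℝ → ℝ≥0∞}, Integrable H → (∀ ζ, ‖planeFT H ζ‖ₑ ≤ g ζ) →
      Integrable (fun z => v j (z.2 - a) z.1 * H z) ∧
      ∀ ζ, ‖planeFT (fun z => v j (z.2 - a) z.1 * H z) ζ‖ₑ ≤
        ((fun ζ => ‖spacetimeFT (v j) ζ.1 ζ.2‖ₑ) ⋆ₗ[freqMeasure] g) ζ := by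
    intro j a H g hH hg
    have hI := (hv j).isFourierIntegral.translate a
    refine ⟨hI.integrable_mul hH (hcont j a), fun ζ => (hI.enorm_planeFT_mul_le hH ζ).trans ?_⟩
    exact lconvolution_mono (fun ζ => by rw [enorm_mul, hf, mul_one]) hg ζ
  have hmul' : ∀ (j : Fin 5) (a : AddCircle (1:ℝ)) {H : ℝ × AddCircle (1:ℝ) → ℂ}
      {g : ℤ × ℝ → ℝ≥0∞}, Integrable H → (∀ ζ, ‖planeFT H ζ‖ₑ ≤ g ζ) →
      Integrable (fun z => (starRingEnd ℂ) (v j (z.2 - a) z.1) * H z) ∧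
      ∀ ζ, ‖planeFT (fun z => (starRingEnd ℂ) (v j (z.2 - a) z.1) * H z) ζ‖ₑ ≤
        ((fun ζ => ‖spacetimeFT (v j) (-ζ).1 (-ζ).2‖ₑ) ⋆ₗ[freqMeasure] g) ζ := by
    intro j a H g hH hg
    have hI := ((hv j).isFourierIntegral.translate a).conj
    refine ⟨hI.integrable_mul hH (Complex.continuous_conj.comp (hcont j a)),
      fun ζ => (hI.enorm_planeFT_mul_le hH ζ).trans ?_⟩
    exact lconvolution_mono (fun ζ => by rw [hstar, enorm_mul, hf, mul_one]) hg ζ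
  have h4 : ∀ ζ : ℤ × ℝ, ‖planeFT (fun z => v 4 z.2 z.1) ζ‖ₑ ≤ ‖spacetimeFT (v 4) ζ.1 ζ.2‖ₑ :=
    fun ζ => by rw [spacetimeFT_eq_planeFT (hv 4).integrable]
  obtain ⟨i3, h3⟩ := hmul' 3 (p.1 + p.2) (hv 4).integrable h4
  obtain ⟨i2, h2⟩ := hmul 2 (p.1 + p.2) i3 h3
  obtain ⟨i1, h1⟩ := hmul' 1 p.1 i2 h2
  exact (hmul 0 p.1 i1 h1).2 ξ

/-- The Fourier transform of the triangle nonlinearity is dominated by the quintic convolution. -/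
theorem enorm_spacetimeFT_M2_le {w₁ w₂ w₃ : AddCircle (1:ℝ) → ℝ}
    (h₁ : MemLp w₁ (3/2) volume) (h₂ : MemLp w₂ (3/2) volume) (h₃ : MemLp w₃ (3/2) volume)
    {v : Fin 5 → AddCircle (1:ℝ) → ℝ → ℂ} (hv : ∀ j, IsTestFunction (v j)) (ξ : ℤ × ℝ) :
    ‖spacetimeFT (M2 w₁ w₂ w₃ v) ξ.1 ξ.2‖ₑ ≤
      eLpNorm w₁ (3/2) volume * eLpNorm w₂ (3/2) volume * eLpNorm w₃ (3/2) volume *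
      ((fun ζ => ‖spacetimeFT (v 0) ζ.1 ζ.2‖ₑ) ⋆ₗ[freqMeasure]
      ((fun ζ => ‖spacetimeFT (v 1) (-ζ).1 (-ζ).2‖ₑ) ⋆ₗ[freqMeasure]
      ((fun ζ => ‖spacetimeFT (v 2) ζ.1 ζ.2‖ₑ) ⋆ₗ[freqMeasure]
      ((fun ζ => ‖spacetimeFT (v 3) (-ζ).1 (-ζ).2‖ₑ) ⋆ₗ[freqMeasure]
        (fun ζ => ‖spacetimeFT (v 4) ζ.1 ζ.2‖ₑ))))) ξ := by
  have hint := integrable_triangleKernel_mul h₁ h₂ h₃ hv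
  have hκ := integrable_triangleKernel h₁ h₂ h₃
  choose C hC using fun j => (hv j).exists_norm_le
  have hM : (fun z : ℝ × AddCircle (1:ℝ) => M2 w₁ w₂ w₃ v z.2 z.1) = fun z =>
      ∫ p, triangleKernel w₁ w₂ w₃ p * translatedProduct v p z ∂(volume.prod volume) := by
    funext z
    have hz : Integrable (fun p => triangleKernel w₁ w₂ w₃ p * translatedProduct v p z)
        (volume.prod volume) := by
      refine hκ.mul_bdd (c := C 0 * (C 1 * (C 2 * (C 3 * C 4)))) ?_ (.of_forall fun p => ?_)
      · have hc : ∀ j, Continuous fun z : ℝ × AddCircle (1:ℝ) => v j z.2 z.1 := fun j =>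
          (hv j).continuous
        have e₁ : Continuous fun p : AddCircle (1:ℝ) × AddCircle (1:ℝ) =>
          (z.1, z.2 - p.1) := by fun_prop
        have e₂ : Continuous fun p : AddCircle (1:ℝ) × AddCircle (1:ℝ) =>
          (z.1, z.2 - (p.1 + p.2)) := by fun_prop
        exact (((hc 0).comp e₁).mul ((Complex.continuous_conj.comp ((hc 1).comp e₁)).mul
          (((hc 2).comp e₂).mul ((Complex.continuous_conj.comp ((hc 3).comp e₂)).mul
            continuous_const)))).aestronglyMeasurable
      · have hC0 : ∀ j, 0 ≤ C j := fun j => (norm_nonneg _).trans (hC j 0 0)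
        have := hC0 0
        have := hC0 1
        have := hC0 2
        have := hC0 3
        simp only [translatedProduct, norm_mul, RCLike.norm_conj]
        gcongr <;> exact hC _ _ _
    rw [M2_eq_integral_integral, integral_prod _ hz]
  have hMint : Integrable fun z : ℝ × AddCircle (1:ℝ) => M2 w₁ w₂ w₃ v z.2 z.1 := by
    rw [hM]
    exact hint.integral_prod_left
  have hFT : planeFT (fun z => M2 w₁ w₂ w₃ v z.2 z.1) ξ =
      ∫ p, triangleKernel w₁ w₂ w₃ p * planeFT (translatedProduct v p) ξ
        ∂(volume.prod volume) := by
    rw [hM, planeFT]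
    simp only [← integral_mul_const, planeFT, ← integral_const_mul, ← mul_assoc]
    refine integral_integral_swap ?_
    refine hint.mul_bdd (c := 1) ?_ (.of_forall fun q => (norm_planeWave (-ξ) q.1).le)
    exact ((continuous_planeWave_apply (-ξ)).comp continuous_fst).aestronglyMeasurable
  rw [spacetimeFT_eq_planeFT hMint, Prod.mk.eta, hFT]
  refine (enorm_integral_le_lintegral_enorm _).trans ?_
  simp only [enorm_mul]
  refine (lintegral_mono fun p => mul_le_mul_right
    (enorm_planeFT_translatedProduct_le hv p ξ) _).trans ?_
  rw [lintegral_mul_const'' _ hκ.1.enorm]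
  gcongr
  exact lintegral_enorm_triangleKernel_le h₁.1 h₂.1 h₃.1

end TriangleNonlinearity

section Assembly

theorem ofReal_weight_eq_sq (s b : ℝ) (ξ : ℤ × ℝ) (w : ℂ) :
    ENNReal.ofReal ((1 + |2 * Real.pi * (ξ.1:ℝ)|) ^ (2 * s) *
      (1 + |ξ.2 + 2 * Real.pi * (ξ.1:ℝ) ^ 2|) ^ (2 * b) * ‖w‖ ^ 2) =
      (spaceWeight s ξ * modWeight b ξ * ‖w‖ₑ) ^ 2 := by
  rw [spaceWeight, modWeight, ← ofReal_norm, ← ENNReal.ofReal_mul (by positivity),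
    ← ENNReal.ofReal_mul (by positivity), ← ENNReal.ofReal_pow (by positivity), mul_pow, mul_pow,
    mul_comm 2 s, mul_comm 2 b, Real.rpow_mul (by positivity), Real.rpow_mul (by positivity),
    Real.rpow_two, Real.rpow_two]

theorem Xnorm_eq_tsum (s b : ℝ) (v : AddCircle (1:ℝ) → ℝ → ℂ) :
    Xnorm s b v = (∑' k : ℤ, ∫⁻ η : ℝ, (spaceWeight s (k, η) * modWeight b (k, η) *
      ‖spacetimeFT v k η‖ₑ) ^ 2) ^ ((1:ℝ) / 2) := by
  simp only [Xnorm, ← ofReal_weight_eq_sq]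

theorem IsTestFunction.measurable_enorm_spacetimeFT {v : AddCircle (1:ℝ) → ℝ → ℂ}
    (hv : IsTestFunction v) : Measurable fun ξ : ℤ × ℝ => ‖spacetimeFT v ξ.1 ξ.2‖ₑ :=
  hv.continuous_spacetimeFT.measurable.enorm

theorem IsTestFunction.Xnorm_eq_lintegral {v : AddCircle (1:ℝ) → ℝ → ℂ} (hv : IsTestFunction v)
    (s b : ℝ) : Xnorm s b v = (∫⁻ ξ, (spaceWeight s ξ * modWeight b ξ *
      ‖spacetimeFT v ξ.1 ξ.2‖ₑ) ^ 2 ∂freqMeasure) ^ ((1:ℝ) / 2) := by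
  have := hv.measurable_enorm_spacetimeFT
  rw [lintegral_freqMeasure (by fun_prop), Xnorm_eq_tsum]

end Assembly

/-- **Global-in-time quintic multilinear estimate for the triangle nonlinearity** (proof of
Lemma A.7): for every `s > 0` there is `ε₀ ∈ (0,1/2)` such that for all `ε ∈ (0,ε₀)` there is
`C > 0` with
`‖ℳ₂(v₁,…,v₅)‖_{X^{s,−1/2+ε}} ≤ C ‖w₁‖_{L^{3/2}} ‖w₂‖_{L^{3/2}} ‖w₃‖_{L^{3/2}} ∏_j ‖v_j‖_{X^{s,1/2−ε}}`
for all `w₁, w₂, w₃ ∈ L^{3/2}(Λ;ℝ)` and all smooth `v_j : Λ × ℝ → ℂ` compactly supported in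
time. -/
theorem quintic_multilinear_estimate_triangle :
    ∀ s : ℝ, 0 < s → ∃ ε₀ : ℝ, 0 < ε₀ ∧ ε₀ < 1/2 ∧
    ∀ ε : ℝ, 0 < ε → ε < ε₀ → ∃ C : ℝ, 0 < C ∧
    ∀ w₁ w₂ w₃ : AddCircle (1:ℝ) → ℝ,
      MemLp w₁ (3/2) volume → MemLp w₂ (3/2) volume → MemLp w₃ (3/2) volume →
    ∀ v : Fin 5 → AddCircle (1:ℝ) → ℝ → ℂ,
      (∀ j, ContDiff ℝ (⊤ : ℕ∞) (fun p : ℝ × ℝ => v j ((p.1 : ℝ) : AddCircle (1:ℝ)) p.2)) →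
      (∀ j, ∃ R : ℝ, ∀ (x : AddCircle (1:ℝ)) (t : ℝ), R ≤ |t| → v j x t = 0) →
      Xnorm s (-(1/2) + ε) (M2 w₁ w₂ w₃ v) ≤
        ENNReal.ofReal C * eLpNorm w₁ (3/2) volume * eLpNorm w₂ (3/2) volume *
          eLpNorm w₃ (3/2) volume * ∏ j : Fin 5, Xnorm s (1/2 - ε) (v j) := by
  intro s hs
  refine ⟨min (1 / 40) (s / 36), by positivity, (min_le_left _ _).trans_lt (by norm_num), ?_⟩
  intro ε hε hε₀
  have hε₁ : ε ≤ 1 / 40 := hε₀.le.trans (min_le_left _ _)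
  have hε₂ : 36 * ε ≤ s := by linarith [hε₀.le.trans (min_le_right (1 / 40) (s / 36))]
  obtain ⟨K, hK, hKb⟩ := exists_lconvolution_weight_le hs hε hε₁ hε₂
  have hct : ENNReal.ofReal (2 ^ s) ^ 4 * 5 * K ≠ ⊤ := by finiteness
  refine ⟨(ENNReal.ofReal (2 ^ s) ^ 4 * 5 * K).toReal + 1, by positivity, ?_⟩
  intro w₁ w₂ w₃ h₁ h₂ h₃ v hsmooth hsupp
  have hv : ∀ j, IsTestFunction (v j) := fun j => ⟨hsmooth j, hsupp j⟩
  have hm := fun j => (hv j).measurable_enorm_spacetimeFT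
  have hquintic := lintegral_sq_quintic_le (measurable_spaceWeight s)
    (measurable_modWeight (1 / 2 - ε)) (modWeight_ne_zero _) (modWeight_ne_top _)
    (spaceWeight_ne_zero s) (spaceWeight_ne_top s) (spaceWeight_neg s)
    (ENNReal.one_le_ofReal.2 (Real.one_le_rpow one_le_two hs.le))
    (spaceWeight_add_le hs.le) hKb (hm 0) (hm 1) (hm 2) (hm 3) (hm 4)
  set N := eLpNorm w₁ (3/2) volume * eLpNorm w₂ (3/2) volume * eLpNorm w₃ (3/2) volume with hN
  set Q := (fun ζ : ℤ × ℝ => ‖spacetimeFT (v 0) ζ.1 ζ.2‖ₑ) ⋆ₗ[freqMeasure]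
      ((fun ζ => ‖spacetimeFT (v 1) (-ζ).1 (-ζ).2‖ₑ) ⋆ₗ[freqMeasure]
      ((fun ζ => ‖spacetimeFT (v 2) ζ.1 ζ.2‖ₑ) ⋆ₗ[freqMeasure]
      ((fun ζ => ‖spacetimeFT (v 3) (-ζ).1 (-ζ).2‖ₑ) ⋆ₗ[freqMeasure]
        (fun ζ => ‖spacetimeFT (v 4) ζ.1 ζ.2‖ₑ)))) with hQ
  have hmQ : Measurable Q := by
    have h1 := (hm 1).comp measurable_neg
    have h3 := (hm 3).comp measurable_neg
    exact measurable_lconvolution _ (hm 0) (measurable_lconvolution _ h1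
      (measurable_lconvolution _ (hm 2) (measurable_lconvolution _ h3 (hm 4))))
  have hhalf : ∀ y : ℝ≥0∞, (y ^ 2) ^ ((1:ℝ) / 2) = y := fun y => by
    rw [← ENNReal.rpow_natCast, ← ENNReal.rpow_mul]
    norm_num
  calc Xnorm s (-(1/2) + ε) (M2 w₁ w₂ w₃ v)
      ≤ (∑' k : ℤ, ∫⁻ η : ℝ, (N * (spaceWeight s (k, η) * (modWeight (1 / 2 - ε) (k, η))⁻¹ *
          Q (k, η))) ^ 2) ^ ((1:ℝ) / 2) := by
        rw [Xnorm_eq_tsum]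
        refine ENNReal.rpow_le_rpow (ENNReal.tsum_le_tsum fun k => lintegral_mono fun η =>
          pow_le_pow_left' ?_ 2) (by norm_num)
        rw [modWeight_inv, show -(1 / 2 - ε) = -(1 / 2) + ε by ring, mul_left_comm]
        gcongr
        exact enorm_spacetimeFT_M2_le h₁ h₂ h₃ hv (k, η)
    _ = (N ^ 2 * ∫⁻ ξ, (spaceWeight s ξ * (modWeight (1 / 2 - ε) ξ)⁻¹ * Q ξ) ^ 2
          ∂freqMeasure) ^ ((1:ℝ) / 2) := by
        rw [← lintegral_const_mul _ (by fun_prop), lintegral_freqMeasure (by fun_prop)]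
        simp only [mul_pow]
    _ ≤ _ := ENNReal.rpow_le_rpow (mul_le_mul' le_rfl hquintic) (by norm_num)
    _ = (ENNReal.ofReal (2 ^ s) ^ 4 * 5 * K) * N * ∏ j : Fin 5, Xnorm s (1/2 - ε) (v j) := by
        simp only [Fin.prod_univ_five, (hv _).Xnorm_eq_lintegral]
        simp only [ENNReal.mul_rpow_of_nonneg _ _ (by norm_num : (0:ℝ) ≤ 1 / 2), hhalf]
        ring
    _ ≤ _ := by
        rw [hN]
        simp only [← mul_assoc]
        gcongr
        rw [← ENNReal.ofReal_toReal hct]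
        exact ENNReal.ofReal_le_ofReal (by simp)

end
end
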